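/- arXiv:1411.3047 — 2 statements merged into one kernel-verified Lean document; each statement's English description precedes it below -/
import Mathlib

section
/- Fix positive integers Δ, g and a. If every Δ-regular finite simple graph with girth at least g admits an acyclic edge colouring with a colours, then every finite simple graph with maximum degree Δ and girth at least g also admits an acyclic edge colouring with a colours. -/
open SimpleGraph

/-- `c` is an acyclic edge colouring of `G` using colours from `{0, …, n-1}`:
every edge gets a colour `< n`, the colouring is proper (distinct edges sharing an
endpoint get different colours) and every cycle of `G` receives at least three colours. -/
def IsAcyclicEdgeColoring {V : Type} (G : SimpleGraph V) (n : ℕ) (c : Sym2 V → ℕ) : Prop :=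
  (∀ e ∈ G.edgeSet, c e < n) ∧
  (∀ e₁ ∈ G.edgeSet, ∀ e₂ ∈ G.edgeSet, e₁ ≠ e₂ → (∃ x, x ∈ e₁ ∧ x ∈ e₂) → c e₁ ≠ c e₂) ∧
  (∀ (v : V) (w : G.Walk v v), w.IsCycle → 3 ≤ (w.edges.map c).toFinset.card)

/-- The reduced words of length at most `n` over `I`, i.e. a ball in the `I`-regular tree. -/
abbrev ReducedWord (I : Type) (n : ℕ) : Type :=
  {w : List I // w.IsChain (· ≠ ·) ∧ w.length ≤ n}

namespace ReducedWord

variable {I : Type} {n : ℕ}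

open Classical in
/-- The involution of the reduced words adding or deleting the first letter `i`; words of
maximal length not starting with `i` are fixed. -/
noncomputable def toggle (i : I) (w : ReducedWord I n) : ReducedWord I n :=
  if h : w.1.head? = some i then
    ⟨w.1.tail, w.2.1.tail, (by simp; have := w.2.2; omega)⟩
  else if h' : w.1.length < n then
    ⟨i :: w.1, List.isChain_cons.2 ⟨fun y hy hiy => h (by subst hiy; exact hy), w.2.1⟩,
      by simpa using h'⟩
  else w

theorem toggle_of_lt {i : I} {w : ReducedWord I n} (h : w.1.head? ≠ some i)
    (h' : w.1.length < n) : (toggle i w).1 = i :: w.1 := by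
  simp [toggle, h, h']

theorem toggle_involutive (i : I) : Function.Involutive (toggle (n := n) i) := by
  rintro ⟨w, hw, hn⟩
  apply Subtype.ext
  by_cases h : w.head? = some i
  · obtain ⟨t, rfl⟩ : ∃ t, w = i :: t := by
      cases w with
      | nil => simp at h
      | cons a t => simp at h; exact ⟨t, by rw [h]⟩
    have ht : t.head? ≠ some i := fun h1 => (List.isChain_cons.1 hw).1 i (by simp [h1]) rfl
    have hlt : t.length < n := by simpa using hn
    simp [toggle, ht, hlt]
  · by_cases h' : w.length < n
    · simp [toggle, h, h']
    · simp [toggle, h, h']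

instance [Finite I] : Finite (ReducedWord I n) :=
  ((List.finite_length_le I n).subset fun _ h => h.2).to_subtype

end ReducedWord

/-- For every finite index set there is a finite group with involutions satisfying no nontrivial
relation of length at most `n`. -/
theorem exists_finite_group_involutions (I : Type) [Finite I] (n : ℕ) :
    ∃ (Γ : Type) (_ : Group Γ) (_ : Finite Γ) (s : I → Γ), (∀ i, s i * s i = 1) ∧
      ∀ L : List I, L.IsChain (· ≠ ·) → L.length ≤ n → (L.map s).prod = 1 → L = [] := by
  let s : I → Equiv.Perm (ReducedWord I n) := fun i => (ReducedWord.toggle_involutive i).toPerm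
  refine ⟨Equiv.Perm (ReducedWord I n), inferInstance, inferInstance, s, fun i => ?_, ?_⟩
  · ext1 w
    exact ReducedWord.toggle_involutive i w
  · have key : ∀ L : List I, L.IsChain (· ≠ ·) → L.length ≤ n →
        ((L.map s).prod ⟨[], List.isChain_nil, Nat.zero_le _⟩).1 = L := by
      intro L
      induction L with
      | nil => intro _ _; rfl
      | cons i L ih =>
        intro hc hl
        have hc' := List.isChain_cons.1 hc
        have hl' : L.length < n := by simpa using hl
        have e := ih hc'.2 hl'.le
        have h1 := ReducedWord.toggle_of_lt (i := i)
          (w := (L.map s).prod ⟨[], List.isChain_nil, Nat.zero_le _⟩)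
          (by rw [e]; exact fun h => hc'.1 i (by simp [h]) rfl) (by rwa [e])
        rw [e] at h1
        simpa [s] using h1
    intro L hc hl h
    have := key L hc hl
    rw [h] at this
    exact this.symm

namespace SimpleGraph

variable {V Γ : Type} [Group Γ] (G : SimpleGraph V) {K : V → Type} (s : (Σ v, K v) → Γ)

/-- Copies of `G` indexed by `Γ`, with each vertex `(v, x)` joined to `(v, x * s ⟨v, k⟩)`
for every `k : K v`. -/
def involutionCover (hs : ∀ i, s i * s i = 1) (hs' : ∀ i, s i ≠ 1) :
    SimpleGraph (V × Γ) where
  Adj p q := (G.Adj p.1 q.1 ∧ p.2 = q.2) ∨ ∃ k : K p.1, q = (p.1, p.2 * s ⟨p.1, k⟩)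
  symm := ⟨by
    rintro ⟨u, x⟩ ⟨v, y⟩ (⟨h, h'⟩ | ⟨k, h⟩)
    · exact Or.inl ⟨h.symm, h'.symm⟩
    · obtain ⟨rfl, rfl⟩ := Prod.mk.inj h
      exact Or.inr ⟨k, by simp [mul_assoc, hs]⟩⟩
  loopless := ⟨by
    rintro ⟨u, x⟩ (⟨h, -⟩ | ⟨k, h⟩)
    · exact h.ne rfl
    · exact hs' _ (by simpa using h)⟩

variable {G s} {hs : ∀ i, s i * s i = 1} {hs' : ∀ i, s i ≠ 1}

theorem ncard_neighborSet_involutionCover [Finite V] [∀ v, Finite (K v)]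
    (hinj : Function.Injective s) (u : V) (x : Γ) :
    ((G.involutionCover s hs hs').neighborSet (u, x)).ncard =
      (G.neighborSet u).ncard + Nat.card (K u) := by
  have e : (G.involutionCover s hs hs').neighborSet (u, x) =
      (fun v => (v, x)) '' G.neighborSet u ∪ Set.range fun k => (u, x * s ⟨u, k⟩) := by
    ext ⟨v, y⟩
    simp only [mem_neighborSet, involutionCover, Set.mem_union, Set.mem_image, Set.mem_range,
      Prod.mk.injEq]
    constructor
    · rintro (⟨h, rfl⟩ | ⟨k, rfl, rfl⟩)
      · exact Or.inl ⟨v, h, rfl, rfl⟩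
      · exact Or.inr ⟨k, rfl, rfl⟩
    · rintro (⟨_, h, rfl, rfl⟩ | ⟨k, rfl, rfl⟩)
      · exact Or.inl ⟨h, rfl⟩
      · exact Or.inr ⟨k, rfl, rfl⟩
  rw [e, Set.ncard_union_eq _ (Set.toFinite _) (Set.finite_range _),
    Set.ncard_image_of_injective _ (fun a b h => by simpa using h)]
  · congr 1
    rw [← Set.image_univ, Set.ncard_image_of_injective, Set.ncard_univ]
    intro k l h
    simpa using @hinj ⟨u, k⟩ ⟨u, l⟩ (by simpa using h)
  · rw [Set.disjoint_left]
    rintro _ ⟨v, hv, rfl⟩ ⟨k, hk⟩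
    exact hv.ne (Prod.mk.inj hk).1

/-- The letters read off along a trail form a reduced word. -/
theorem exists_reduced_word_of_isTrail {p q : V × Γ} (w : (G.involutionCover s hs hs').Walk p q)
    (hw : w.IsTrail) :
    ∃ L : List (Σ v, K v), L.IsChain (· ≠ ·) ∧ L.length ≤ w.length ∧
      q.2 = p.2 * (L.map s).prod ∧
      (∀ i ∈ L.head?, s((i.1, p.2), (i.1, p.2 * s i)) ∈ w.edges) ∧
      (L = [] → ∀ z ∈ w.support, z.2 = p.2) := by
  induction w with
  | nil => exact ⟨[], by simp, by simp, by simp, by simp, by simp⟩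
  | @cons p r q h w ih =>
    rw [Walk.isTrail_cons] at hw
    obtain ⟨L, hc, hl, hq, he, hn⟩ := ih hw.1
    rw [Walk.length_cons, Walk.edges_cons, Walk.support_cons]
    obtain ⟨-, h2⟩ | ⟨k, rfl⟩ : (G.Adj p.1 r.1 ∧ p.2 = r.2) ∨
        ∃ k : K p.1, r = (p.1, p.2 * s ⟨p.1, k⟩) := h
    · refine ⟨L, hc, by omega, by rw [h2, hq], fun i hi => ?_, fun h0 z hz => ?_⟩
      · rw [h2]
        exact List.mem_cons_of_mem _ (he i hi)
      · rw [List.mem_cons] at hz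
        rcases hz with rfl | hz
        · rfl
        · rw [hn h0 z hz, h2]
    · refine ⟨⟨p.1, k⟩ :: L, List.isChain_cons.2 ⟨?_, hc⟩, by simpa using hl,
        by rw [hq]; simp [mul_assoc], ?_, by simp⟩
      · rintro i hi rfl
        apply hw.2
        have := he _ hi
        rw [mul_assoc, hs, mul_one, Sym2.eq_swap] at this
        exact this
      · intro i hi
        obtain rfl : (⟨p.1, k⟩ : Σ v, K v) = i := by simpa using hi
        simp

theorem le_length_of_isCycle_involutionCover {g : ℕ} (hG : g ≤ G.girth)
    (hrel : ∀ L : List (Σ v, K v), L.IsChain (· ≠ ·) → L.length ≤ g → (L.map s).prod = 1 → L = [])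
    {p : V × Γ} (w : (G.involutionCover s hs hs').Walk p p) (hw : w.IsCycle) :
    g ≤ w.length := by
  by_contra! hlt
  obtain ⟨L, hc, hl, hq, -, hn⟩ := exists_reduced_word_of_isTrail w hw.isTrail
  have hsupp := hn (hrel L hc (by omega) (by simpa using hq))
  let S : Set (V × Γ) := {z | z.2 = p.2}
  let f : (G.involutionCover s hs hs').induce S →g G :=
    { toFun := fun z => z.1.1
      map_rel' := by
        rintro ⟨⟨u, x⟩, hx⟩ ⟨⟨v, y⟩, hy⟩ (⟨h, -⟩ | ⟨k, h⟩)
        · exact h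
        · obtain ⟨rfl, h⟩ := Prod.mk.inj h
          obtain rfl : x = p.2 := hx
          obtain rfl : y = p.2 := hy
          exact absurd (by simpa using h) (hs' ⟨_, k⟩) }
  have hf : Function.Injective f := by
    rintro ⟨⟨u, x⟩, hx⟩ ⟨⟨v, y⟩, hy⟩ h
    exact Subtype.ext (Prod.ext h (Eq.trans hx (Eq.symm hy)))
  have hind : (w.induce S hsupp).IsCycle := by
    rw [← Walk.isCycle_map_iff_of_injective
      (f := (Embedding.induce (G := G.involutionCover s hs hs') S).toHom)
      Subtype.val_injective, Walk.map_induce]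
    exact hw
  have h1 := ((Walk.isCycle_map_iff_of_injective hf).2 hind).girth_le_length
  have h2 : ((w.induce S hsupp).map f).length = w.length := by
    rw [Walk.length_map, ← Walk.length_map (Embedding.induce S).toHom, Walk.map_induce]
    rfl
  omega

end SimpleGraph

theorem IsAcyclicEdgeColoring.comap {V W : Type} {G : SimpleGraph V} {H : SimpleGraph W} {n : ℕ}
    {c : Sym2 W → ℕ} (hc : IsAcyclicEdgeColoring H n c) (f : G →g H)
    (hf : Function.Injective f) : IsAcyclicEdgeColoring G n fun e => c (e.map f) := by
  obtain ⟨h1, h2, h3⟩ := hc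
  refine ⟨fun e he => h1 _ (f.map_mem_edgeSet he), ?_, ?_⟩
  · rintro e₁ he₁ e₂ he₂ hne ⟨x, hx₁, hx₂⟩
    exact h2 _ (f.map_mem_edgeSet he₁) _ (f.map_mem_edgeSet he₂)
      (fun h => hne (Sym2.map.injective hf h))
      ⟨f x, Sym2.mem_map.2 ⟨x, hx₁, rfl⟩, Sym2.mem_map.2 ⟨x, hx₂, rfl⟩⟩
  · intro v w hw
    have := h3 _ (w.map f) ((Walk.isCycle_map_iff_of_injective hf).2 hw)
    rwa [Walk.edges_map, List.map_map] at this

/-- If every `Δ`-regular finite simple graph with girth at least `g` admits an acyclic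
edge colouring with `a` colours, then every finite simple graph with maximum degree `Δ`
and girth at least `g` also admits an acyclic edge colouring with `a` colours. -/
theorem statement2 (Δ g a : ℕ) (hΔ : 0 < Δ) (hg : 0 < g) (ha : 0 < a)
    (hreg : ∀ (V : Type) [Fintype V] [DecidableEq V]
        (G : SimpleGraph V) [DecidableRel G.Adj],
      G.IsRegularOfDegree Δ → (g : ℕ∞) ≤ G.girth →
        ∃ c : Sym2 V → ℕ, IsAcyclicEdgeColoring G a c) :
    ∀ (V : Type) [Fintype V] [DecidableEq V] (G : SimpleGraph V) [DecidableRel G.Adj],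
      G.maxDegree ≤ Δ → (g : ℕ∞) ≤ G.girth →
        ∃ c : Sym2 V → ℕ, IsAcyclicEdgeColoring G a c := by
  intro V _ _ G _ hmax hgirth
  classical
  have hgirth' : g ≤ G.girth := by exact_mod_cast hgirth
  let K : V → Type := fun v => Fin (Δ - G.degree v)
  obtain ⟨Γ, _, _, s, hs, hrel⟩ := exists_finite_group_involutions (Σ v, K v) (g + 2)
  have hs' : ∀ i, s i ≠ 1 := fun i h => by
    simpa using hrel [i] (by simp) (by simp) (by simpa using h)
  have hinj : Function.Injective s := by
    intro i j h
    by_contra hij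
    simpa using hrel [i, j] (by simpa using hij) (by simp) (by simp [h, hs])
  let H := G.involutionCover s hs hs'
  let f : G →g H := ⟨fun v => (v, 1), fun h => Or.inl ⟨h, rfl⟩⟩
  have hf : Function.Injective f := fun u v h => (Prod.mk.inj h).1
  have := Fintype.ofFinite Γ
  have hHreg : H.IsRegularOfDegree Δ := by
    rintro ⟨u, x⟩
    have h := ncard_neighborSet_involutionCover (G := G) (hs := hs) (hs' := hs') hinj u x
    rw [← Nat.card_coe_set_eq, ← Nat.card_coe_set_eq, Nat.card_eq_fintype_card,
      Nat.card_eq_fintype_card, card_neighborSet_eq_degree, card_neighborSet_eq_degree,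
      Nat.card_fin] at h
    have := G.degree_le_maxDegree u
    change H.degree (u, x) = _ at h
    omega
  have hHgirth : (g : ℕ∞) ≤ H.girth := by
    have hGc : ¬ G.IsAcyclic := fun h => by
      have := h.girth_eq_zero
      omega
    obtain ⟨v, w, hw, -⟩ := exists_girth_eq_length.2 hGc
    have hHc : ¬ H.IsAcyclic := fun h =>
      h (w.map f) ((Walk.isCycle_map_iff_of_injective hf).2 hw)
    obtain ⟨p, w', hw', he⟩ := exists_girth_eq_length.2 hHc
    rw [he]
    exact_mod_cast le_length_of_isCycle_involutionCover hgirth'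
      (fun L hc hl => hrel L hc (by omega)) w' hw'
  obtain ⟨c, hc⟩ := hreg (V × Γ) H hHreg hHgirth
  exact ⟨_, hc.comap f hf⟩
end

section
/- Let ε ∈ (0, 10⁻³]. There exist g = g(ε) and Δ₀ = Δ₀(ε) such that the following holds for every Δ ≥ Δ₀ and every Δ-regular finite simple graph G with girth at least g. Suppose {S_v : v ∈ V(G)} is a collection of subsets of {1, …, ⌊(1+ε)Δ⌋} satisfying: (A.1) for every vertex v, |S_v| ≤ 4εΔ/9; (A.2) for every edge e = uv, |S_u ∩ S_v| ≥ ε²Δ/18; and (A.3) for every vertex v and every colour c, the number of neighbours u of v with c ∈ S_u is at most εΔ/2. Then there exists a partial acyclic edge colouring χ of G with colours from {1, …, ⌊(1+ε)Δ⌋} such that: (B.1) every coloured edge e = uv has a colour in {1, …, ⌊(1+ε)Δ⌋} \ (S_u ∪ S_v); (B.2) for every vertex v and every colour c ∈ S_v, there are at most (ε²/18)²·Δ/128 neighbours u of v such that the edge uv is uncoloured and c ∈ S_u; and (B.3) every cycle C of G which can be made completely bicoloured by assigning to each uncoloured edge e = uv of C a colour from S_u ∩ S_v has at least 3 uncoloured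 edges. -/
open SimpleGraph Finset

/-- `χ` is a partial acyclic edge colouring of `G`: no two distinct edges sharing an
endpoint receive the same colour, and no cycle of `G` has all of its edges coloured
using only two colours. -/
def IsPartialAcyclicEdgeColoring {V : Type} (G : SimpleGraph V) (χ : Sym2 V → Option ℕ) :
    Prop :=
  (∀ e₁ ∈ G.edgeSet, ∀ e₂ ∈ G.edgeSet, e₁ ≠ e₂ → (∃ x, x ∈ e₁ ∧ x ∈ e₂) →
    ∀ c : ℕ, χ e₁ = some c → χ e₂ ≠ some c) ∧
  (∀ (v : V) (w : G.Walk v v), w.IsCycle →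
    ¬ ∃ c d : ℕ, ∀ e ∈ w.edges, χ e = some c ∨ χ e = some d)

/-- The cycle `w` can be made completely bicoloured by assigning to each of its
uncoloured edges `e` a colour satisfying the predicate `P e`: there is such an
assignment after which all edges of the cycle are coloured, only two colours appear on
the cycle, and the colouring is proper on the cycle (distinct edges of the cycle sharing
a vertex receive different colours). -/
def CycleCanBecomeBicolored {V : Type} (G : SimpleGraph V) (χ : Sym2 V → Option ℕ)
    (P : Sym2 V → ℕ → Prop) {v : V} (w : G.Walk v v) : Prop :=
  ∃ σ : Sym2 V → ℕ,
    (∀ e ∈ w.edges, χ e = none → P e (σ e)) ∧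
    (∃ c d : ℕ, ∀ e ∈ w.edges, (χ e).getD (σ e) = c ∨ (χ e).getD (σ e) = d) ∧
    (∀ e₁ ∈ w.edges, ∀ e₂ ∈ w.edges, e₁ ≠ e₂ → (∃ x, x ∈ e₁ ∧ x ∈ e₂) →
      (χ e₁).getD (σ e₁) ≠ (χ e₂).getD (σ e₂))

set_option linter.unusedSectionVars false

/-- The weight of `ω` under the product of Bernoulli measures with parameters `p i`. -/
noncomputable def bernoulliWeight {ι : Type} [Fintype ι] (p : ι → ℝ) (ω : ι → Bool) : ℝ :=
  ∏ i, if ω i then p i else 1 - p i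

/-- Expectation under the product of Bernoulli measures with parameters `p i`. -/
noncomputable def bernoulliExp {ι : Type} [Fintype ι] [DecidableEq ι] (p : ι → ℝ)
    (f : (ι → Bool) → ℝ) : ℝ :=
  ∑ ω, bernoulliWeight p ω * f ω

open Classical in
/-- Probability under the product of Bernoulli measures with parameters `p i`. -/
noncomputable def bernoulliProb {ι : Type} [Fintype ι] [DecidableEq ι] (p : ι → ℝ)
    (A : (ι → Bool) → Prop) : ℝ :=
  bernoulliExp p fun ω => if A ω then 1 else 0

open Classical in
/-- The configuration agreeing with `ω'` on `A` and with `ω` elsewhere. -/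
noncomputable def mergeOn {ι : Type} (A : Set ι) (ω' ω : ι → Bool) : ι → Bool :=
  fun i => if i ∈ A then ω' i else ω i

/-- `f` depends only on the coordinates in `A`. -/
def DependsOnlyOn {ι β : Type} (f : (ι → Bool) → β) (A : Set ι) : Prop :=
  ∀ ω ω', (∀ i ∈ A, ω i = ω' i) → f ω = f ω'


section Bernoulli

variable {ι : Type} [Fintype ι] [DecidableEq ι] {p : ι → ℝ}

theorem bernoulliWeight_nonneg (hp : ∀ i, 0 ≤ p i ∧ p i ≤ 1) (ω : ι → Bool) :
    0 ≤ bernoulliWeight p ω := by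
  refine Finset.prod_nonneg fun i _ => ?_
  have := hp i
  split_ifs <;> linarith

theorem bernoulliExp_prod (h : ι → Bool → ℝ) :
    bernoulliExp p (fun ω => ∏ i, h i (ω i)) =
      ∏ i, (p i * h i true + (1 - p i) * h i false) := by
  have key := Finset.prod_univ_sum (fun _ : ι => (Finset.univ : Finset Bool))
    (fun i b => (if b then p i else 1 - p i) * h i b)
  simp only [Fintype.sum_bool, Fintype.piFinset_univ, if_true, Bool.false_eq_true, if_false] at key
  rw [key]
  simp only [bernoulliExp, bernoulliWeight, Finset.prod_mul_distrib]

theorem bernoulliWeight_sum : ∑ ω, bernoulliWeight p ω = 1 := by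
  have := bernoulliExp_prod (p := p) (fun _ _ => 1)
  simpa [bernoulliExp] using this

theorem bernoulliExp_const (c : ℝ) : bernoulliExp p (fun _ => c) = c := by
  simp [bernoulliExp, ← Finset.sum_mul, bernoulliWeight_sum]

theorem bernoulliExp_mono (hp : ∀ i, 0 ≤ p i ∧ p i ≤ 1) {f g : (ι → Bool) → ℝ}
    (h : ∀ ω, f ω ≤ g ω) : bernoulliExp p f ≤ bernoulliExp p g :=
  Finset.sum_le_sum fun ω _ => mul_le_mul_of_nonneg_left (h ω) (bernoulliWeight_nonneg hp ω)

theorem bernoulliExp_add (f g : (ι → Bool) → ℝ) :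
    bernoulliExp p (fun ω => f ω + g ω) = bernoulliExp p f + bernoulliExp p g := by
  simp [bernoulliExp, mul_add, Finset.sum_add_distrib]

theorem bernoulliExp_const_mul (c : ℝ) (f : (ι → Bool) → ℝ) :
    bernoulliExp p (fun ω => c * f ω) = c * bernoulliExp p f := by
  simp only [bernoulliExp, Finset.mul_sum]
  exact Finset.sum_congr rfl fun _ _ => by ring

theorem bernoulliExp_neg (f : (ι → Bool) → ℝ) :
    bernoulliExp p (fun ω => - f ω) = - bernoulliExp p f := by
  simp [bernoulliExp]

theorem bernoulliExp_sub (f g : (ι → Bool) → ℝ) :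
    bernoulliExp p (fun ω => f ω - g ω) = bernoulliExp p f - bernoulliExp p g := by
  simp [bernoulliExp, mul_sub]

theorem bernoulliExp_sum {κ : Type} (s : Finset κ) (f : κ → (ι → Bool) → ℝ) :
    bernoulliExp p (fun ω => ∑ k ∈ s, f k ω) = ∑ k ∈ s, bernoulliExp p (f k) := by
  simp only [bernoulliExp, Finset.mul_sum]
  exact Finset.sum_comm

theorem mergeOn_of_mem {A : Set ι} {i : ι} (h : i ∈ A) (ω' ω : ι → Bool) :
    mergeOn A ω' ω i = ω' i := by simp [mergeOn, h]

theorem mergeOn_of_notMem {A : Set ι} {i : ι} (h : i ∉ A) (ω' ω : ι → Bool) :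
    mergeOn A ω' ω i = ω i := by simp [mergeOn, h]

theorem bernoulliExp_merge (A : Set ι) (f : (ι → Bool) → ℝ) :
    bernoulliExp p f =
      bernoulliExp p fun ω => bernoulliExp p fun ω' => f (mergeOn A ω' ω) := by
  let e : (ι → Bool) × (ι → Bool) → (ι → Bool) × (ι → Bool) :=
    fun x => (mergeOn A x.2 x.1, mergeOn A x.1 x.2)
  have he : Function.Involutive e := by
    rintro ⟨a, b⟩
    ext i <;> by_cases hi : i ∈ A <;> simp [e, mergeOn, hi]
  have hw : ∀ x, bernoulliWeight p (e x).1 * bernoulliWeight p (e x).2 =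
      bernoulliWeight p x.1 * bernoulliWeight p x.2 := by
    rintro ⟨a, b⟩
    simp only [bernoulliWeight, ← Finset.prod_mul_distrib, e]
    refine Finset.prod_congr rfl fun i _ => ?_
    by_cases hi : i ∈ A
    · simp only [mergeOn, hi, if_true]; ring
    · simp only [mergeOn, hi, if_false]
  have h1 : bernoulliExp p (fun ω => bernoulliExp p fun ω' => f (mergeOn A ω' ω)) =
      ∑ x : (ι → Bool) × (ι → Bool),
        bernoulliWeight p (e x).1 * bernoulliWeight p (e x).2 * f (e x).1 := by
    simp only [hw]
    simp only [bernoulliExp, Finset.mul_sum, Fintype.sum_prod_type, e, mul_assoc]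
  have h2 := Equiv.sum_comp he.toPerm
    (fun x => bernoulliWeight p x.1 * bernoulliWeight p x.2 * f x.1)
  simp only [Function.Involutive.coe_toPerm] at h2
  rw [h1, h2, Fintype.sum_prod_type]
  simp only [bernoulliExp]
  refine Finset.sum_congr rfl fun a _ => ?_
  rw [← Finset.sum_mul, ← Finset.mul_sum, bernoulliWeight_sum, mul_one]

theorem bernoulliExp_mul_of_disjoint {f g : (ι → Bool) → ℝ} {A B : Set ι}
    (hf : DependsOnlyOn f A) (hg : DependsOnlyOn g B) (hAB : Disjoint A B) :
    bernoulliExp p (fun ω => f ω * g ω) = bernoulliExp p f * bernoulliExp p g := by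
  rw [bernoulliExp_merge A]
  have : ∀ ω ω', f (mergeOn A ω' ω) * g (mergeOn A ω' ω) = g ω * f ω' := by
    intro ω ω'
    rw [hf (mergeOn A ω' ω) ω' fun i hi => mergeOn_of_mem hi _ _,
      hg (mergeOn A ω' ω) ω fun i hi =>
        mergeOn_of_notMem (fun h => Set.disjoint_left.mp hAB h hi) _ _, mul_comm]
  simp only [this, bernoulliExp_const_mul]
  simp only [mul_comm _ (bernoulliExp p f), bernoulliExp_const_mul]

theorem bernoulliExp_prod_of_label {J : Type} (lab : ι → J) (s : Finset J)
    (f : J → (ι → Bool) → ℝ) (hf : ∀ j ∈ s, DependsOnlyOn (f j) {i | lab i = j}) :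
    bernoulliExp p (fun ω => ∏ j ∈ s, f j ω) = ∏ j ∈ s, bernoulliExp p (f j) := by
  classical
  induction s using Finset.induction_on with
  | empty => simp [bernoulliExp_const]
  | insert a s ha ih =>
    simp only [Finset.prod_insert ha]
    rw [bernoulliExp_mul_of_disjoint (A := {i | lab i = a}) (B := {i | lab i ∈ s})
      (hf a (Finset.mem_insert_self a s)), ih fun j hj => hf j (Finset.mem_insert_of_mem hj)]
    · intro ω ω' h
      refine Finset.prod_congr rfl fun j hj => hf j (Finset.mem_insert_of_mem hj) ω ω' ?_
      intro i hi
      exact h i (by simpa [show lab i = j from hi] using hj)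
    · rw [Set.disjoint_left]
      rintro i rfl hi
      exact ha hi

theorem bernoulliProb_nonneg (hp : ∀ i, 0 ≤ p i ∧ p i ≤ 1) (A : (ι → Bool) → Prop) :
    0 ≤ bernoulliProb p A := by
  classical
  have := bernoulliExp_mono hp (f := fun _ => 0) (g := fun ω => if A ω then (1 : ℝ) else 0)
    (fun ω => by split_ifs <;> norm_num)
  rw [bernoulliExp_const] at this
  convert this using 1
  unfold bernoulliProb
  congr

theorem bernoulliProb_mono (hp : ∀ i, 0 ≤ p i ∧ p i ≤ 1) {A B : (ι → Bool) → Prop}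
    (h : ∀ ω, A ω → B ω) : bernoulliProb p A ≤ bernoulliProb p B := by
  classical
  refine bernoulliExp_mono hp fun ω => ?_
  by_cases hA : A ω
  · simp [hA, h ω hA]
  · simp only [hA, if_false]; split_ifs <;> norm_num

theorem bernoulliProb_exists_le (hp : ∀ i, 0 ≤ p i ∧ p i ≤ 1) {κ : Type} (s : Finset κ)
    (A : κ → (ι → Bool) → Prop) :
    bernoulliProb p (fun ω => ∃ k ∈ s, A k ω) ≤ ∑ k ∈ s, bernoulliProb p (A k) := by
  classical
  unfold bernoulliProb
  rw [← bernoulliExp_sum]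
  refine bernoulliExp_mono hp fun ω => ?_
  have h0 : ∀ k ∈ s, (0 : ℝ) ≤ if A k ω then 1 else 0 := fun k _ => by split_ifs <;> norm_num
  split_ifs with h
  · obtain ⟨k, hk, hA⟩ := h
    calc (1 : ℝ) = if A k ω then 1 else 0 := by simp [hA]
      _ ≤ _ := Finset.single_le_sum h0 hk
  · exact Finset.sum_nonneg h0

theorem bernoulliProb_or_le (hp : ∀ i, 0 ≤ p i ∧ p i ≤ 1) (A B : (ι → Bool) → Prop) :
    bernoulliProb p (fun ω => A ω ∨ B ω) ≤ bernoulliProb p A + bernoulliProb p B := by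
  classical
  unfold bernoulliProb
  rw [← bernoulliExp_add]
  refine bernoulliExp_mono hp fun ω => ?_
  by_cases hA : A ω <;> by_cases hB : B ω <;> simp [hA, hB]

theorem bernoulliProb_false : bernoulliProb p (fun _ => False) = 0 := by
  simp [bernoulliProb, bernoulliExp_const]

theorem bernoulliProb_true : bernoulliProb p (fun _ => True) = 1 := by
  simp [bernoulliProb, bernoulliExp_const]

theorem bernoulliProb_le_of_merge (hp : ∀ i, 0 ≤ p i ∧ p i ≤ 1) (A : Set ι)
    (B : (ι → Bool) → Prop) (b : ℝ)
    (h : ∀ ω, bernoulliProb p (fun ω' => B (mergeOn A ω' ω)) ≤ b) : bernoulliProb p B ≤ b := by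
  classical
  unfold bernoulliProb at h ⊢
  rw [bernoulliExp_merge A, ← bernoulliExp_const (p := p) b]
  exact bernoulliExp_mono hp h

theorem bernoulliProb_and_of_disjoint {P Q : (ι → Bool) → Prop} {A B : Set ι}
    (hP : DependsOnlyOn P A) (hQ : DependsOnlyOn Q B) (hAB : Disjoint A B) :
    bernoulliProb p (fun ω => P ω ∧ Q ω) = bernoulliProb p P * bernoulliProb p Q := by
  classical
  unfold bernoulliProb
  rw [← bernoulliExp_mul_of_disjoint (A := A) (B := B) _ _ hAB]
  · congr 1
    ext ω
    by_cases h1 : P ω <;> by_cases h2 : Q ω <;> simp [h1, h2]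
  · intro ω ω' h; simp only [hP ω ω' h]
  · intro ω ω' h; simp only [hQ ω ω' h]

theorem bernoulliProb_cylinder (s t : Finset ι) (hst : Disjoint s t) :
    bernoulliProb p (fun ω => (∀ i ∈ s, ω i = true) ∧ ∀ i ∈ t, ω i = false) =
      (∏ i ∈ s, p i) * ∏ i ∈ t, (1 - p i) := by
  classical
  have h := bernoulliExp_prod (p := p)
    (fun i b => (if i ∈ s → b = true then (1 : ℝ) else 0) * if i ∈ t → b = false then 1 else 0)
  have e1 : bernoulliProb p (fun ω => (∀ i ∈ s, ω i = true) ∧ ∀ i ∈ t, ω i = false) =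
      ∏ i, (p i * ((if i ∈ s → true = true then (1 : ℝ) else 0) *
        if i ∈ t → true = false then 1 else 0) + (1 - p i) *
        ((if i ∈ s → false = true then (1 : ℝ) else 0) *
          if i ∈ t → false = false then 1 else 0)) := by
    rw [← h]
    unfold bernoulliProb
    congr 1
    ext ω
    rw [Finset.prod_mul_distrib, Finset.prod_ite_zero, Finset.prod_ite_zero]
    simp only [Finset.mem_univ, true_implies, Finset.prod_const_one]
    by_cases h1 : ∀ i ∈ s, ω i = true
    · by_cases h2 : ∀ i ∈ t, ω i = false
      · rw [if_pos ⟨h1, h2⟩, if_pos h1, if_pos h2, one_mul]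
      · rw [if_neg fun h => h2 h.2, if_neg h2, mul_zero]
    · rw [if_neg fun h => h1 h.1, if_neg h1, zero_mul]
  rw [e1, ← Finset.prod_subset (Finset.subset_univ (s ∪ t)), Finset.prod_union hst]
  · congr 1
    · refine Finset.prod_congr rfl fun i hi => ?_
      have : i ∉ t := Finset.disjoint_left.mp hst hi
      simp [hi, this]
    · refine Finset.prod_congr rfl fun i hi => ?_
      have : i ∉ s := Finset.disjoint_right.mp hst hi
      simp [hi, this]
  · intro i _ hi
    simp only [Finset.mem_union, not_or] at hi
    simp [hi.1, hi.2]

end Bernoulli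

section Concentration

variable {ι : Type} [Fintype ι] [DecidableEq ι] {p : ι → ℝ}

theorem bernoulliExp_exp_centered_le (hp : ∀ i, 0 ≤ p i ∧ p i ≤ 1) (X : (ι → Bool) → ℝ)
    (hX : ∀ ω ω', |X ω - X ω'| ≤ 1) (l : ℝ) :
    bernoulliExp p (fun ω => Real.exp (l * (X ω - bernoulliExp p X))) ≤ Real.exp (l ^ 2 / 2) := by
  set m := bernoulliExp p X with hm
  have hb : ∀ ω, |X ω - m| ≤ 1 := by
    intro ω
    have h1 : bernoulliExp p X ≤ bernoulliExp p fun _ => X ω + 1 :=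
      bernoulliExp_mono hp fun ω' => by linarith [(abs_le.mp (hX ω ω')).1]
    have h2 : bernoulliExp p (fun _ => X ω - 1) ≤ bernoulliExp p X :=
      bernoulliExp_mono hp fun ω' => by linarith [(abs_le.mp (hX ω ω')).2]
    rw [bernoulliExp_const] at h1 h2
    rw [abs_le]; constructor <;> linarith
  have hpt : ∀ ω, Real.exp (l * (X ω - m)) ≤ Real.cosh l + Real.sinh l * (X ω - m) := by
    intro ω
    obtain ⟨h1, h2⟩ := abs_le.mp (hb ω)
    have hc := convexOn_exp.2 (Set.mem_univ l) (Set.mem_univ (-l))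
      (show 0 ≤ (1 + (X ω - m)) / 2 by linarith) (show 0 ≤ (1 - (X ω - m)) / 2 by linarith)
      (by ring)
    simp only [smul_eq_mul] at hc
    rw [Real.cosh_eq, Real.sinh_eq]
    calc Real.exp (l * (X ω - m)) = Real.exp ((1 + (X ω - m)) / 2 * l + (1 - (X ω - m)) / 2 * -l) := by
          congr 1; ring
      _ ≤ _ := hc
      _ = _ := by ring
  refine (bernoulliExp_mono hp hpt).trans ?_
  rw [bernoulliExp_add, bernoulliExp_const, bernoulliExp_const_mul, bernoulliExp_sub,
    bernoulliExp_const, ← hm, sub_self, mul_zero, add_zero]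
  exact Real.cosh_le_exp_half_sq l

/-- McDiarmid's bounded difference inequality, in moment generating function form. -/
theorem bernoulliExp_exp_le_of_lipschitz (hp : ∀ i, 0 ≤ p i ∧ p i ≤ 1) {J : Type} (lab : ι → J)
    (l : ℝ) (s : Finset J) (f : (ι → Bool) → ℝ) (hf : DependsOnlyOn f {i | lab i ∈ s})
    (hlip : ∀ j ∈ s, ∀ ω ω', (∀ i, lab i ≠ j → ω i = ω' i) → |f ω - f ω'| ≤ 1) :
    bernoulliExp p (fun ω => Real.exp (l * (f ω - bernoulliExp p f))) ≤
      Real.exp (l ^ 2 / 2 * s.card) := by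
  classical
  induction s using Finset.induction_on generalizing f with
  | empty =>
    have h0 : ∀ ω, f ω = f fun _ => true := fun ω => hf _ _ fun i hi => by simp at hi
    have : f = fun _ => f fun _ => true := funext h0
    rw [this]
    simp [bernoulliExp_const]
  | insert j s hj ih =>
    set A : Set ι := {i | lab i = j} with hA
    set g : (ι → Bool) → ℝ := fun ω => bernoulliExp p fun ω' => f (mergeOn A ω' ω) with hg
    have hEg : bernoulliExp p f = bernoulliExp p g := bernoulliExp_merge A f
    have hgdep : DependsOnlyOn g {i | lab i ∈ s} := by
      intro ω ω' h
      simp only [hg]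
      congr 1
      ext ζ
      refine hf _ _ fun i hi => ?_
      by_cases hi' : i ∈ A
      · simp [mergeOn, hi']
      · simp only [mergeOn, hi', if_false]
        refine h i ?_
        have hi2 : lab i ∈ insert j s := hi
        rcases Finset.mem_insert.mp hi2 with h | h
        · exact absurd h hi'
        · exact h
    have hglip : ∀ j' ∈ s, ∀ ω ω', (∀ i, lab i ≠ j' → ω i = ω' i) → |g ω - g ω'| ≤ 1 := by
      intro j' hj' ω ω' h
      have hd : ∀ ζ, |f (mergeOn A ζ ω) - f (mergeOn A ζ ω')| ≤ 1 := by
        intro ζ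
        refine hlip j' (Finset.mem_insert_of_mem hj') _ _ fun i hi => ?_
        by_cases hi' : i ∈ A
        · simp [mergeOn, hi']
        · simp only [mergeOn, hi', if_false]; exact h i hi
      simp only [hg]
      rw [← bernoulliExp_sub, abs_le]
      have h1 := bernoulliExp_mono hp fun ζ => (abs_le.mp (hd ζ)).1
      have h2 := bernoulliExp_mono hp fun ζ => (abs_le.mp (hd ζ)).2
      rw [bernoulliExp_const] at h1 h2
      exact ⟨h1, h2⟩
    have ih' := ih g hgdep hglip
    rw [bernoulliExp_merge A, hEg]
    have hin : ∀ ω, bernoulliExp p (fun ω' => Real.exp (l * (f (mergeOn A ω' ω) - bernoulliExp p g)))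
        ≤ Real.exp (l ^ 2 / 2) * Real.exp (l * (g ω - bernoulliExp p g)) := by
      intro ω
      have := bernoulliExp_exp_centered_le hp (fun ω' => f (mergeOn A ω' ω)) (by
        intro a b
        refine hlip j (Finset.mem_insert_self j s) _ _ fun i hi => ?_
        have hi' : i ∉ A := hi
        simp [mergeOn, hi']) l
      have e : (fun ω' => Real.exp (l * (f (mergeOn A ω' ω) - bernoulliExp p g))) = fun ω' =>
          Real.exp (l * (g ω - bernoulliExp p g)) * Real.exp (l * (f (mergeOn A ω' ω) -
            bernoulliExp p fun ω' => f (mergeOn A ω' ω))) := by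
        ext ω'
        rw [← Real.exp_add]
        congr 1
        simp only [hg]; ring
      rw [e, bernoulliExp_const_mul, mul_comm]
      exact mul_le_mul_of_nonneg_right this (Real.exp_pos _).le
    refine (bernoulliExp_mono hp hin).trans ?_
    rw [bernoulliExp_const_mul, Finset.card_insert_of_notMem hj]
    calc _ ≤ Real.exp (l ^ 2 / 2) * Real.exp (l ^ 2 / 2 * s.card) :=
          mul_le_mul_of_nonneg_left ih' (Real.exp_pos _).le
      _ = _ := by rw [← Real.exp_add]; congr 1; push_cast; ring

/-- McDiarmid's inequality: a function of `n` independent blocks which changes by at most one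
when a single block is resampled is unlikely to exceed an upper bound for its mean by `t`. -/
theorem bernoulliProb_ge_le_of_lipschitz (hp : ∀ i, 0 ≤ p i ∧ p i ≤ 1) {J : Type} (lab : ι → J)
    (s : Finset J) (f : (ι → Bool) → ℝ) (hf : DependsOnlyOn f {i | lab i ∈ s})
    (hlip : ∀ j ∈ s, ∀ ω ω', (∀ i, lab i ≠ j → ω i = ω' i) → |f ω - f ω'| ≤ 1)
    {n a b t : ℝ} (hn : 0 < n) (hs : (s.card : ℝ) ≤ n) (ht : 0 ≤ t)
    (ha : bernoulliExp p f ≤ a) (hab : a + t ≤ b) :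
    bernoulliProb p (fun ω => b < f ω) ≤ Real.exp (-(t ^ 2 / (2 * n))) := by
  classical
  set l := t / n with hl
  have hl0 : 0 ≤ l := by positivity
  have h1 : bernoulliProb p (fun ω => b < f ω) ≤
      bernoulliExp p fun ω => Real.exp (-(l * t)) * Real.exp (l * (f ω - bernoulliExp p f)) := by
    unfold bernoulliProb
    refine bernoulliExp_mono hp fun ω => ?_
    rw [← Real.exp_add]
    split_ifs with h
    · rw [Real.one_le_exp_iff]
      nlinarith
    · exact (Real.exp_pos _).le
  refine h1.trans ?_
  rw [bernoulliExp_const_mul]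
  calc _ ≤ Real.exp (-(l * t)) * Real.exp (l ^ 2 / 2 * n) := by
        refine mul_le_mul_of_nonneg_left ?_ (Real.exp_pos _).le
        refine (bernoulliExp_exp_le_of_lipschitz hp lab l s f hf hlip).trans ?_
        rw [Real.exp_le_exp]
        exact mul_le_mul_of_nonneg_left hs (by positivity)
    _ = _ := by
        rw [← Real.exp_add, hl]
        congr 1
        field_simp
        ring

theorem bernoulliProb_lt_le_of_lipschitz (hp : ∀ i, 0 ≤ p i ∧ p i ≤ 1) {J : Type} (lab : ι → J)
    (s : Finset J) (f : (ι → Bool) → ℝ) (hf : DependsOnlyOn f {i | lab i ∈ s})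
    (hlip : ∀ j ∈ s, ∀ ω ω', (∀ i, lab i ≠ j → ω i = ω' i) → |f ω - f ω'| ≤ 1)
    {n a b t : ℝ} (hn : 0 < n) (hs : (s.card : ℝ) ≤ n) (ht : 0 ≤ t)
    (ha : a ≤ bernoulliExp p f) (hab : b ≤ a - t) :
    bernoulliProb p (fun ω => f ω < b) ≤ Real.exp (-(t ^ 2 / (2 * n))) := by
  have := bernoulliProb_ge_le_of_lipschitz hp lab s (fun ω => - f ω)
    (fun ω ω' h => by simp only [hf ω ω' h])
    (fun j hj ω ω' h => by
      have := hlip j hj ω ω' h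
      rwa [neg_sub_neg, abs_sub_comm]) (a := -a) (b := -b) hn hs ht
    (by rw [bernoulliExp_neg]; linarith) (by linarith)
  simpa only [neg_lt_neg_iff] using this

end Concentration

theorem sum_biUnion_le_of_nonneg {V κ : Type} [DecidableEq κ] (X : Finset V) (t : V → Finset κ)
    (f : κ → ℝ) (hf : ∀ k, 0 ≤ f k) : ∑ j ∈ X.biUnion t, f j ≤ ∑ x ∈ X, ∑ j ∈ t x, f j := by
  classical
  induction X using Finset.induction_on with
  | empty => simp
  | insert a s ha ih =>
    rw [Finset.biUnion_insert, Finset.sum_insert ha]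
    have := Finset.sum_union_inter (s₁ := t a) (s₂ := s.biUnion t) (f := f)
    have h2 : 0 ≤ ∑ j ∈ t a ∩ s.biUnion t, f j := Finset.sum_nonneg fun j _ => hf j
    linarith

section LocalLemma

variable {ι : Type} [Fintype ι] [DecidableEq ι] {p : ι → ℝ}

theorem bernoulliProb_local_lemma_aux (hp : ∀ i, 0 ≤ p i ∧ p i ≤ 1) {κ : Type} (s : Finset κ)
    (A : κ → (ι → Bool) → Prop) (supp : κ → Set ι)
    (hA : ∀ k ∈ s, DependsOnlyOn (A k) (supp k))
    (hq : ∀ k ∈ s, bernoulliProb p (A k) ≤ 1 / 4)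
    (hsum : ∀ k ∈ s, ∀ r ⊆ s, (∀ j ∈ r, ¬ Disjoint (supp j) (supp k)) →
      ∑ j ∈ r, bernoulliProb p (A j) ≤ 1 / 4) (S : Finset κ) (hS : S ⊆ s) :
    0 < bernoulliProb p (fun ω => ∀ k ∈ S, ¬ A k ω) ∧
      ∀ k ∈ s, bernoulliProb p (fun ω => A k ω ∧ ∀ j ∈ S, ¬ A j ω) ≤
        2 * bernoulliProb p (A k) * bernoulliProb p (fun ω => ∀ k ∈ S, ¬ A k ω) := by
  classical
  induction S using Finset.strongInduction with
  | H S ih =>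
    have hpos : 0 < bernoulliProb p (fun ω => ∀ k ∈ S, ¬ A k ω) := by
      rcases S.eq_empty_or_nonempty with rfl | ⟨k, hk⟩
      · simp [bernoulliProb_true]
      · obtain ⟨h1, h2⟩ := ih (S.erase k) (Finset.erase_ssubset hk)
          ((Finset.erase_subset k S).trans hS)
        have h3 := h2 k (hS hk)
        have h4 := bernoulliProb_or_le hp (fun ω => ∀ k ∈ S, ¬ A k ω)
          (fun ω => A k ω ∧ ∀ j ∈ S.erase k, ¬ A j ω)
        have h5 : bernoulliProb p (fun ω => ∀ j ∈ S.erase k, ¬ A j ω) ≤ bernoulliProb p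
            (fun ω => (∀ k ∈ S, ¬ A k ω) ∨ A k ω ∧ ∀ j ∈ S.erase k, ¬ A j ω) := by
          refine bernoulliProb_mono hp fun ω h => ?_
          by_cases hA : A k ω
          · exact Or.inr ⟨hA, h⟩
          · left
            intro j hj
            by_cases hjk : j = k
            · rwa [hjk]
            · exact h j (Finset.mem_erase.mpr ⟨hjk, hj⟩)
        have h6 := hq k (hS hk)
        nlinarith
    refine ⟨hpos, fun k hk => ?_⟩
    set S1 := S.filter fun j => ¬ Disjoint (supp j) (supp k)
    set S2 := S.filter fun j => Disjoint (supp j) (supp k)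
    have hq0 := bernoulliProb_nonneg hp (A k)
    have hstep : bernoulliProb p (fun ω => A k ω ∧ ∀ j ∈ S, ¬ A j ω) ≤
        bernoulliProb p (A k) * bernoulliProb p (fun ω => ∀ j ∈ S2, ¬ A j ω) := by
      rw [← bernoulliProb_and_of_disjoint (A := supp k) (B := ⋃ j ∈ S2, supp j) (hA k hk)]
      · exact bernoulliProb_mono hp fun ω h =>
          ⟨h.1, fun j hj => h.2 j (Finset.mem_of_mem_filter j hj)⟩
      · intro ω ω' h
        refine propext (forall₂_congr fun j hj => ?_)
        rw [hA j (hS (Finset.mem_of_mem_filter j hj)) ω ω' fun i hi =>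
          h i (Set.mem_biUnion (show j ∈ (S2 : Set κ) from hj) hi)]
      · rw [Set.disjoint_iUnion₂_right]
        intro j hj
        exact (Finset.mem_filter.mp hj).2.symm
    have hhalf : bernoulliProb p (fun ω => ∀ j ∈ S2, ¬ A j ω) ≤
        2 * bernoulliProb p (fun ω => ∀ j ∈ S, ¬ A j ω) := by
      by_cases hS1 : S2 = S
      · rw [hS1]; linarith
      · obtain ⟨h1, h2⟩ := ih S2
          (Finset.ssubset_iff_subset_ne.mpr ⟨Finset.filter_subset _ _, hS1⟩)
          ((Finset.filter_subset _ _).trans hS)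
        have h4 := bernoulliProb_or_le hp (fun ω => ∀ k ∈ S, ¬ A k ω)
          (fun ω => ∃ j ∈ S1, A j ω ∧ ∀ i ∈ S2, ¬ A i ω)
        have h5 := bernoulliProb_exists_le hp S1 (fun j ω => A j ω ∧ ∀ i ∈ S2, ¬ A i ω)
        have h6 : bernoulliProb p (fun ω => ∀ j ∈ S2, ¬ A j ω) ≤ bernoulliProb p
            (fun ω => (∀ k ∈ S, ¬ A k ω) ∨ ∃ j ∈ S1, A j ω ∧ ∀ i ∈ S2, ¬ A i ω) := by
          refine bernoulliProb_mono hp fun ω h => ?_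
          by_cases hA : ∃ j ∈ S1, A j ω
          · obtain ⟨j, hj, hjA⟩ := hA
            exact Or.inr ⟨j, hj, hjA, h⟩
          · left
            push Not at hA
            intro j hj
            by_cases hd : Disjoint (supp j) (supp k)
            · exact h j (Finset.mem_filter.mpr ⟨hj, hd⟩)
            · exact hA j (Finset.mem_filter.mpr ⟨hj, hd⟩)
        have h7 : ∑ j ∈ S1, bernoulliProb p (fun ω => A j ω ∧ ∀ i ∈ S2, ¬ A i ω) ≤
            2 * (∑ j ∈ S1, bernoulliProb p (A j)) *
              bernoulliProb p (fun ω => ∀ j ∈ S2, ¬ A j ω) := by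
          rw [Finset.mul_sum, Finset.sum_mul]
          exact Finset.sum_le_sum fun j hj => h2 j (hS (Finset.mem_of_mem_filter j hj))
        have h8 := hsum k hk S1 ((Finset.filter_subset _ _).trans hS)
          fun j hj => (Finset.mem_filter.mp hj).2
        nlinarith
    nlinarith

/-- The asymmetric local lemma for events depending on independent coordinates. -/
theorem bernoulliProb_local_lemma (hp : ∀ i, 0 ≤ p i ∧ p i ≤ 1) {κ : Type} (s : Finset κ)
    (A : κ → (ι → Bool) → Prop) (supp : κ → Set ι)
    (hA : ∀ k ∈ s, DependsOnlyOn (A k) (supp k))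
    (hq : ∀ k ∈ s, bernoulliProb p (A k) ≤ 1 / 4)
    (hsum : ∀ k ∈ s, ∀ r ⊆ s, (∀ j ∈ r, ¬ Disjoint (supp j) (supp k)) →
      ∑ j ∈ r, bernoulliProb p (A j) ≤ 1 / 4) :
    ∃ ω, ∀ k ∈ s, ¬ A k ω := by
  have h := (bernoulliProb_local_lemma_aux hp s A supp hA hq hsum s subset_rfl).1
  by_contra hne
  push Not at hne
  have : (fun ω => ∀ k ∈ s, ¬ A k ω) = fun _ => False := by
    ext ω
    obtain ⟨k, hk, hA⟩ := hne ω
    simp only [iff_false]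
    exact fun h => h k hk hA
  rw [this, bernoulliProb_false] at h
  exact lt_irrefl _ h

/-- The local lemma for events located at small sets of vertices: each event depends only on the
coordinates located within its set, and the events touching any given vertex are rare. -/
theorem bernoulliProb_local_lemma_of_touch (hp : ∀ i, 0 ≤ p i ∧ p i ≤ 1) {V κ : Type}
    [DecidableEq V] (s : Finset κ) (A : κ → (ι → Bool) → Prop) (loc : ι → Set V)
    (hloc : ∀ i, (loc i).Nonempty) (X : κ → Finset V) (hX : ∀ k ∈ s, (X k).Nonempty)
    {M : ℝ} (hM : ∀ k ∈ s, ((X k).card : ℝ) ≤ M)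
    (hA : ∀ k ∈ s, DependsOnlyOn (A k) {i | loc i ⊆ X k})
    (hsum : ∀ x, M * ∑ k ∈ s with x ∈ X k, bernoulliProb p (A k) ≤ 1 / 4) :
    ∃ ω, ∀ k ∈ s, ¬ A k ω := by
  classical
  have hbd : ∀ k ∈ s, ∀ r ⊆ s, (∀ j ∈ r, ∃ x ∈ X k, x ∈ X j) →
      ∑ j ∈ r, bernoulliProb p (A j) ≤ 1 / 4 := by
    intro k hk r hr hrk
    have h0 := fun j => bernoulliProb_nonneg hp (A j)
    have h1 : ∑ j ∈ r, bernoulliProb p (A j) ≤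
        ∑ j ∈ (X k).biUnion fun x => s.filter fun j => x ∈ X j, bernoulliProb p (A j) := by
      refine Finset.sum_le_sum_of_subset_of_nonneg ?_ fun j _ _ => h0 j
      intro j hj
      obtain ⟨x, hx, hxj⟩ := hrk j hj
      exact Finset.mem_biUnion.mpr ⟨x, hx, Finset.mem_filter.mpr ⟨hr hj, hxj⟩⟩
    have hM0 : 0 < M := by
      have : 0 < (X k).card := Finset.card_pos.mpr (hX k hk)
      have : (0 : ℝ) < (X k).card := by exact_mod_cast this
      linarith [hM k hk]
    have h2 : ∑ j ∈ (X k).biUnion fun x => s.filter fun j => x ∈ X j, bernoulliProb p (A j) ≤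
        ∑ x ∈ X k, ∑ j ∈ s with x ∈ X j, bernoulliProb p (A j) :=
      sum_biUnion_le_of_nonneg _ _ _ h0
    have h3 : ∑ x ∈ X k, ∑ j ∈ s with x ∈ X j, bernoulliProb p (A j) ≤
        ∑ x ∈ X k, 1 / 4 / M := by
      refine Finset.sum_le_sum fun x _ => ?_
      rw [le_div_iff₀ hM0, mul_comm]
      exact hsum x
    rw [Finset.sum_const, nsmul_eq_mul] at h3
    have h4 : ((X k).card : ℝ) * (1 / 4 / M) ≤ M * (1 / 4 / M) :=
      mul_le_mul_of_nonneg_right (hM k hk) (by positivity)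
    have h5 : M * (1 / 4 / M) = 1 / 4 := by field_simp
    linarith
  refine bernoulliProb_local_lemma hp s A (fun k => {i | loc i ⊆ X k}) hA (fun k hk => ?_)
    fun k hk r hr hrk => hbd k hk r hr fun j hj => ?_
  · have := hbd k hk {k} (by simpa using hk) (by
      intro j hj
      rw [Finset.mem_singleton.mp hj]
      obtain ⟨x, hx⟩ := hX k hk
      exact ⟨x, hx, hx⟩)
    simpa using this
  · obtain ⟨i, hi1, hi2⟩ := Set.not_disjoint_iff.mp (hrk j hj)
    obtain ⟨x, hx⟩ := hloc i
    exact ⟨x, by simpa using hi2 hx, by simpa using hi1 hx⟩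

end LocalLemma

section Marginals

variable {ι : Type} [Fintype ι] [DecidableEq ι] {p : ι → ℝ}

theorem bernoulliProb_not (A : (ι → Bool) → Prop) :
    bernoulliProb p (fun ω => ¬ A ω) = 1 - bernoulliProb p A := by
  classical
  unfold bernoulliProb
  have := bernoulliExp_sub (p := p) (fun _ => 1) (fun ω => if A ω then 1 else 0)
  rw [bernoulliExp_const] at this
  rw [← this]
  congr 1
  ext ω
  by_cases h : A ω <;> simp [h]

theorem bernoulliExp_comp {X : Type} [Fintype X] [DecidableEq X] (φ : X → ι)
    (hφ : Function.Injective φ) (f : (X → Bool) → ℝ) :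
    bernoulliExp p (fun ω => f fun x => ω (φ x)) = bernoulliExp (fun x => p (φ x)) f := by
  classical
  have h1 : ∀ ω : ι → Bool, f (fun x => ω (φ x)) =
      ∑ ξ : X → Bool, f ξ * if (fun x => ω (φ x)) = ξ then 1 else 0 := by
    intro ω; simp
  simp only [h1]
  rw [bernoulliExp_sum]
  unfold bernoulliExp
  refine Finset.sum_congr rfl fun ξ _ => ?_
  have h2 := bernoulliProb_cylinder (p := p) ((Finset.univ.filter fun x => ξ x = true).image φ)
    ((Finset.univ.filter fun x => ξ x = false).image φ) (by
      rw [Finset.disjoint_left]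
      simp only [Finset.mem_image, Finset.mem_filter, Finset.mem_univ, true_and, not_exists, not_and]
      rintro _ ⟨x, hx, rfl⟩ y hy hxy
      rw [hφ hxy] at hy
      simp [hx] at hy)
  rw [Finset.prod_image fun _ _ _ _ h => hφ h, Finset.prod_image fun _ _ _ _ h => hφ h] at h2
  have h3 : bernoulliWeight (fun x => p (φ x)) ξ = (∏ x with ξ x = true, p (φ x)) *
      ∏ x with ξ x = false, (1 - p (φ x)) := by
    unfold bernoulliWeight
    rw [Finset.prod_ite]
    simp
  have h4 := bernoulliExp_const_mul (p := p) (f ξ)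
    (fun ω => if (fun x => ω (φ x)) = ξ then (1 : ℝ) else 0)
  unfold bernoulliExp at h4
  rw [h3, ← h2, h4, mul_comm]
  congr 1
  unfold bernoulliProb bernoulliExp
  refine Finset.sum_congr rfl fun ω _ => ?_
  congr 1
  have hiff : (fun x => ω (φ x)) = ξ ↔
      (∀ i ∈ (Finset.univ.filter fun x => ξ x = true).image φ, ω i = true) ∧
        ∀ i ∈ (Finset.univ.filter fun x => ξ x = false).image φ, ω i = false := by
    constructor
    · rintro rfl
      simp
    rintro ⟨h, h'⟩
    ext x
    cases hx : ξ x
    · exact h' (φ x) (Finset.mem_image_of_mem φ (by simp [hx]))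
    · exact h (φ x) (Finset.mem_image_of_mem φ (by simp [hx]))
  by_cases h : (fun x => ω (φ x)) = ξ
  · exact (if_pos h).trans (if_pos (hiff.mp h)).symm
  · exact (if_neg h).trans (if_neg fun h' => h (hiff.mpr h')).symm

theorem bernoulliProb_comp {X : Type} [Fintype X] [DecidableEq X] (φ : X → ι)
    (hφ : Function.Injective φ) (A : (X → Bool) → Prop) :
    bernoulliProb p (fun ω => A fun x => ω (φ x)) = bernoulliProb (fun x => p (φ x)) A := by
  classical
  unfold bernoulliProb
  rw [← bernoulliExp_comp φ hφ]

theorem bernoulliProb_forall_false (q : ℝ) (t : Finset ι) :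
    bernoulliProb (fun _ => q) (fun ω => ∀ i ∈ t, ω i = false) = (1 - q) ^ t.card := by
  have := bernoulliProb_cylinder (p := fun _ => q) (∅ : Finset ι) t (Finset.disjoint_empty_left t)
  simpa using this

theorem bernoulliProb_true_forall_false (q : ℝ) (i₀ : ι) (t : Finset ι) (h : i₀ ∉ t) :
    bernoulliProb (fun _ => q) (fun ω => ω i₀ = true ∧ ∀ i ∈ t, ω i = false) =
      q * (1 - q) ^ t.card := by
  have := bernoulliProb_cylinder (p := fun _ => q) {i₀} t (by simpa using h)
  simpa using this

theorem bernoulliExp_card_filter {κ : Type} (s : Finset κ)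
    (A : (ι → Bool) → κ → Prop) [∀ ω, DecidablePred (A ω)] :
    bernoulliExp p (fun ω => ((s.filter (A ω)).card : ℝ)) =
      ∑ k ∈ s, bernoulliProb p fun ω => A ω k := by
  classical
  unfold bernoulliProb
  rw [← bernoulliExp_sum]
  congr 1
  ext ω
  rw [Finset.card_filter]
  push_cast
  refine Finset.sum_congr rfl fun k _ => ?_
  congr

end Marginals

/-- A stage of the nibble: a partial edge colouring, together with the colours still available
at each vertex. -/
structure NibbleState (V Col : Type) where
  col : Sym2 V → Option Col
  avail : V → Col → Prop

open Classical in
/-- Some element satisfying `P`, if there is one. -/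
noncomputable def pickSome {α : Type} (P : α → Prop) : Option α :=
  if h : ∃ a, P a then some h.choose else none

theorem pickSome_eq_none {α : Type} {P : α → Prop} : pickSome P = none ↔ ∀ a, ¬ P a := by
  unfold pickSome
  split_ifs with h
  · simp only [false_iff]; push Not; exact h
  · simp only [true_iff]; push Not at h; exact h

theorem of_pickSome {α : Type} {P : α → Prop} {a : α} (h : pickSome P = some a) : P a := by
  unfold pickSome at h
  split_ifs at h with h'
  cases h
  exact h'.choose_spec

/-- The coordinates of a single round: whether a colour is proposed along an edge, and whether
the `j`-th dummy edge at a vertex proposes a colour. -/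
abbrev NibbleCoord (V Col : Type) (Δ : ℕ) : Type := Col × (Sym2 V ⊕ V × Fin Δ)

section Step

variable {V : Type} [Fintype V] [DecidableEq V] (G : SimpleGraph V) [DecidableRel G.Adj]
  {Col : Type} [Fintype Col] [DecidableEq Col] {Δ : ℕ}

open Classical in
/-- Neighbours of `v` along an uncoloured edge at which `c` is available. -/
noncomputable def candNbrs (s : NibbleState V Col) (v : V) (c : Col) : Finset V :=
  (G.neighborFinset v).filter fun u => s.col s(v, u) = none ∧ s.avail u c

open Classical in
/-- The coordinates which may remove the colour `c` at `v`; padded with dummies to size `N`. -/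
noncomputable def hitCoords (N : ℕ) (s : NibbleState V Col) (v : V) (c : Col) :
    Finset (NibbleCoord V Col Δ) :=
  (candNbrs G s v c).image (fun u => (c, Sum.inl s(v, u))) ∪
    (Finset.univ.filter fun j : Fin Δ => (j : ℕ) < N - (candNbrs G s v c).card).image
      fun j => (c, Sum.inr (v, j))

/-- The colour `c` is proposed for the edge `e`. -/
def Proposes (s : NibbleState V Col) (ξ : NibbleCoord V Col Δ → Bool) (e : Sym2 V) (c : Col) :
    Prop :=
  e ∈ G.edgeSet ∧ s.col e = none ∧ (∀ x ∈ e, s.avail x c) ∧ ξ (c, Sum.inl e) = true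

/-- The colour `c` is proposed for the edge `e` and for no edge adjacent to it. -/
def Wins (s : NibbleState V Col) (ξ : NibbleCoord V Col Δ → Bool) (e : Sym2 V) (c : Col) :
    Prop :=
  Proposes G s ξ e c ∧ ∀ e', Proposes G s ξ e' c → (∃ x, x ∈ e ∧ x ∈ e') → e' = e

open Classical in
/-- One round of the nibble. -/
noncomputable def nibbleStep (N : ℕ) (s : NibbleState V Col)
    (ξ : NibbleCoord V Col Δ → Bool) : NibbleState V Col where
  col e := if s.col e = none then pickSome (Wins G s ξ e) else s.col e
  avail v c := s.avail v c ∧ ∀ i ∈ hitCoords G N s v c, ξ i = false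

variable {G} {s : NibbleState V Col} {N : ℕ}

theorem mem_candNbrs {v u : V} {c : Col} :
    u ∈ candNbrs G s v c ↔ G.Adj v u ∧ s.col s(v, u) = none ∧ s.avail u c := by
  simp [candNbrs]

theorem inl_mem_hitCoords {v u : V} {c : Col} (h : u ∈ candNbrs G s v c) :
    ((c, Sum.inl s(v, u)) : NibbleCoord V Col Δ) ∈ hitCoords G N s v c :=
  Finset.mem_union_left _ (Finset.mem_image_of_mem _ h)

theorem mem_hitCoords {v : V} {c : Col} {i : NibbleCoord V Col Δ} (h : i ∈ hitCoords G N s v c) :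
    i.1 = c ∧ ((∃ u ∈ candNbrs G s v c, i.2 = Sum.inl s(v, u)) ∨ ∃ j, i.2 = Sum.inr (v, j)) := by
  rcases Finset.mem_union.mp h with h | h
  · obtain ⟨u, hu, rfl⟩ := Finset.mem_image.mp h
    exact ⟨rfl, Or.inl ⟨u, hu, rfl⟩⟩
  · obtain ⟨j, -, rfl⟩ := Finset.mem_image.mp h
    exact ⟨rfl, Or.inr ⟨j, rfl⟩⟩

theorem card_hitCoords {v : V} {c : Col} (h : (candNbrs G s v c).card ≤ N) (hN : N ≤ Δ) :
    (hitCoords G N s v c : Finset (NibbleCoord V Col Δ)).card = N := by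
  classical
  unfold hitCoords
  rw [Finset.card_union_of_disjoint, Finset.card_image_of_injective, Finset.card_image_of_injective]
  · have : (Finset.univ.filter fun j : Fin Δ => (j : ℕ) < N - (candNbrs G s v c).card).card =
        N - (candNbrs G s v c).card := by
      rw [Fin.card_filter_val_lt]
      omega
    rw [this]
    omega
  · intro a b hab; simpa using hab
  · intro a b hab
    simp only [Prod.mk.injEq, Sum.inl.injEq, true_and] at hab
    exact Sym2.congr_right.mp hab
  · rw [Finset.disjoint_left]
    simp

theorem Proposes.mem_hitCoords {ξ : NibbleCoord V Col Δ → Bool} {e : Sym2 V} {c : Col} {v : V}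
    (h : Proposes G s ξ e c) (hv : v ∈ e) :
    ((c, Sum.inl e) : NibbleCoord V Col Δ) ∈ hitCoords G N s v c := by
  obtain ⟨u, rfl⟩ := hv
  exact inl_mem_hitCoords (mem_candNbrs.mpr ⟨h.1, h.2.1, h.2.2.1 u (by simp)⟩)

theorem Wins.of_cylinder {ξ : NibbleCoord V Col Δ → Bool} {u v : V} {c : Col} (h : G.Adj v u)
    (hcol : s.col s(v, u) = none) (hv : s.avail v c) (hu : s.avail u c)
    (h1 : ξ (c, Sum.inl s(v, u)) = true)
    (h2 : ∀ i ∈ (hitCoords G N s v c ∪ hitCoords G N s u c).erase (c, Sum.inl s(v, u)),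
      ξ i = false) : Wins G s ξ s(v, u) c := by
  have hp : Proposes G s ξ s(v, u) c := by
    refine ⟨h, hcol, fun x hx => ?_, h1⟩
    rcases Sym2.mem_iff.mp hx with rfl | rfl <;> assumption
  refine ⟨hp, fun e' he' ⟨x, hx, hx'⟩ => ?_⟩
  by_contra hne
  have hmem : ((c, Sum.inl e') : NibbleCoord V Col Δ) ∈
      (hitCoords G N s v c ∪ hitCoords G N s u c).erase (c, Sum.inl s(v, u)) := by
    refine Finset.mem_erase.mpr ⟨by simpa using hne, ?_⟩
    rcases Sym2.mem_iff.mp hx with rfl | rfl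
    · exact Finset.mem_union_left _ (Proposes.mem_hitCoords he' hx')
    · exact Finset.mem_union_right _ (Proposes.mem_hitCoords he' hx')
  have := h2 _ hmem
  rw [he'.2.2.2] at this
  simp at this

theorem Wins.eq_of_mem {ξ : NibbleCoord V Col Δ → Bool} {e e' : Sym2 V} {c : Col} {x : V}
    (h : Wins G s ξ e c) (h' : Wins G s ξ e' c) (hx : x ∈ e) (hx' : x ∈ e') : e = e' :=
  (h.2 e' h'.1 ⟨x, hx, hx'⟩).symm

theorem wins_congr {ξ ξ' : NibbleCoord V Col Δ → Bool} {e : Sym2 V} {c : Col}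
    (h : ∀ i, i.1 = c → ξ i = ξ' i) : Wins G s ξ e c ↔ Wins G s ξ' e c := by
  have hP : ∀ e, Proposes G s ξ e c ↔ Proposes G s ξ' e c := fun e => by
    unfold Proposes; rw [h _ rfl]
  simp only [Wins, hP]

theorem nibbleStep_col_eq_none {ξ : NibbleCoord V Col Δ → Bool} {e : Sym2 V}
    (h : (nibbleStep G N s ξ).col e = none) : s.col e = none ∧ ∀ c, ¬ Wins G s ξ e c := by
  unfold nibbleStep at h
  simp only at h
  split_ifs at h with h'
  · exact ⟨h', pickSome_eq_none.mp h⟩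
  · exact absurd h h'

end Step

theorem abs_card_sub_card_le_one {α : Type} (A B : Finset α)
    (hA : ∀ x ∈ A, x ∉ B → ∀ y ∈ A, y ∉ B → x = y) (hB : ∀ x ∈ B, x ∉ A → ∀ y ∈ B, y ∉ A → x = y) :
    |(A.card : ℝ) - B.card| ≤ 1 := by
  classical
  have h1 : (A \ B).card ≤ 1 := Finset.card_le_one.mpr fun x hx y hy =>
    hA x (Finset.mem_sdiff.mp hx).1 (Finset.mem_sdiff.mp hx).2 y (Finset.mem_sdiff.mp hy).1
      (Finset.mem_sdiff.mp hy).2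
  have h2 : (B \ A).card ≤ 1 := Finset.card_le_one.mpr fun x hx y hy =>
    hB x (Finset.mem_sdiff.mp hx).1 (Finset.mem_sdiff.mp hx).2 y (Finset.mem_sdiff.mp hy).1
      (Finset.mem_sdiff.mp hy).2
  have h3 := Finset.card_le_card_sdiff_add_card (s := A) (t := B)
  have h4 := Finset.card_le_card_sdiff_add_card (s := B) (t := A)
  have h5 : (A.card : ℝ) ≤ 1 + B.card := by exact_mod_cast h3.trans (by omega)
  have h6 : (B.card : ℝ) ≤ 1 + A.card := by exact_mod_cast h4.trans (by omega)
  rw [abs_le]; constructor <;> linarith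

theorem bernoulliProb_forall_of_label {ι : Type} [Fintype ι] [DecidableEq ι] {p : ι → ℝ}
    {J : Type} (lab : ι → J) (s : Finset J) (A : J → (ι → Bool) → Prop)
    (hA : ∀ j ∈ s, DependsOnlyOn (A j) {i | lab i = j}) :
    bernoulliProb p (fun ω => ∀ j ∈ s, A j ω) = ∏ j ∈ s, bernoulliProb p (A j) := by
  classical
  unfold bernoulliProb
  rw [← bernoulliExp_prod_of_label lab s]
  · congr 1
    ext ω
    rw [Finset.prod_ite_zero]
    simp only [Finset.prod_const_one]
    by_cases h : ∀ j ∈ s, A j ω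
    · exact (if_pos h).trans (if_pos h).symm
    · exact (if_neg h).trans (if_neg h).symm
  · intro j hj ω ω' h
    simp only [hA j hj ω ω' h]

section StepProb

variable {V : Type} [Fintype V] [DecidableEq V] (G : SimpleGraph V) [DecidableRel G.Adj]
  {Col : Type} [Fintype Col] [DecidableEq Col] {Δ : ℕ}

open Classical in
/-- Colours available at both ends of `vu`. -/
noncomputable def freeColors (s : NibbleState V Col) (v u : V) : Finset Col :=
  Finset.univ.filter fun c => s.avail v c ∧ s.avail u c

open Classical in
/-- Neighbours `u` of `v` along uncoloured edges with `c` in the reserved set of `u`. -/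
noncomputable def uncolNbrs (R : V → Col → Prop) (s : NibbleState V Col) (v : V) (c : Col) :
    Finset V :=
  (G.neighborFinset v).filter fun u => s.col s(v, u) = none ∧ R u c

/-- The parameters at `v` of a stage of the nibble are under control. -/
structure StateOK (R : V → Col → Prop) (Λ D F : ℝ) (s : NibbleState V Col) (v : V) : Prop where
  free : ∀ u, G.Adj v u → s.col s(v, u) = none → Λ ≤ (freeColors s v u).card
  cand : ∀ c, ((candNbrs G s v c).card : ℝ) ≤ D
  uncol : ∀ c, ((uncolNbrs G R s v c).card : ℝ) ≤ F

variable {G} {s : NibbleState V Col} {N : ℕ} {q : ℝ}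

theorem mem_freeColors {v u : V} {c : Col} :
    c ∈ freeColors s v u ↔ s.avail v c ∧ s.avail u c := by
  simp [freeColors]

theorem mem_uncolNbrs {R : V → Col → Prop} {v u : V} {c : Col} :
    u ∈ uncolNbrs G R s v c ↔ G.Adj v u ∧ s.col s(v, u) = none ∧ R u c := by
  simp [uncolNbrs]

theorem prob_stay_ge (hq : 0 ≤ q ∧ q ≤ 1) {v u : V} {c : Col}
    (hv : (candNbrs G s v c).card ≤ N) (hu : (candNbrs G s u c).card ≤ N) (hN : N ≤ Δ) :
    ((1 - q) ^ N) ^ 2 ≤ bernoulliProb (fun _ => q) (fun ξ : NibbleCoord V Col Δ → Bool =>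
      ∀ i ∈ hitCoords G N s v c ∪ hitCoords G N s u c, ξ i = false) := by
  rw [bernoulliProb_forall_false, ← pow_mul]
  refine pow_le_pow_of_le_one (by linarith) (by linarith) ?_
  refine (Finset.card_union_le _ _).trans ?_
  rw [card_hitCoords hv hN, card_hitCoords hu hN]
  omega

theorem prob_wins_ge (hq : 0 ≤ q ∧ q ≤ 1) {v u : V} {c : Col} (hadj : G.Adj v u)
    (hcol : s.col s(v, u) = none) (hc : c ∈ freeColors s v u)
    (hv : (candNbrs G s v c).card ≤ N) (hu : (candNbrs G s u c).card ≤ N) (hN : N ≤ Δ) :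
    q * ((1 - q) ^ N) ^ 2 ≤ bernoulliProb (fun _ => q)
      (fun ξ : NibbleCoord V Col Δ → Bool => Wins G s ξ s(v, u) c) := by
  rw [mem_freeColors] at hc
  refine le_trans ?_ (bernoulliProb_mono (fun _ => hq) fun ξ (h : _ ∧ _) =>
    Wins.of_cylinder (N := N) hadj hcol hc.1 hc.2 h.1 h.2)
  rw [bernoulliProb_true_forall_false _ _ _ (by simp), ← pow_mul]
  refine mul_le_mul_of_nonneg_left ?_ hq.1
  refine pow_le_pow_of_le_one (by linarith) (by linarith) ?_
  refine Finset.card_erase_le.trans ((Finset.card_union_le _ _).trans ?_)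
  rw [card_hitCoords hv hN, card_hitCoords hu hN]
  omega

theorem prob_noWin_le (hq : 0 ≤ q ∧ q ≤ 1) {v u : V} (hadj : G.Adj v u)
    (hcol : s.col s(v, u) = none)
    (hv : ∀ c, (candNbrs G s v c).card ≤ N) (hu : ∀ c, (candNbrs G s u c).card ≤ N) (hN : N ≤ Δ)
    (Q : Finset Col) (hQ : Q ⊆ freeColors s v u) :
    bernoulliProb (fun _ => q)
      (fun ξ : NibbleCoord V Col Δ → Bool => ∀ c ∈ Q, ¬ Wins G s ξ s(v, u) c) ≤
      Real.exp (-(q * ((1 - q) ^ N) ^ 2 * Q.card)) := by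
  classical
  have hp : ∀ _ : NibbleCoord V Col Δ, 0 ≤ q ∧ q ≤ 1 := fun _ => hq
  rw [bernoulliProb_forall_of_label (p := fun _ : NibbleCoord V Col Δ => q) Prod.fst Q
    (fun c ξ => ¬ Wins G s ξ s(v, u) c) (by
      intro c _ ξ ξ' h
      simp only [wins_congr h])]
  calc _ ≤ ∏ c ∈ Q, Real.exp (-(q * ((1 - q) ^ N) ^ 2)) := by
        refine Finset.prod_le_prod (fun c _ => bernoulliProb_nonneg hp _) fun c hc => ?_
        rw [bernoulliProb_not]
        have := prob_wins_ge (Δ := Δ) hq hadj hcol (hQ hc) (hv c) (hu c) hN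
        have h3 := Real.add_one_le_exp (-(q * ((1 - q) ^ N) ^ 2))
        linarith
    _ = _ := by
        rw [Finset.prod_const, ← Real.exp_nat_mul]
        congr 1
        ring

theorem prob_freeColors_lt (hq : 0 ≤ q ∧ q ≤ 1) {v u : V}
    (hv : ∀ c, (candNbrs G s v c).card ≤ N) (hu : ∀ c, (candNbrs G s u c).card ≤ N) (hN : N ≤ Δ)
    {Λ Λ' t n : ℝ} (hn : 0 < n) (hnC : (Fintype.card Col : ℝ) ≤ n) (ht : 0 ≤ t)
    (hΛ : Λ ≤ (freeColors s v u).card) (hΛ' : Λ' ≤ ((1 - q) ^ N) ^ 2 * Λ - t) :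
    bernoulliProb (fun _ => q) (fun ξ : NibbleCoord V Col Δ → Bool =>
      ((freeColors (nibbleStep G N s ξ) v u).card : ℝ) < Λ') ≤ Real.exp (-(t ^ 2 / (2 * n))) := by
  classical
  have hp : ∀ _ : NibbleCoord V Col Δ, 0 ≤ q ∧ q ≤ 1 := fun _ => hq
  have e : ∀ ξ : NibbleCoord V Col Δ → Bool, freeColors (nibbleStep G N s ξ) v u =
      (freeColors s v u).filter fun c =>
        ∀ i ∈ hitCoords G N s v c ∪ hitCoords G N s u c, ξ i = false := by
    intro ξ
    ext c
    rw [Finset.mem_filter, mem_freeColors, mem_freeColors]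
    simp only [Finset.mem_union]
    constructor
    · rintro ⟨⟨h1, h2⟩, h3, h4⟩
      exact ⟨⟨h1, h3⟩, fun i hi => hi.elim (h2 i) (h4 i)⟩
    · rintro ⟨⟨h1, h3⟩, h⟩
      exact ⟨⟨h1, fun i hi => h i (Or.inl hi)⟩, h3, fun i hi => h i (Or.inr hi)⟩
  have hdiff : ∀ (j : Col) (ξ ξ' : NibbleCoord V Col Δ → Bool), (∀ i, i.1 ≠ j → ξ i = ξ' i) →
      ∀ x ∈ freeColors (nibbleStep G N s ξ) v u, x ∉ freeColors (nibbleStep G N s ξ') v u →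
        x = j := by
    intro j ξ ξ' h x hx hx'
    by_contra hne
    refine hx' ?_
    rw [e, Finset.mem_filter] at hx ⊢
    refine ⟨hx.1, fun i hi => ?_⟩
    rw [← h i, hx.2 i hi]
    have : i.1 = x := by
      rcases Finset.mem_union.mp hi with hi | hi <;> exact (mem_hitCoords hi).1
    rwa [this]
  refine bernoulliProb_lt_le_of_lipschitz hp Prod.fst Finset.univ _ ?_ ?_ hn ?_ ht ?_ hΛ'
  · intro ξ ξ' h
    rw [show ξ = ξ' from funext fun i => h i (by simp)]
  · intro j _ ξ ξ' h
    have h' : ∀ i : NibbleCoord V Col Δ, i.1 ≠ j → ξ' i = ξ i := fun i hi => (h i hi).symm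
    exact abs_card_sub_card_le_one _ _
      (fun x hx hx' y hy hy' => (hdiff j ξ ξ' h x hx hx').trans (hdiff j ξ ξ' h y hy hy').symm)
      (fun x hx hx' y hy hy' => (hdiff j ξ' ξ h' x hx hx').trans (hdiff j ξ' ξ h' y hy hy').symm)
  · simpa using hnC
  · simp only [e]
    refine le_trans ?_ (bernoulliExp_card_filter (freeColors s v u) fun ξ c =>
      ∀ i ∈ hitCoords G N s v c ∪ hitCoords G N s u c, ξ i = false).ge
    calc ((1 - q) ^ N) ^ 2 * Λ ≤ ((1 - q) ^ N) ^ 2 * (freeColors s v u).card :=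
          mul_le_mul_of_nonneg_left hΛ (by positivity)
      _ = ∑ c ∈ freeColors s v u, ((1 - q) ^ N) ^ 2 := by
          rw [Finset.sum_const, nsmul_eq_mul, mul_comm]
      _ ≤ _ := Finset.sum_le_sum fun c _ => prob_stay_ge hq (hv c) (hu c) hN

theorem noWin_diff_aux {v : V} {W : Finset V} {Q : Finset Col}
    {B : (NibbleCoord V Col Δ → Bool) → V → Prop} [∀ ξ, DecidablePred (B ξ)]
    [∀ ξ : NibbleCoord V Col Δ → Bool, DecidablePred fun u => ∀ c ∈ Q, ¬ Wins G s ξ s(v, u) c]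
    {j : Col} {ξ ξ' : NibbleCoord V Col Δ → Bool} (h : ∀ i, i.1 ≠ j → ξ i = ξ' i)
    (hB : ∀ u, B ξ u → B ξ' u) {x : V}
    (hx : x ∈ W.filter fun u => B ξ u ∧ ∀ c ∈ Q, ¬ Wins G s ξ s(v, u) c)
    (hx' : x ∉ W.filter fun u => B ξ' u ∧ ∀ c ∈ Q, ¬ Wins G s ξ' s(v, u) c) :
    Wins G s ξ' s(v, x) j := by
  rw [Finset.mem_filter] at hx hx'
  by_contra hne
  refine hx' ⟨hx.1, hB x hx.2.1, fun c hc hw => ?_⟩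
  by_cases hcj : c = j
  · exact hne (hcj ▸ hw)
  · refine hx.2.2 c hc ((wins_congr fun i hi => (h i ?_)).mpr hw)
    rwa [hi]

theorem noWin_lipschitz {v : V} {W : Finset V} {Q : Finset Col}
    {B : (NibbleCoord V Col Δ → Bool) → V → Prop} [∀ ξ, DecidablePred (B ξ)]
    [∀ ξ : NibbleCoord V Col Δ → Bool, DecidablePred fun u => ∀ c ∈ Q, ¬ Wins G s ξ s(v, u) c]
    {j : Col} {ξ ξ' : NibbleCoord V Col Δ → Bool} (h : ∀ i, i.1 ≠ j → ξ i = ξ' i)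
    (hB : ∀ u, B ξ u ↔ B ξ' u) :
    |((W.filter fun u => B ξ u ∧ ∀ c ∈ Q, ¬ Wins G s ξ s(v, u) c).card : ℝ) -
      (W.filter fun u => B ξ' u ∧ ∀ c ∈ Q, ¬ Wins G s ξ' s(v, u) c).card| ≤ 1 := by
  have h' : ∀ i : NibbleCoord V Col Δ, i.1 ≠ j → ξ' i = ξ i := fun i hi => (h i hi).symm
  have huniq : ∀ {η : NibbleCoord V Col Δ → Bool} {x y : V}, Wins G s η s(v, x) j →
      Wins G s η s(v, y) j → x = y := fun hx hy =>
    Sym2.congr_right.mp (hx.eq_of_mem hy (x := v) (by simp) (by simp))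
  exact abs_card_sub_card_le_one _ _
    (fun x hx hx' y hy hy' => huniq (noWin_diff_aux h (fun u => (hB u).mp) hx hx')
      (noWin_diff_aux h (fun u => (hB u).mp) hy hy'))
    (fun x hx hx' y hy hy' => huniq (noWin_diff_aux h' (fun u => (hB u).mpr) hx hx')
      (noWin_diff_aux h' (fun u => (hB u).mpr) hy hy'))

theorem prob_uncolNbrs_gt (hq : 0 ≤ q ∧ q ≤ 1) {R : V → Col → Prop} {v : V} {c : Col}
    (hv : ∀ c, (candNbrs G s v c).card ≤ N)
    (hu : ∀ u, G.Adj v u → ∀ c, (candNbrs G s u c).card ≤ N) (hN : N ≤ Δ)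
    {Λ r F F' t n : ℝ} (hn : 0 < n) (hnC : (Fintype.card Col : ℝ) ≤ n) (ht : 0 ≤ t)
    (hΛ : ∀ u, G.Adj v u → s.col s(v, u) = none → Λ ≤ (freeColors s v u).card)
    (hr : Real.exp (-(q * ((1 - q) ^ N) ^ 2 * Λ)) ≤ r)
    (hF : ((uncolNbrs G R s v c).card : ℝ) ≤ F) (hF' : r * F + t ≤ F') :
    bernoulliProb (fun _ => q) (fun ξ : NibbleCoord V Col Δ → Bool =>
      F' < ((uncolNbrs G R (nibbleStep G N s ξ) v c).card : ℝ)) ≤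
        Real.exp (-(t ^ 2 / (2 * n))) := by
  classical
  have hp : ∀ _ : NibbleCoord V Col Δ, 0 ≤ q ∧ q ≤ 1 := fun _ => hq
  set f : (NibbleCoord V Col Δ → Bool) → ℝ := fun ξ => ((uncolNbrs G R s v c).filter fun u =>
    True ∧ ∀ c ∈ (Finset.univ : Finset Col), ¬ Wins G s ξ s(v, u) c).card with hf
  refine (bernoulliProb_mono hp (B := fun ξ => F' < f ξ) fun ξ h => ?_).trans
    (bernoulliProb_ge_le_of_lipschitz hp Prod.fst Finset.univ f ?_ ?_ hn ?_ ht
      (a := r * F) ?_ hF')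
  · refine lt_of_lt_of_le h ?_
    simp only [hf, Nat.cast_le]
    refine Finset.card_le_card fun u hu => ?_
    rw [mem_uncolNbrs] at hu
    have := nibbleStep_col_eq_none hu.2.1
    exact Finset.mem_filter.mpr
      ⟨mem_uncolNbrs.mpr ⟨hu.1, this.1, hu.2.2⟩, trivial, fun c _ => this.2 c⟩
  · intro ξ ξ' h
    rw [show ξ = ξ' from funext fun i => h i (by simp)]
  · intro j _ ξ ξ' h
    exact noWin_lipschitz (B := fun _ _ => True) h fun _ => Iff.rfl
  · simpa using hnC
  · rw [hf, bernoulliExp_card_filter]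
    have hr0 : 0 ≤ r := (Real.exp_pos _).le.trans hr
    calc _ ≤ ∑ u ∈ uncolNbrs G R s v c, r := by
          refine Finset.sum_le_sum fun u hmem => ?_
          have hm := mem_uncolNbrs.mp hmem
          refine (bernoulliProb_mono hp (B := fun ξ =>
            ∀ c ∈ freeColors s v u, ¬ Wins G s ξ s(v, u) c) fun ξ h => ?_).trans
              ((prob_noWin_le hq hm.1 hm.2.1 hv (hu u hm.1) hN _ subset_rfl).trans
                (le_trans ?_ hr))
          · exact fun c _ => h.2 c (Finset.mem_univ c)
          · rw [Real.exp_le_exp, neg_le_neg_iff]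
            exact mul_le_mul_of_nonneg_left (hΛ u hm.1 hm.2.1)
              (mul_nonneg hq.1 (by positivity))
      _ = (uncolNbrs G R s v c).card * r := by rw [Finset.sum_const, nsmul_eq_mul]
      _ ≤ _ := by rw [mul_comm]; exact mul_le_mul_of_nonneg_left hF hr0

end StepProb

section StepProb

variable {V : Type} [Fintype V] [DecidableEq V] {G : SimpleGraph V} [DecidableRel G.Adj]
  {Col : Type} [Fintype Col] [DecidableEq Col] {Δ : ℕ} {s : NibbleState V Col} {N : ℕ} {q : ℝ}

open Classical in
/-- Groups the coordinates of a round relevant for the number of candidates `u` for `c` at `v`: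
one block for each other colour, and one block for each neighbour of `v`. -/
noncomputable def candLabel (G : SimpleGraph V) (v : V) (c : Col) (i : NibbleCoord V Col Δ) :
    Col ⊕ V :=
  if i.1 ≠ c then Sum.inl i.1 else
    match i.2 with
    | Sum.inl e => if h : ∃ u, G.Adj v u ∧ u ∈ e then Sum.inr h.choose else Sum.inr v
    | Sum.inr (u, _) => Sum.inr u

theorem candLabel_of_ne {v : V} {c : Col} {i : NibbleCoord V Col Δ} (h : i.1 ≠ c) :
    candLabel G v c i = Sum.inl i.1 := by
  simp [candLabel, h]

theorem candLabel_of_eq {v : V} {c : Col} {i : NibbleCoord V Col Δ} (h : i.1 = c) (c' : Col) :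
    candLabel G v c i ≠ Sum.inl c' := by
  rw [candLabel, if_neg (not_not.mpr h)]
  split
  · split_ifs <;> simp
  · simp

theorem candLabel_of_mem_hitCoords {v u : V} {c : Col} {i : NibbleCoord V Col Δ}
    (htri : ∀ u w, G.Adj v u → G.Adj v w → ¬ G.Adj u w) (huv : G.Adj v u)
    (hi : i ∈ hitCoords G N s u c) : candLabel G v c i = Sum.inr u := by
  obtain ⟨h1, h2⟩ := mem_hitCoords hi
  obtain ⟨i1, i2⟩ := i
  simp only at h1 h2
  rcases h2 with ⟨w, hw, rfl⟩ | ⟨j, rfl⟩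
  · have hex : ∃ x, G.Adj v x ∧ x ∈ s(u, w) := ⟨u, huv, by simp⟩
    have hch := hex.choose_spec
    have : hex.choose = u := by
      rcases Sym2.mem_iff.mp hch.2 with h | h
      · exact h
      · exact absurd (mem_candNbrs.mp hw).1 (htri u w huv (h ▸ hch.1))
    simp only [candLabel, h1, ne_eq, not_true_eq_false, if_false]
    rw [dif_pos hex, this]
  · simp [candLabel, h1]

theorem prob_candNbrs_gt (hq : 0 ≤ q ∧ q ≤ 1) {v : V} {c : Col}
    (htri : ∀ u w, G.Adj v u → G.Adj v w → ¬ G.Adj u w)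
    (hv : ∀ c, (candNbrs G s v c).card ≤ N)
    (hu : ∀ u, G.Adj v u → ∀ c, (candNbrs G s u c).card ≤ N) (hN : N ≤ Δ)
    {Λ r D D' t n : ℝ} (hn : 0 < n)
    (hnC : (Fintype.card Col : ℝ) + (G.neighborFinset v).card ≤ n) (ht : 0 ≤ t)
    (hΛ : ∀ u, G.Adj v u → s.col s(v, u) = none → Λ ≤ (freeColors s v u).card)
    (hr : Real.exp (-(q * ((1 - q) ^ N) ^ 2 * (Λ - 1))) ≤ r)
    (hD : ((candNbrs G s v c).card : ℝ) ≤ D) (hD' : (1 - q) ^ N * r * D + t ≤ D') :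
    bernoulliProb (fun _ => q) (fun ξ : NibbleCoord V Col Δ → Bool =>
      D' < ((candNbrs G (nibbleStep G N s ξ) v c).card : ℝ)) ≤
        Real.exp (-(t ^ 2 / (2 * n))) := by
  classical
  have hp : ∀ _ : NibbleCoord V Col Δ, 0 ≤ q ∧ q ≤ 1 := fun _ => hq
  set B : (NibbleCoord V Col Δ → Bool) → V → Prop :=
    fun ξ u => ∀ i ∈ hitCoords G N s u c, ξ i = false with hB
  set f : (NibbleCoord V Col Δ → Bool) → ℝ := fun ξ => ((candNbrs G s v c).filter fun u =>
    B ξ u ∧ ∀ c' ∈ Finset.univ.erase c, ¬ Wins G s ξ s(v, u) c').card with hf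
  set J : Finset (Col ⊕ V) :=
    (Finset.univ.erase c).image Sum.inl ∪ (G.neighborFinset v).image Sum.inr with hJ
  refine (bernoulliProb_mono hp (B := fun ξ => D' < f ξ) fun ξ h => ?_).trans
    (bernoulliProb_ge_le_of_lipschitz hp (candLabel G v c) J f ?_ ?_ hn ?_ ht
      (a := (1 - q) ^ N * r * D) ?_ hD')
  · refine lt_of_lt_of_le h ?_
    simp only [hf, Nat.cast_le]
    refine Finset.card_le_card fun u hu => ?_
    rw [mem_candNbrs] at hu
    have := nibbleStep_col_eq_none hu.2.1
    exact Finset.mem_filter.mpr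
      ⟨mem_candNbrs.mpr ⟨hu.1, this.1, hu.2.2.1⟩, hu.2.2.2, fun c _ => this.2 c⟩
  · intro ξ ξ' h
    simp only [hf]
    congr 2
    refine Finset.filter_congr fun u hmem => and_congr ?_ ?_
    · refine forall₂_congr fun i hi => ?_
      rw [h i]
      have huv := (mem_candNbrs.mp hmem).1
      show candLabel G v c i ∈ J
      rw [candLabel_of_mem_hitCoords htri huv hi]
      simp [hJ, huv]
    · refine forall₂_congr fun c' hc' => not_congr (wins_congr fun i hi => h i ?_)
      have hne : i.1 ≠ c := by rw [hi]; exact Finset.ne_of_mem_erase hc'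
      show candLabel G v c i ∈ J
      rw [candLabel_of_ne hne]
      simp [hJ, hne]
  · intro j hj ξ ξ' h
    rcases Finset.mem_union.mp hj with hj | hj
    · obtain ⟨c', hc', rfl⟩ := Finset.mem_image.mp hj
      have hag : ∀ i : NibbleCoord V Col Δ, i.1 ≠ c' → ξ i = ξ' i := by
        intro i hi
        refine h i ?_
        by_cases hic : i.1 = c
        · exact candLabel_of_eq hic c'
        · rw [candLabel_of_ne hic]
          simpa using hi
      refine noWin_lipschitz (B := B) hag fun u => forall₂_congr fun i hi => ?_
      rw [hag i]
      rw [(mem_hitCoords hi).1]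
      exact (Finset.ne_of_mem_erase hc').symm
    · obtain ⟨u₀, hu₀, rfl⟩ := Finset.mem_image.mp hj
      have hdiff : ∀ ξ ξ' : NibbleCoord V Col Δ → Bool,
          (∀ i, candLabel G v c i ≠ Sum.inr u₀ → ξ i = ξ' i) → ∀ x,
          x ∈ ((candNbrs G s v c).filter fun u =>
            B ξ u ∧ ∀ c' ∈ Finset.univ.erase c, ¬ Wins G s ξ s(v, u) c') →
          x ∉ ((candNbrs G s v c).filter fun u =>
            B ξ' u ∧ ∀ c' ∈ Finset.univ.erase c, ¬ Wins G s ξ' s(v, u) c') → x = u₀ := by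
        intro ξ ξ' h x hx hx'
        by_contra hne
        rw [Finset.mem_filter] at hx hx'
        refine hx' ⟨hx.1, fun i hi => ?_, fun c' hc' hw => hx.2.2 c' hc' ?_⟩
        · rw [← h i, hx.2.1 i hi]
          rw [candLabel_of_mem_hitCoords htri (mem_candNbrs.mp hx.1).1 hi]
          simpa using hne
        · refine (wins_congr fun i hi => h i ?_).mpr hw
          rw [candLabel_of_ne (by rw [hi]; exact Finset.ne_of_mem_erase hc')]
          simp
      have h' : ∀ i, candLabel G v c i ≠ Sum.inr u₀ → ξ' i = ξ i := fun i hi => (h i hi).symm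
      exact abs_card_sub_card_le_one _ _
        (fun x hx hx' y hy hy' => (hdiff ξ ξ' h x hx hx').trans (hdiff ξ ξ' h y hy hy').symm)
        (fun x hx hx' y hy hy' => (hdiff ξ' ξ h' x hx hx').trans (hdiff ξ' ξ h' y hy hy').symm)
  · refine le_trans ?_ hnC
    have h1 : J.card ≤ Fintype.card Col + (G.neighborFinset v).card :=
      (Finset.card_union_le _ _).trans (add_le_add
        (Finset.card_image_le.trans (Finset.card_le_univ _)) Finset.card_image_le)
    exact_mod_cast h1
  · refine (bernoulliExp_card_filter (candNbrs G s v c) fun ξ u =>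
      B ξ u ∧ ∀ c' ∈ Finset.univ.erase c, ¬ Wins G s ξ s(v, u) c').le.trans ?_
    have hr0 : 0 ≤ r := (Real.exp_pos _).le.trans hr
    have hk0 : 0 ≤ (1 - q) ^ N := pow_nonneg (by linarith) _
    calc _ ≤ ∑ u ∈ candNbrs G s v c, (1 - q) ^ N * r := by
          refine Finset.sum_le_sum fun u hmem => ?_
          have hm := mem_candNbrs.mp hmem
          rw [bernoulliProb_and_of_disjoint (A := {i : NibbleCoord V Col Δ | i.1 = c})
            (B := {i | i.1 ≠ c})]
          · have e1 : bernoulliProb (fun _ => q) (fun ξ : NibbleCoord V Col Δ → Bool => B ξ u) =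
                (1 - q) ^ N := by
              rw [hB, bernoulliProb_forall_false, card_hitCoords (hu u hm.1 c) hN]
            rw [e1]
            refine mul_le_mul_of_nonneg_left ?_ hk0
            refine (bernoulliProb_mono hp (B := fun ξ =>
              ∀ c' ∈ (freeColors s v u).erase c, ¬ Wins G s ξ s(v, u) c') fun ξ h => ?_).trans
                ((prob_noWin_le hq hm.1 hm.2.1 hv (hu u hm.1) hN _
                  (Finset.erase_subset _ _)).trans (le_trans ?_ hr))
            · exact fun c' hc' => h c' (Finset.mem_erase.mpr
                ⟨Finset.ne_of_mem_erase hc', Finset.mem_univ c'⟩)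
            · rw [Real.exp_le_exp, neg_le_neg_iff]
              refine mul_le_mul_of_nonneg_left ?_ (mul_nonneg hq.1 (by positivity))
              have h1 := Finset.pred_card_le_card_erase (s := freeColors s v u) (a := c)
              have h2 := hΛ u hm.1 hm.2.1
              have h3 : ((freeColors s v u).card : ℝ) ≤ ((freeColors s v u).erase c).card + 1 := by
                exact_mod_cast (by omega : (freeColors s v u).card ≤
                  ((freeColors s v u).erase c).card + 1)
              linarith
          · intro ξ ξ' h
            refine propext (forall₂_congr fun i hi => ?_)
            rw [h i (mem_hitCoords hi).1]
          · intro ξ ξ' h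
            refine propext (forall₂_congr fun c' hc' => not_congr (wins_congr fun i hi => h i ?_))
            show i.1 ≠ c
            rw [hi]; exact Finset.ne_of_mem_erase hc'
          · rw [Set.disjoint_left]
            intro i h h'
            exact h' h
      _ = (candNbrs G s v c).card * ((1 - q) ^ N * r) := by rw [Finset.sum_const, nsmul_eq_mul]
      _ ≤ _ := by rw [mul_comm]; exact mul_le_mul_of_nonneg_left hD (mul_nonneg hk0 hr0)

/-- If the parameters of the nibble are under control around `v` before a round, then they are
likely to be under control at `v` after it. -/
theorem prob_not_stateOK_le (hq : 0 ≤ q ∧ q ≤ 1) {R : V → Col → Prop} {v : V}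
    (htri : ∀ u w, G.Adj v u → G.Adj v w → ¬ G.Adj u w)
    {Λ D F Λ' D' F' r t n : ℝ} (hN : N ≤ Δ) (hDN : ⌊D⌋₊ ≤ N) (hn : 0 < n)
    (hnC : (Fintype.card Col : ℝ) + (G.neighborFinset v).card ≤ n) (ht : 0 ≤ t)
    (hOK : StateOK G R Λ D F s v) (hOK' : ∀ u, G.Adj v u → StateOK G R Λ D F s u)
    (hr : Real.exp (-(q * ((1 - q) ^ N) ^ 2 * (Λ - 1))) ≤ r)
    (hΛ' : Λ' ≤ ((1 - q) ^ N) ^ 2 * Λ - t) (hD' : (1 - q) ^ N * r * D + t ≤ D')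
    (hF' : r * F + t ≤ F') :
    bernoulliProb (fun _ => q) (fun ξ : NibbleCoord V Col Δ → Bool =>
      ¬ StateOK G R Λ' D' F' (nibbleStep G N s ξ) v) ≤
        2 * n * Real.exp (-(t ^ 2 / (2 * n))) := by
  classical
  have hp : ∀ _ : NibbleCoord V Col Δ, 0 ≤ q ∧ q ≤ 1 := fun _ => hq
  have hv : ∀ c, (candNbrs G s v c).card ≤ N := fun c =>
    (Nat.le_floor (hOK.cand c)).trans hDN
  have hu : ∀ u, G.Adj v u → ∀ c, (candNbrs G s u c).card ≤ N := fun u h c =>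
    (Nat.le_floor ((hOK' u h).cand c)).trans hDN
  have hr' : Real.exp (-(q * ((1 - q) ^ N) ^ 2 * Λ)) ≤ r := by
    refine le_trans ?_ hr
    rw [Real.exp_le_exp, neg_le_neg_iff]
    exact mul_le_mul_of_nonneg_left (by linarith) (mul_nonneg hq.1 (by positivity))
  have hnb : (0 : ℝ) ≤ (G.neighborFinset v).card := Nat.cast_nonneg _
  have hcc : (0 : ℝ) ≤ Fintype.card Col := Nat.cast_nonneg _
  have hnC' : (Fintype.card Col : ℝ) ≤ n := by linarith
  set δ := Real.exp (-(t ^ 2 / (2 * n)))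
  have hδ : 0 ≤ δ := (Real.exp_pos _).le
  have h1 := bernoulliProb_exists_le hp
    ((G.neighborFinset v).filter fun u => s.col s(v, u) = none)
    (fun u (ξ : NibbleCoord V Col Δ → Bool) =>
      ((freeColors (nibbleStep G N s ξ) v u).card : ℝ) < Λ')
  have h2 := bernoulliProb_exists_le hp (Finset.univ : Finset Col)
    (fun c (ξ : NibbleCoord V Col Δ → Bool) =>
      D' < ((candNbrs G (nibbleStep G N s ξ) v c).card : ℝ))
  have h3 := bernoulliProb_exists_le hp (Finset.univ : Finset Col)
    (fun c (ξ : NibbleCoord V Col Δ → Bool) =>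
      F' < ((uncolNbrs G R (nibbleStep G N s ξ) v c).card : ℝ))
  have h1' := h1.trans (Finset.sum_le_card_nsmul _ _ δ fun u hmem => by
    simp only [Finset.mem_filter, mem_neighborFinset] at hmem
    exact prob_freeColors_lt hq hv (hu u hmem.1) hN hn hnC' ht (hOK.free u hmem.1 hmem.2) hΛ')
  have h2' := h2.trans (Finset.sum_le_card_nsmul _ _ δ fun c _ =>
    prob_candNbrs_gt hq htri hv hu hN hn hnC ht hOK.free hr (hOK.cand c) hD')
  have h3' := h3.trans (Finset.sum_le_card_nsmul _ _ δ fun c _ =>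
    prob_uncolNbrs_gt hq hv hu hN hn hnC' ht hOK.free hr' (hOK.uncol c) hF')
  rw [nsmul_eq_mul] at h1' h2' h3'
  have hfree := h1'.trans (mul_le_mul_of_nonneg_right
    (Nat.cast_le (α := ℝ).mpr (Finset.card_filter_le _ _)) hδ)
  rw [Finset.card_univ] at h2' h3'
  have hsub := bernoulliProb_mono hp (A := fun ξ : NibbleCoord V Col Δ → Bool =>
      ¬ StateOK G R Λ' D' F' (nibbleStep G N s ξ) v)
    (B := fun ξ => (∃ u ∈ (G.neighborFinset v).filter fun u => s.col s(v, u) = none,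
      ((freeColors (nibbleStep G N s ξ) v u).card : ℝ) < Λ') ∨
      (∃ c ∈ (Finset.univ : Finset Col), D' < ((candNbrs G (nibbleStep G N s ξ) v c).card : ℝ)) ∨
      ∃ c ∈ (Finset.univ : Finset Col),
        F' < ((uncolNbrs G R (nibbleStep G N s ξ) v c).card : ℝ)) (by
    intro ξ h
    by_contra hcon
    push Not at hcon
    obtain ⟨c1, c2, c3⟩ := hcon
    refine h ⟨fun u huv hcol => c1 u ?_, fun c => c2 c (Finset.mem_univ c),
      fun c => c3 c (Finset.mem_univ c)⟩
    simp only [Finset.mem_filter, mem_neighborFinset]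
    exact ⟨huv, (nibbleStep_col_eq_none hcol).1⟩)
  refine hsub.trans ((bernoulliProb_or_le hp _ _).trans
    ((add_le_add hfree ((bernoulliProb_or_le hp _ _).trans (add_le_add h2' h3'))).trans ?_))
  nlinarith

end StepProb

section Ball

variable {V : Type} [Fintype V] [DecidableEq V] (G : SimpleGraph V) [DecidableRel G.Adj]

/-- The vertices at distance at most `r` from `v`. -/
def graphBall : ℕ → V → Finset V
  | 0, v => {v}
  | r + 1, v => (insert v (G.neighborFinset v)).biUnion (graphBall r)

variable {G}

theorem mem_graphBall {r : ℕ} {v x : V} :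
    x ∈ graphBall G r v ↔ ∃ w : G.Walk v x, w.length ≤ r := by
  induction r generalizing v with
  | zero =>
    simp only [graphBall, Finset.mem_singleton]
    constructor
    · rintro rfl
      exact ⟨Walk.nil, le_rfl⟩
    · rintro ⟨w, hw⟩
      exact (Walk.eq_of_length_eq_zero (Nat.le_zero.mp hw)).symm
  | succ r ih =>
    simp only [graphBall, Finset.mem_biUnion, Finset.mem_insert, mem_neighborFinset, ih]
    constructor
    · rintro ⟨u, rfl | h, w, hw⟩
      · exact ⟨w, by omega⟩
      · exact ⟨Walk.cons h w, by simpa using hw⟩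
    · rintro ⟨w, hw⟩
      cases w with
      | nil => exact ⟨x, Or.inl rfl, Walk.nil, Nat.zero_le _⟩
      | cons h w => exact ⟨_, Or.inr h, w, by simpa using hw⟩

theorem mem_graphBall_comm {r : ℕ} {v x : V} : x ∈ graphBall G r v ↔ v ∈ graphBall G r x := by
  simp only [mem_graphBall]
  constructor <;> rintro ⟨w, hw⟩ <;> exact ⟨w.reverse, by simpa using hw⟩

theorem self_mem_graphBall (r : ℕ) (v : V) : v ∈ graphBall G r v :=
  mem_graphBall.mpr ⟨Walk.nil, Nat.zero_le _⟩

theorem adj_mem_graphBall {r : ℕ} (hr : 1 ≤ r) {v u : V} (h : G.Adj v u) :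
    u ∈ graphBall G r v :=
  mem_graphBall.mpr ⟨Walk.cons h Walk.nil, by simpa using hr⟩

theorem graphBall_subset {r r' k : ℕ} {v u : V} (h : u ∈ graphBall G k v) (hk : k + r ≤ r') :
    graphBall G r u ⊆ graphBall G r' v := by
  intro x hx
  obtain ⟨w, hw⟩ := mem_graphBall.mp h
  obtain ⟨w', hw'⟩ := mem_graphBall.mp hx
  exact mem_graphBall.mpr ⟨w.append w', by rw [Walk.length_append]; omega⟩

theorem card_graphBall_le {Δ : ℕ} (hΔ : G.IsRegularOfDegree Δ) (r : ℕ) (v : V) :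
    (graphBall G r v).card ≤ (Δ + 1) ^ r := by
  induction r generalizing v with
  | zero => simp [graphBall]
  | succ r ih =>
    rw [graphBall, pow_succ']
    refine (Finset.card_biUnion_le_card_mul _ _ _ fun u _ => ih u).trans ?_
    refine Nat.mul_le_mul_right _ ((Finset.card_insert_le _ _).trans ?_)
    rw [card_neighborFinset_eq_degree, hΔ v]

end Ball

section Rounds

variable {V : Type} [Fintype V] [DecidableEq V] (G : SimpleGraph V) [DecidableRel G.Adj]
  {Col : Type} [Fintype Col] [DecidableEq Col] {Δ : ℕ}

/-- The vertices at which a coordinate of a round is located. -/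
def coordLoc (i : NibbleCoord V Col Δ) : Set V :=
  match i.2 with
  | Sum.inl e => {x | x ∈ e}
  | Sum.inr (v, _) => {v}

/-- The stage of the nibble after `t` rounds. -/
noncomputable def nibbleState (N : ℕ → ℕ) (s₀ : NibbleState V Col)
    (η : ℕ → NibbleCoord V Col Δ → Bool) : ℕ → NibbleState V Col
  | 0 => s₀
  | t + 1 => nibbleStep G (N t) (nibbleState N s₀ η t) (η t)

/-- The two stages look the same at `v`. -/
def LocalEq (s s' : NibbleState V Col) (v : V) : Prop :=
  (∀ c, s.avail v c ↔ s'.avail v c) ∧ ∀ u, G.Adj v u → s.col s(v, u) = s'.col s(v, u)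

variable {G}

theorem candNbrs_congr {s s' : NibbleState V Col} {v : V}
    (h : ∀ x ∈ graphBall G 1 v, LocalEq G s s' x) (c : Col) :
    candNbrs G s v c = candNbrs G s' v c := by
  ext u
  simp only [mem_candNbrs]
  refine and_congr_right fun hu => ?_
  rw [(h v (self_mem_graphBall _ _)).2 u hu, (h u (adj_mem_graphBall le_rfl hu)).1]

theorem hitCoords_congr {s s' : NibbleState V Col} {v : V}
    (h : ∀ x ∈ graphBall G 1 v, LocalEq G s s' x) (N : ℕ) (c : Col) :
    (hitCoords G N s v c : Finset (NibbleCoord V Col Δ)) = hitCoords G N s' v c := by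
  unfold hitCoords
  rw [candNbrs_congr h]

theorem coordLoc_hitCoords {s : NibbleState V Col} {v : V} {N : ℕ} {c : Col}
    {i : NibbleCoord V Col Δ} (hi : i ∈ hitCoords G N s v c) :
    coordLoc i ⊆ (graphBall G 1 v : Set V) := by
  obtain ⟨-, ⟨u, hu, h⟩ | ⟨j, h⟩⟩ := mem_hitCoords hi
  · simp only [coordLoc, h]
    intro x hx
    rcases Sym2.mem_iff.mp hx with rfl | rfl
    · exact self_mem_graphBall _ _
    · exact adj_mem_graphBall le_rfl (mem_candNbrs.mp hu).1
  · simp only [coordLoc, h]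
    intro x hx
    rw [Set.mem_singleton_iff.mp hx]
    exact self_mem_graphBall _ _

theorem nibbleStep_localEq {s s' : NibbleState V Col} {ξ ξ' : NibbleCoord V Col Δ → Bool} {v : V}
    (N : ℕ) (h : ∀ x ∈ graphBall G 2 v, LocalEq G s s' x)
    (hξ : ∀ i, coordLoc i ⊆ (graphBall G 2 v : Set V) → ξ i = ξ' i) :
    LocalEq G (nibbleStep G N s ξ) (nibbleStep G N s' ξ') v := by
  have h12 : graphBall G 1 v ⊆ graphBall G 2 v :=
    graphBall_subset (k := 0) (self_mem_graphBall _ _) (by norm_num)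
  have hv := h v (self_mem_graphBall _ _)
  constructor
  · intro c
    show s.avail v c ∧ (∀ i ∈ hitCoords G N s v c, ξ i = false) ↔
      s'.avail v c ∧ ∀ i ∈ hitCoords G N s' v c, ξ' i = false
    rw [hv.1, hitCoords_congr fun x hx => h x (h12 hx)]
    refine and_congr_right fun _ => forall₂_congr fun i hi => ?_
    rw [hξ i ((coordLoc_hitCoords hi).trans (by exact_mod_cast h12))]
  · intro u hu
    have hP : ∀ e c, (∃ x, x ∈ s(v, u) ∧ x ∈ e) → (Proposes G s ξ e c ↔ Proposes G s' ξ' e c) := by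
      rintro e c ⟨a, ha, b, rfl⟩
      refine and_congr_right fun (hadj : G.Adj a b) => ?_
      have ha1 : a ∈ graphBall G 1 v := by
        rcases Sym2.mem_iff.mp ha with rfl | rfl
        · exact self_mem_graphBall _ _
        · exact adj_mem_graphBall le_rfl hu
      have hb2 : b ∈ graphBall G 2 v :=
        graphBall_subset (r := 1) ha1 le_rfl (adj_mem_graphBall le_rfl hadj)
      rw [(h a (h12 ha1)).2 b hadj, hξ (c, Sum.inl s(a, b)) ?_]
      · simp only [Sym2.mem_iff, forall_eq_or_imp, forall_eq, (h a (h12 ha1)).1, (h b hb2).1]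
      · intro x (hx : x ∈ s(a, b))
        rcases Sym2.mem_iff.mp hx with rfl | rfl
        · exact h12 ha1
        · exact hb2
    have hW : Wins G s ξ s(v, u) = Wins G s' ξ' s(v, u) := by
      ext c
      unfold Wins
      refine and_congr (hP _ c ⟨v, by simp, by simp⟩) (forall_congr' fun e' => ?_)
      constructor
      · intro h1 h2 h3
        exact h1 ((hP e' c h3).mpr h2) h3
      · intro h1 h2 h3
        exact h1 ((hP e' c h3).mp h2) h3
    simp only [nibbleStep]
    rw [hW, hv.2 u hu]

theorem StateOK.congr {R : V → Col → Prop} {Λ D F : ℝ} {s s' : NibbleState V Col} {v : V}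
    (h : ∀ x ∈ graphBall G 1 v, LocalEq G s s' x) (hs : StateOK G R Λ D F s v) :
    StateOK G R Λ D F s' v := by
  have hv := h v (self_mem_graphBall _ _)
  refine ⟨fun u hu hcol => ?_, fun c => ?_, fun c => ?_⟩
  · have : freeColors s' v u = freeColors s v u := by
      ext c
      rw [mem_freeColors, mem_freeColors, hv.1, (h u (adj_mem_graphBall le_rfl hu)).1]
    rw [this]
    exact hs.free u hu (by rw [hv.2 u hu, hcol])
  · rw [← candNbrs_congr h]; exact hs.cand c
  · have : uncolNbrs G R s' v c = uncolNbrs G R s v c := by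
      ext u
      rw [mem_uncolNbrs, mem_uncolNbrs]
      refine and_congr_right fun hu => ?_
      rw [hv.2 u hu]
    rw [this]; exact hs.uncol c

theorem nibbleState_localEq {N : ℕ → ℕ} {s₀ : NibbleState V Col}
    {η η' : ℕ → NibbleCoord V Col Δ → Bool} (t : ℕ) (v : V)
    (h : ∀ t' < t, ∀ i, coordLoc i ⊆ (graphBall G (2 * t) v : Set V) → η t' i = η' t' i) :
    LocalEq G (nibbleState G N s₀ η t) (nibbleState G N s₀ η' t) v := by
  induction t generalizing v with
  | zero => exact ⟨fun _ => Iff.rfl, fun _ _ => rfl⟩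
  | succ t ih =>
    refine nibbleStep_localEq (N t) (fun x hx => ih x fun t' ht' i hi => h t' (by omega) i ?_)
      fun i hi => h t (by omega) i ?_
    · exact hi.trans (by exact_mod_cast graphBall_subset hx (by omega))
    · have hb : graphBall G 2 v ⊆ graphBall G (2 * (t + 1)) v :=
        graphBall_subset (k := 0) (self_mem_graphBall 0 v) (by omega)
      exact hi.trans (by exact_mod_cast hb)

theorem nibbleState_congr {N : ℕ → ℕ} {s₀ : NibbleState V Col}
    {η η' : ℕ → NibbleCoord V Col Δ → Bool} (t : ℕ) (h : ∀ t' < t, η t' = η' t') :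
    nibbleState G N s₀ η t = nibbleState G N s₀ η' t := by
  induction t with
  | zero => rfl
  | succ t ih =>
    rw [nibbleState, nibbleState, ih fun t' ht' => h t' (by omega), h t (by omega)]

/-- Consistency of a stage of the nibble. -/
structure NibbleInv (G : SimpleGraph V) (R : V → Col → Prop) (s : NibbleState V Col) : Prop where
  mem_edgeSet : ∀ e c, s.col e = some c → e ∈ G.edgeSet
  not_avail : ∀ e c, s.col e = some c → ∀ x ∈ e, ¬ s.avail x c ∧ ¬ R x c
  proper : ∀ e e' c x, s.col e = some c → s.col e' = some c → x ∈ e → x ∈ e' → e = e'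
  avail : ∀ v c, s.avail v c → ¬ R v c

theorem nibbleStep_col_eq_some {s : NibbleState V Col} {N : ℕ} {ξ : NibbleCoord V Col Δ → Bool}
    {e : Sym2 V} {c : Col} (h : (nibbleStep G N s ξ).col e = some c) :
    s.col e = some c ∨ Wins G s ξ e c := by
  simp only [nibbleStep] at h
  split_ifs at h with h'
  · exact Or.inr (of_pickSome h)
  · exact Or.inl h

theorem NibbleInv.step {R : V → Col → Prop} {s : NibbleState V Col} (hs : NibbleInv G R s) (N : ℕ)
    (ξ : NibbleCoord V Col Δ → Bool) : NibbleInv G R (nibbleStep G N s ξ) where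
  mem_edgeSet e c h := by
    rcases nibbleStep_col_eq_some h with h | h
    · exact hs.mem_edgeSet e c h
    · exact h.1.1
  not_avail e c h x hx := by
    rcases nibbleStep_col_eq_some h with h | h
    · exact ⟨fun h' => (hs.not_avail e c h x hx).1 h'.1, (hs.not_avail e c h x hx).2⟩
    · refine ⟨fun h' => ?_, hs.avail x c (h.1.2.2.1 x hx)⟩
      have := h'.2 _ (Proposes.mem_hitCoords h.1 hx)
      rw [h.1.2.2.2] at this
      simp at this
  proper e e' c x h h' hx hx' := by
    rcases nibbleStep_col_eq_some h with h | h <;> rcases nibbleStep_col_eq_some h' with h' | h'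
    · exact hs.proper e e' c x h h' hx hx'
    · exact absurd (h'.1.2.2.1 x hx') (hs.not_avail e c h x hx).1
    · exact absurd (h.1.2.2.1 x hx) (hs.not_avail e' c h' x hx').1
    · exact h.eq_of_mem h' hx hx'
  avail v c h := hs.avail v c h.1

theorem nibbleState_inv {R : V → Col → Prop} {N : ℕ → ℕ} {s₀ : NibbleState V Col}
    (h₀ : NibbleInv G R s₀) (η : ℕ → NibbleCoord V Col Δ → Bool) (t : ℕ) :
    NibbleInv G R (nibbleState G N s₀ η t) := by
  induction t with
  | zero => exact h₀
  | succ t ih => exact ih.step _ _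

theorem nibbleState_col_eq_some {N : ℕ → ℕ} {s₀ : NibbleState V Col}
    (h₀ : ∀ e, s₀.col e = none) {η : ℕ → NibbleCoord V Col Δ → Bool} {t : ℕ} {e : Sym2 V} {c : Col}
    (h : (nibbleState G N s₀ η t).col e = some c) : ∃ t' < t, η t' (c, Sum.inl e) = true := by
  induction t with
  | zero => rw [nibbleState, h₀] at h; simp at h
  | succ t ih =>
    rcases nibbleStep_col_eq_some h with h | h
    · obtain ⟨t', ht', h'⟩ := ih h
      exact ⟨t', by omega, h'⟩
    · exact ⟨t, by omega, h.1.2.2.2⟩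

/-- The coordinates of the `t`-th round in a configuration for `T` rounds. -/
def roundOf {T : ℕ} {X : Type} (ω : Fin T × X → Bool) (t : ℕ) (x : X) : Bool :=
  if h : t < T then ω (⟨t, h⟩, x) else false

variable (G) in
/-- The parameters are under control around `v` after `t` rounds, but not at `v` one round
later. -/
def BadRound {T : ℕ} (R : V → Col → Prop) (N : ℕ → ℕ) (Λ D F : ℕ → ℝ) (s₀ : NibbleState V Col)
    (t : ℕ) (v : V) (ω : Fin T × NibbleCoord V Col Δ → Bool) : Prop :=
  (∀ w ∈ graphBall G 1 v, StateOK G R (Λ t) (D t) (F t) (nibbleState G N s₀ (roundOf ω) t) w) ∧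
    ¬ StateOK G R (Λ (t + 1)) (D (t + 1)) (F (t + 1)) (nibbleState G N s₀ (roundOf ω) (t + 1)) v

theorem stateOK_of_not_badRound {T : ℕ} {R : V → Col → Prop} {N : ℕ → ℕ} {Λ D F : ℕ → ℝ}
    {s₀ : NibbleState V Col} {ω : Fin T × NibbleCoord V Col Δ → Bool}
    (h₀ : ∀ v, StateOK G R (Λ 0) (D 0) (F 0) s₀ v)
    (h : ∀ t < T, ∀ v, ¬ BadRound G R N Λ D F s₀ t v ω) (t : ℕ) (ht : t ≤ T) (v : V) :
    StateOK G R (Λ t) (D t) (F t) (nibbleState G N s₀ (roundOf ω) t) v := by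
  induction t generalizing v with
  | zero => exact h₀ v
  | succ t ih =>
    by_contra hcon
    exact h t (by omega) v ⟨fun w _ => ih (by omega) w, hcon⟩

theorem badRound_dependsOnlyOn {T : ℕ} (R : V → Col → Prop) (N : ℕ → ℕ) (Λ D F : ℕ → ℝ)
    (s₀ : NibbleState V Col) (t : ℕ) (ht : t < T) (v : V) :
    DependsOnlyOn (BadRound (T := T) (Δ := Δ) G R N Λ D F s₀ t v)
      {i | coordLoc i.2 ⊆ (graphBall G (2 * T + 4) v : Set V)} := by
  have key : ∀ ω ω' : Fin T × NibbleCoord V Col Δ → Bool,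
      (∀ i ∈ {i : Fin T × NibbleCoord V Col Δ |
        coordLoc i.2 ⊆ (graphBall G (2 * T + 4) v : Set V)}, ω i = ω' i) →
      ∀ t' ≤ T, ∀ w ∈ graphBall G 2 v, LocalEq G (nibbleState G N s₀ (roundOf ω) t')
        (nibbleState G N s₀ (roundOf ω') t') w := by
    intro ω ω' h t' ht' w hw
    refine nibbleState_localEq t' w fun j hlt i hi => ?_
    unfold roundOf
    rw [dif_pos (by omega), dif_pos (by omega)]
    exact h _ (hi.trans (by exact_mod_cast graphBall_subset hw (by omega)))
  have hlift : ∀ ω ω' : Fin T × NibbleCoord V Col Δ → Bool,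
      (∀ i ∈ {i : Fin T × NibbleCoord V Col Δ |
        coordLoc i.2 ⊆ (graphBall G (2 * T + 4) v : Set V)}, ω i = ω' i) →
      BadRound G R N Λ D F s₀ t v ω → BadRound G R N Λ D F s₀ t v ω' := by
    intro ω ω' h ⟨h1, h2⟩
    refine ⟨fun w hw => (h1 w hw).congr fun x hx => key ω ω' h t ht.le x ?_, fun h3 => h2 ?_⟩
    · exact graphBall_subset hw (by norm_num) hx
    · refine h3.congr fun x hx => key ω' ω (fun i hi => (h i hi).symm) (t + 1) ht x ?_
      exact graphBall_subset (k := 0) (self_mem_graphBall _ _) (by norm_num) hx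
  intro ω ω' h
  exact propext ⟨hlift ω ω' h, hlift ω' ω fun i hi => (h i hi).symm⟩

theorem prob_badRound_le {T : ℕ} {R : V → Col → Prop} {N : ℕ → ℕ} {Λ D F : ℕ → ℝ}
    {s₀ : NibbleState V Col} {q : ℕ → ℝ} (hq : ∀ t, 0 ≤ q t ∧ q t ≤ 1)
    (htri : ∀ v u w, G.Adj v u → G.Adj v w → ¬ G.Adj u w) {t : ℕ} (ht : t < T) (v : V)
    {r n τ : ℝ} (hN : N t ≤ Δ) (hDN : ⌊D t⌋₊ ≤ N t) (hn : 0 < n)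
    (hnC : (Fintype.card Col : ℝ) + (G.neighborFinset v).card ≤ n) (hτ : 0 ≤ τ)
    (hr : Real.exp (-(q t * ((1 - q t) ^ N t) ^ 2 * (Λ t - 1))) ≤ r)
    (hΛ' : Λ (t + 1) ≤ ((1 - q t) ^ N t) ^ 2 * Λ t - τ)
    (hD' : (1 - q t) ^ N t * r * D t + τ ≤ D (t + 1)) (hF' : r * F t + τ ≤ F (t + 1)) :
    bernoulliProb (fun i : Fin T × NibbleCoord V Col Δ => q i.1)
      (BadRound G R N Λ D F s₀ t v) ≤ 2 * n * Real.exp (-(τ ^ 2 / (2 * n))) := by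
  have hp : ∀ i : Fin T × NibbleCoord V Col Δ, 0 ≤ q i.1 ∧ q i.1 ≤ 1 := fun i => hq i.1
  have hb : 0 ≤ 2 * n * Real.exp (-(τ ^ 2 / (2 * n))) := by positivity
  refine bernoulliProb_le_of_merge hp {i | i.1 = ⟨t, ht⟩} _ _ fun ω => ?_
  set s := nibbleState G N s₀ (roundOf ω) t with hs
  have hround : ∀ ω' : Fin T × NibbleCoord V Col Δ → Bool,
      nibbleState G N s₀ (roundOf (mergeOn {i | i.1 = ⟨t, ht⟩} ω' ω)) t = s := by
    intro ω'
    refine nibbleState_congr t fun t' ht' => ?_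
    ext x
    unfold roundOf
    rw [dif_pos (ht'.trans ht), dif_pos (ht'.trans ht), mergeOn_of_notMem]
    simp only [Set.mem_ofPred_eq, Fin.mk.injEq]
    omega
  have hstep : ∀ ω' : Fin T × NibbleCoord V Col Δ → Bool,
      nibbleState G N s₀ (roundOf (mergeOn {i | i.1 = ⟨t, ht⟩} ω' ω)) (t + 1) =
        nibbleStep G (N t) s fun x => ω' (⟨t, ht⟩, x) := by
    intro ω'
    rw [nibbleState, hround]
    congr 1
    ext x
    unfold roundOf
    rw [dif_pos ht]
    exact mergeOn_of_mem (A := {i : Fin T × NibbleCoord V Col Δ | i.1 = ⟨t, ht⟩}) (by simp) _ _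
  by_cases hOK : ∀ w ∈ graphBall G 1 v, StateOK G R (Λ t) (D t) (F t) s w
  · refine (bernoulliProb_mono hp (B := fun ω' => ¬ StateOK G R (Λ (t + 1)) (D (t + 1)) (F (t + 1))
      (nibbleStep G (N t) s fun x => ω' (⟨t, ht⟩, x)) v) fun ω' h => ?_).trans ?_
    · rw [← hstep]; exact h.2
    · rw [bernoulliProb_comp (fun x : NibbleCoord V Col Δ => ((⟨t, ht⟩ : Fin T), x))
        (fun a b h => by simpa using h) (fun ξ => ¬ StateOK G R (Λ (t + 1)) (D (t + 1)) (F (t + 1))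
          (nibbleStep G (N t) s ξ) v)]
      exact prob_not_stateOK_le (hq t) (htri v) hN hDN hn hnC hτ
        (hOK v (self_mem_graphBall _ _)) (fun u hu => hOK u (adj_mem_graphBall le_rfl hu))
        hr hΛ' hD' hF'
  · have : (fun ω' => BadRound G R N Λ D F s₀ t v (mergeOn {i | i.1 = ⟨t, ht⟩} ω' ω)) =
        fun _ => False := by
      ext ω'
      simp only [iff_false]
      rintro ⟨h1, -⟩
      rw [hround] at h1
      exact hOK h1
    rw [this, bernoulliProb_false]
    exact hb

end Rounds

section Cycles

variable {V : Type} [Fintype V] [DecidableEq V] {G : SimpleGraph V} [DecidableRel G.Adj]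

theorem walk_eq_of_length_add_lt_girth {u v : V} {p q : G.Walk u v} (hp : p.IsPath) (hq : q.IsPath)
    (h : p.length + q.length < G.girth) : p = q := by
  set H : SimpleGraph V := SimpleGraph.fromEdgeSet {e | e ∈ p.edges ∨ e ∈ q.edges} with hH
  have hle : H ≤ G := by
    intro a b hab
    rw [hH, SimpleGraph.fromEdgeSet_adj] at hab
    rcases hab.1 with h1 | h1
    · exact p.adj_of_mem_edges h1
    · exact q.adj_of_mem_edges h1
  have hac : H.IsAcyclic := by
    intro a w hw
    have h1 : G.girth ≤ (w.mapLe hle).length := girth_le_length (hw.mapLe hle)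
    have h2 : w.edges.length ≤ (p.edges ++ q.edges).length := by
      refine (List.subperm_of_subset hw.edges_nodup fun e he => ?_).length_le
      have := w.edges_subset_edgeSet he
      rw [hH, SimpleGraph.edgeSet_fromEdgeSet] at this
      simpa using this.1
    simp only [Walk.length_map, Walk.length_edges, List.length_append] at h1 h2
    omega
  have hpH : ∀ e ∈ p.edges, e ∈ H.edgeSet := fun e he => by
    rw [hH, SimpleGraph.edgeSet_fromEdgeSet]
    exact ⟨Or.inl he, G.not_isDiag_of_mem_edgeSet (p.edges_subset_edgeSet he)⟩
  have hqH : ∀ e ∈ q.edges, e ∈ H.edgeSet := fun e he => by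
    rw [hH, SimpleGraph.edgeSet_fromEdgeSet]
    exact ⟨Or.inr he, G.not_isDiag_of_mem_edgeSet (q.edges_subset_edgeSet he)⟩
  have := (hac.subsingleton_path u v).elim ⟨p.transfer H hpH, hp.transfer hpH⟩
    ⟨q.transfer H hqH, hq.transfer hqH⟩
  have h3 : p.transfer H hpH = q.transfer H hqH := congrArg Subtype.val this
  refine Walk.ext_support ?_
  rw [← Walk.support_transfer p hpH, h3, Walk.support_transfer]

theorem exists_walk_of_forall_adj (f : ℕ → V) (n : ℕ) (h : ∀ i < n, G.Adj (f i) (f (i + 1))) :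
    ∃ w : G.Walk (f 0) (f n), w.length = n ∧ ∀ i ≤ n, w.getVert i = f i := by
  induction n generalizing f with
  | zero => exact ⟨Walk.nil, rfl, fun i hi => by simp [Nat.le_zero.mp hi]⟩
  | succ n ih =>
    obtain ⟨w, hw, hw'⟩ := ih (fun i => f (i + 1)) fun i hi => h (i + 1) (by omega)
    refine ⟨Walk.cons (h 0 (by omega)) w, by simp [hw], fun i hi => ?_⟩
    cases i with
    | zero => simp
    | succ i => rw [Walk.getVert_cons_succ, hw' i (by omega)]

theorem eq_of_short_paths {f f' : ℕ → V} {m : ℕ} (hf : ∀ i < m, G.Adj (f i) (f (i + 1)))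
    (hf' : ∀ i < m, G.Adj (f' i) (f' (i + 1))) (hi : Set.InjOn f {i | i ≤ m})
    (hi' : Set.InjOn f' {i | i ≤ m}) (h0 : f 0 = f' 0) (hm : f m = f' m)
    (hg : 2 * m < G.girth) : ∀ i ≤ m, f i = f' i := by
  obtain ⟨w, hw, hwf⟩ := exists_walk_of_forall_adj f m hf
  obtain ⟨w', hw', hwf'⟩ := exists_walk_of_forall_adj f' m hf'
  have hp : w.IsPath := by
    rw [← Walk.IsPath.getVert_injOn_iff]
    intro a ha b hb hab
    rw [Set.mem_ofPred_eq, hw] at ha hb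
    rw [hwf a ha, hwf b hb] at hab
    exact hi ha hb hab
  have hp' : (w'.copy h0.symm hm.symm).IsPath := by
    rw [Walk.isPath_copy, ← Walk.IsPath.getVert_injOn_iff]
    intro a ha b hb hab
    rw [Set.mem_ofPred_eq, hw'] at ha hb
    rw [hwf' a ha, hwf' b hb] at hab
    exact hi' ha hb hab
  have heq := walk_eq_of_length_add_lt_girth hp hp' (by rw [Walk.length_copy]; omega)
  intro i hi
  rw [← hwf i hi, ← hwf' i hi, heq, Walk.getVert_copy]

variable (G) in
/-- Sequences of `n + 1` successively adjacent vertices starting at `x`. -/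
def chainSeqs (x : V) (n : ℕ) : Finset (Fin (n + 1) → V) :=
  univ.filter fun f => f 0 = x ∧ ∀ i : Fin n, G.Adj (f i.castSucc) (f i.succ)

theorem card_chainSeqs_le {Δ : ℕ} (hΔ : G.IsRegularOfDegree Δ) (x : V) (n : ℕ) :
    (chainSeqs G x n).card ≤ Δ ^ n := by
  induction n with
  | zero =>
    rw [pow_zero, Finset.card_le_one]
    intro f hf f' hf'
    simp only [chainSeqs, mem_filter, mem_univ, true_and] at hf hf'
    ext i
    rw [Subsingleton.elim (α := Fin 1) i 0, hf.1, hf'.1]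
  | succ n ih =>
    have hmaps : ∀ f ∈ chainSeqs G x (n + 1), Fin.init (α := fun _ => V) f ∈ chainSeqs G x n := by
      intro f hf
      simp only [chainSeqs, mem_filter, mem_univ, true_and, Fin.init] at hf ⊢
      exact ⟨hf.1, fun i => hf.2 i.castSucc⟩
    refine (Finset.card_le_mul_card_image_of_maps_to hmaps Δ fun g hg => ?_).trans
      (by rw [pow_succ, mul_comm]; exact Nat.mul_le_mul ih le_rfl)
    rw [← hΔ (g (Fin.last n)), ← G.card_neighborFinset_eq_degree]
    refine Finset.card_le_card_of_injOn (fun f => f (Fin.last (n + 1))) ?_ ?_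
    · intro f hf
      simp only [coe_filter, chainSeqs, mem_filter, mem_univ, true_and, Set.mem_ofPred_eq] at hf
      rw [mem_coe, mem_neighborFinset, ← hf.2]
      exact hf.1.2 (Fin.last n)
    · intro f hf f' hf' h
      simp only [coe_filter, Set.mem_ofPred_eq] at hf hf'
      rw [← Fin.snoc_init_self (α := fun _ => V) f, ← Fin.snoc_init_self (α := fun _ => V) f',
        hf.2, hf'.2]
      exact congrArg _ h

variable (G) in
/-- Cyclic sequences of `n + 1` distinct successively adjacent vertices. -/
def cycleSeqs (n : ℕ) : Finset (Fin (n + 1) → V) :=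
  univ.filter fun f => f.Injective ∧ ∀ i, G.Adj (f i) (f (i + 1))

theorem mem_cycleSeqs {n : ℕ} {f : Fin (n + 1) → V} :
    f ∈ cycleSeqs G n ↔ f.Injective ∧ ∀ i, G.Adj (f i) (f (i + 1)) := by
  simp [cycleSeqs]

theorem card_cycleSeqs_zero_le {Δ : ℕ} (hΔ : G.IsRegularOfDegree Δ) (x : V) {n m : ℕ}
    (hm : 2 * m < G.girth) (hm1 : 1 ≤ m) (hmn : m ≤ n) :
    ((cycleSeqs G n).filter fun f => f 0 = x).card ≤ Δ ^ (n + 1 - m) := by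
  set j := n + 1 - m with hj
  have hjn : j + 1 ≤ n + 1 := by omega
  refine le_trans (Finset.card_le_card_of_injOn (fun f i => f (Fin.castLE hjn i)) ?_ ?_)
    (card_chainSeqs_le hΔ x j)
  · intro f hf
    simp only [coe_filter, Set.mem_ofPred_eq, mem_cycleSeqs] at hf
    simp only [chainSeqs, coe_filter, mem_univ, true_and, Set.mem_ofPred_eq]
    refine ⟨hf.2, fun i => ?_⟩
    have := hf.1.2 (Fin.castLE hjn i.castSucc)
    convert this using 2
    ext
    simp only [Fin.val_castLE, Fin.val_succ, Fin.val_add, Fin.val_castSucc, Fin.val_one']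
    have := i.2
    rw [Nat.mod_eq_of_lt (show 1 < n + 1 by omega), Nat.mod_eq_of_lt (by omega)]
  · have key : ∀ f ∈ cycleSeqs G n,
        (∀ i < m, G.Adj (f (Fin.ofNat (n + 1) (j + i))) (f (Fin.ofNat (n + 1) (j + (i + 1))))) ∧
          Set.InjOn (fun i => f (Fin.ofNat (n + 1) (j + i))) {i | i ≤ m} := by
      intro f hf
      rw [mem_cycleSeqs] at hf
      refine ⟨fun i hi => ?_, fun a ha b hb hab => ?_⟩
      · convert hf.2 (Fin.ofNat (n + 1) (j + i)) using 2
        ext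
        simp [Fin.val_add, Nat.add_assoc]
      · rw [Set.mem_ofPred_eq] at ha hb
        have h1 := congrArg Fin.val (hf.1 hab)
        simp only [Fin.val_ofNat] at h1
        rcases Nat.lt_or_ge (j + a) (n + 1) with ha' | ha' <;>
          rcases Nat.lt_or_ge (j + b) (n + 1) with hb' | hb'
        · rw [Nat.mod_eq_of_lt ha', Nat.mod_eq_of_lt hb'] at h1
          omega
        · rw [Nat.mod_eq_of_lt ha', show j + b = n + 1 by omega, Nat.mod_self] at h1
          omega
        · rw [Nat.mod_eq_of_lt hb', show j + a = n + 1 by omega, Nat.mod_self] at h1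
          omega
        · omega
    intro f hf f' hf' h
    simp only [coe_filter, Set.mem_ofPred_eq] at hf hf'
    have hlow : ∀ i (hi : i < j + 1), f ⟨i, by omega⟩ = f' ⟨i, by omega⟩ := fun i hi =>
      congrFun h ⟨i, hi⟩
    have hhigh := eq_of_short_paths (key f hf.1).1 (key f' hf'.1).1 (key f hf.1).2 (key f' hf'.1).2
      (by
        convert hlow j (by omega) using 2 <;>
        · ext; simp only [Fin.val_ofNat]; exact Nat.mod_eq_of_lt (by omega))
      (by
        convert hf.2.trans hf'.2.symm using 2 <;>
        · ext; simp only [Fin.val_ofNat]; rw [show j + m = n + 1 by omega]; simp)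
      hm
    ext i
    rcases Nat.lt_or_ge i.1 (j + 1) with hi | hi
    · exact hlow i.1 hi
    · convert hhigh (i.1 - j) (by omega) using 2 <;>
      · ext; simp only [Fin.val_ofNat]; rw [Nat.mod_eq_of_lt (by omega)]; omega

theorem card_cycleSeqs_mem_le {Δ : ℕ} (hΔ : G.IsRegularOfDegree Δ) (x : V) {n m : ℕ}
    (hm : 2 * m < G.girth) (hm1 : 1 ≤ m) (hmn : m ≤ n) :
    ((cycleSeqs G n).filter fun f => ∃ i, f i = x).card ≤ (n + 1) * Δ ^ (n + 1 - m) := by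
  have hsub : ((cycleSeqs G n).filter fun f => ∃ i, f i = x) ⊆
      (univ : Finset (Fin (n + 1))).biUnion fun i => (cycleSeqs G n).filter fun f => f i = x := by
    intro f hf
    simp only [mem_filter, mem_biUnion, mem_univ, true_and] at hf ⊢
    exact ⟨hf.2.choose, hf.1, hf.2.choose_spec⟩
  refine (Finset.card_le_card hsub).trans (Finset.card_biUnion_le.trans ?_)
  calc _ ≤ ∑ _i : Fin (n + 1), Δ ^ (n + 1 - m) := by
        refine Finset.sum_le_sum fun i _ => ?_
        refine le_trans (Finset.card_le_card_of_injOn (fun f k => f (k + i)) ?_ ?_)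
          (card_cycleSeqs_zero_le hΔ x hm hm1 hmn)
        · intro f hf
          simp only [coe_filter, Set.mem_ofPred_eq, mem_cycleSeqs] at hf ⊢
          refine ⟨⟨fun a b hab => add_right_cancel (hf.1.1 hab), fun k => ?_⟩, by simpa using hf.2⟩
          rw [add_right_comm]
          exact hf.1.2 _
        · intro f _ f' _ h
          ext k
          have := congrFun h (k - i)
          simpa using this
    _ = _ := by simp

end Cycles

theorem bernoulliProb_coord {ι : Type} [Fintype ι] [DecidableEq ι] {p : ι → ℝ} (i : ι) :
    bernoulliProb p (fun ω => ω i = true) = p i := by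
  have := bernoulliProb_cylinder (p := p) {i} ∅ (Finset.disjoint_empty_right _)
  simpa using this

section CycleEvents

variable {V : Type} [Fintype V] [DecidableEq V] {G : SimpleGraph V} [DecidableRel G.Adj]
  {Col : Type} [Fintype Col] [DecidableEq Col] {Δ T : ℕ}

/-- Up to two exceptional edges, the edges of a cyclic sequence are activated alternately with two
colours. -/
def CycleHit (n : ℕ) (f : Fin (n + 1) → V) (ω : Fin T × NibbleCoord V Col Δ → Bool) : Prop :=
  ∃ c d : Col, ∃ a b : Fin (n + 1), ∀ i, i ≠ a → i ≠ b →
    ∃ t : Fin T, ω (t, (if Even i.val then c else d, Sum.inl s(f i, f (i + 1)))) = true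

theorem cycleHit_dependsOnlyOn (n : ℕ) (f : Fin (n + 1) → V) :
    DependsOnlyOn (CycleHit (T := T) (Col := Col) (Δ := Δ) n f)
      {i | coordLoc i.2 ⊆ ((univ.image f : Finset V) : Set V)} := by
  intro ω ω' h
  have key : ∀ t c (i : Fin (n + 1)), ω (t, (c, Sum.inl s(f i, f (i + 1)))) =
      ω' (t, (c, Sum.inl s(f i, f (i + 1)))) := by
    intro t c i
    refine h _ fun x hx => ?_
    have hx' : x ∈ s(f i, f (i + 1)) := hx
    rw [Sym2.mem_iff] at hx'
    rcases hx' with rfl | rfl <;> simp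
  simp only [CycleHit, key]

theorem cycleSeqs_edge_injective {n : ℕ} (hn : 2 ≤ n) {f : Fin (n + 1) → V}
    (hf : f ∈ cycleSeqs G n) : Function.Injective fun i => s(f i, f (i + 1)) := by
  rw [mem_cycleSeqs] at hf
  intro i j hij
  simp only [Sym2.eq_iff] at hij
  rcases hij with h | h
  · exact hf.1 h.1
  · have h1 : i = j + 1 := hf.1 h.1
    have h2 : i + 1 = j := hf.1 h.2
    rw [h1, add_assoc] at h2
    have h3 : (1 + 1 : Fin (n + 1)) = 0 := by simpa using h2
    have h4 := congrArg Fin.val h3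
    rw [Fin.val_add, Fin.val_one', Fin.val_zero, Nat.mod_eq_of_lt (show 1 < n + 1 by omega),
      Nat.mod_eq_of_lt (by omega)] at h4
    omega

theorem prob_cycleHit_le {q : ℕ → ℝ} (hq : ∀ t, 0 ≤ q t ∧ q t ≤ 1) {n : ℕ} (hn : 2 ≤ n)
    {f : Fin (n + 1) → V} (hf : f ∈ cycleSeqs G n) {K : ℝ} (hK : ∑ t : Fin T, q t ≤ K)
    (hK1 : K ≤ 1) :
    bernoulliProb (fun i : Fin T × NibbleCoord V Col Δ => q i.1) (CycleHit n f) ≤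
      (Fintype.card Col) ^ 2 * (n + 1) ^ 2 * K ^ (n - 1) := by
  have hp : ∀ i : Fin T × NibbleCoord V Col Δ, 0 ≤ q i.1 ∧ q i.1 ≤ 1 := fun i => hq i.1
  have hK0 : 0 ≤ K := (Finset.sum_nonneg fun (t : Fin T) _ => (hq t).1).trans hK
  let B : Col × Col × Fin (n + 1) × Fin (n + 1) → (Fin T × NibbleCoord V Col Δ → Bool) → Prop :=
    fun z ω => ∀ i, i ≠ z.2.2.1 → i ≠ z.2.2.2 → ∃ t : Fin T,
      ω (t, (if Even i.val then z.1 else z.2.1, Sum.inl s(f i, f (i + 1)))) = true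
  have hB : ∀ z, bernoulliProb (fun i : Fin T × NibbleCoord V Col Δ => q i.1) (B z) ≤
      K ^ (n - 1) := by
    rintro ⟨c, d, a, b⟩
    let φ : Fin (n + 1) → NibbleCoord V Col Δ := fun i =>
      (if Even i.val then c else d, Sum.inl s(f i, f (i + 1)))
    have hφ : Function.Injective φ := by
      intro i j hij
      have h2 := congrArg Prod.snd hij
      exact cycleSeqs_edge_injective hn hf (Sum.inl_injective h2)
    let I : Finset (Fin (n + 1)) := univ \ {a, b}
    have hI : n - 1 ≤ I.card := by
      have h1 := Finset.le_card_sdiff ({a, b} : Finset (Fin (n + 1))) univ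
      have h2 : ({a, b} : Finset (Fin (n + 1))).card ≤ 2 := Finset.card_le_two
      rw [Finset.card_univ, Fintype.card_fin] at h1
      change n - 1 ≤ (univ \ {a, b}).card
      omega
    have hmono : bernoulliProb (fun i : Fin T × NibbleCoord V Col Δ => q i.1) (B (c, d, a, b)) ≤
        bernoulliProb (fun i : Fin T × NibbleCoord V Col Δ => q i.1)
          (fun ω => ∀ x ∈ I.image φ, ∃ t ∈ (univ : Finset (Fin T)), ω (t, x) = true) := by
      refine bernoulliProb_mono hp fun ω h x hx => ?_
      obtain ⟨i, hi, rfl⟩ := Finset.mem_image.mp hx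
      have hi' : i ≠ a ∧ i ≠ b := by simpa [I] using hi
      obtain ⟨t, ht⟩ := h i hi'.1 hi'.2
      exact ⟨t, mem_univ _, ht⟩
    refine hmono.trans ?_
    rw [bernoulliProb_forall_of_label (fun i : Fin T × NibbleCoord V Col Δ => i.2) (I.image φ)
      (fun x ω => ∃ t ∈ (univ : Finset (Fin T)), ω (t, x) = true)
      (by
        intro x _ ω ω' h
        have : ∀ t, ω (t, x) = ω' (t, x) := fun t => h _ rfl
        simp only [this])]
    calc _ ≤ ∏ x ∈ I.image φ, K := by
          refine Finset.prod_le_prod (fun x _ => bernoulliProb_nonneg hp _) fun x _ => ?_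
          refine (bernoulliProb_exists_le hp _ _).trans (le_trans (le_of_eq ?_) hK)
          exact Finset.sum_congr rfl fun t _ => bernoulliProb_coord _
      _ = K ^ I.card := by rw [Finset.prod_const, Finset.card_image_of_injective _ hφ]
      _ ≤ K ^ (n - 1) := pow_le_pow_of_le_one hK0 hK1 hI
  calc _ ≤ bernoulliProb (fun i : Fin T × NibbleCoord V Col Δ => q i.1)
        (fun ω => ∃ z ∈ (univ : Finset (Col × Col × Fin (n + 1) × Fin (n + 1))), B z ω) := by
        refine bernoulliProb_mono hp fun ω h => ?_
        obtain ⟨c, d, a, b, h⟩ := h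
        exact ⟨(c, d, a, b), mem_univ _, h⟩
    _ ≤ ∑ _z : Col × Col × Fin (n + 1) × Fin (n + 1), K ^ (n - 1) :=
        (bernoulliProb_exists_le hp _ _).trans (Finset.sum_le_sum fun z _ => hB z)
    _ = _ := by
        simp only [sum_const, card_univ, Fintype.card_prod, Fintype.card_fin, nsmul_eq_mul]
        push_cast
        ring

end CycleEvents

section Deletion

variable {V : Type} [Fintype V] [DecidableEq V] {G : SimpleGraph V} [DecidableRel G.Adj]
  {Col : Type} [Fintype Col] [DecidableEq Col]

/-- The edges of the sequence `f` are coloured alternately with `c` and `d`. -/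
def AlternatesOn (col : Sym2 V → Option Col) {L : ℕ} (f : Fin (L + 1) → V) (c d : Col) : Prop :=
  ∀ i : Fin L, col s(f i.castSucc, f i.succ) = some (if Even i.val then c else d)

theorem AlternatesOn.eq_of_eq {col : Sym2 V → Option Col}
    (hcol : ∀ e e' c x, col e = some c → col e' = some c → x ∈ e → x ∈ e' → e = e') {L : ℕ}
    {f f' : Fin (L + 1) → V} {c d : Col} (hf : AlternatesOn col f c d)
    (hf' : AlternatesOn col f' c d) {j : Fin (L + 1)} (hj : f j = f' j) : f = f' := by
  have hstep : ∀ i : Fin L, f i.castSucc = f' i.castSucc ↔ f i.succ = f' i.succ := by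
    intro i
    constructor
    · intro h
      have := hcol _ _ _ (f i.castSucc) (hf i) (hf' i) (Sym2.mem_mk_left _ _)
        (h ▸ Sym2.mem_mk_left _ _)
      rwa [h, Sym2.congr_right] at this
    · intro h
      have := hcol _ _ _ (f i.succ) (hf i) (hf' i) (Sym2.mem_mk_right _ _)
        (h ▸ Sym2.mem_mk_right _ _)
      rwa [h, Sym2.congr_left] at this
  have hall : ∀ i, f 0 = f' 0 ↔ f i = f' i := by
    intro i
    induction i using Fin.induction with
    | zero => rfl
    | succ i ih => rw [ih, hstep]
  ext i
  exact (hall i).mp ((hall j).mpr hj)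

open Classical in
/-- Injective sequences of `L + 1` vertices along alternately coloured edges. -/
noncomputable def alternatingSeqs (col : Sym2 V → Option Col) (L : ℕ) : Finset (Fin (L + 1) → V) :=
  univ.filter fun f => f.Injective ∧ ∃ c d, AlternatesOn col f c d

theorem card_alternatingSeqs_le {col : Sym2 V → Option Col}
    (hcol : ∀ e e' c x, col e = some c → col e' = some c → x ∈ e → x ∈ e' → e = e') (L : ℕ) (x : V) :
    ((alternatingSeqs col L).filter fun f => ∃ i, f i = x).card ≤
      (L + 1) * Fintype.card Col ^ 2 := by
  classical
  have hsub : ((alternatingSeqs col L).filter fun f => ∃ i, f i = x) ⊆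
      (univ : Finset (Fin (L + 1) × Col × Col)).biUnion fun z =>
        univ.filter fun f => f z.1 = x ∧ AlternatesOn col f z.2.1 z.2.2 := by
    intro f hf
    simp only [mem_filter, mem_biUnion, mem_univ, true_and, alternatingSeqs] at hf ⊢
    obtain ⟨⟨_, c, d, h⟩, i, hi⟩ := hf
    exact ⟨(i, c, d), hi, h⟩
  refine (Finset.card_le_card hsub).trans (Finset.card_biUnion_le.trans ?_)
  calc _ ≤ ∑ _z : Fin (L + 1) × Col × Col, 1 := by
        refine Finset.sum_le_sum fun z _ => Finset.card_le_one.mpr fun f hf f' hf' => ?_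
        simp only [mem_filter, mem_univ, true_and] at hf hf'
        exact hf.2.eq_of_eq hcol hf'.2 (hf.1.trans hf'.1.symm)
    _ = _ := by simp [sq]

theorem exists_deletion {Δ : ℕ} (hΔ : G.IsRegularOfDegree Δ) (hΔ0 : 0 < Δ)
    {col : Sym2 V → Option Col}
    (hcol : ∀ e e' c x, col e = some c → col e' = some c → x ∈ e → x ∈ e' → e = e') {L : ℕ}
    (hL : L ≤ Δ) {p : ℝ} (hp0 : 0 ≤ p) (hp1 : p ≤ 1)
    (hsum : ((Δ : ℝ) + 1) * ((Δ + 1) * Real.exp (-((p * Δ) ^ 2 / (2 * Δ))) +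
      (L + 1) * Fintype.card Col ^ 2 * (1 - p) ^ L) ≤ 1 / 4) :
    ∃ X : Sym2 V → Bool,
      (∀ v, (((G.neighborFinset v).filter fun u => X s(v, u) = true).card : ℝ) ≤ 2 * p * Δ) ∧
      ∀ f : Fin (L + 1) → V, f.Injective → ∀ c d, AlternatesOn col f c d →
        ∃ i : Fin L, X s(f i.castSucc, f i.succ) = true := by
  classical
  have hp : ∀ _ : Sym2 V, 0 ≤ p ∧ p ≤ 1 := fun _ => ⟨hp0, hp1⟩
  let A : V ⊕ (Fin (L + 1) → V) → (Sym2 V → Bool) → Prop := Sum.elim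
    (fun v X => 2 * p * Δ < (((G.neighborFinset v).filter fun u => X s(v, u) = true).card : ℝ))
    (fun f X => ∀ i : Fin L, X s(f i.castSucc, f i.succ) = false)
  let Y : V ⊕ (Fin (L + 1) → V) → Finset V :=
    Sum.elim (fun v => graphBall G 1 v) fun f => univ.image f
  have hstar : ∀ v, bernoulliProb (fun _ => p) (A (Sum.inl v)) ≤
      Real.exp (-((p * Δ) ^ 2 / (2 * Δ))) := by
    intro v
    refine bernoulliProb_ge_le_of_lipschitz (J := Sym2 V) hp id
      ((G.neighborFinset v).image fun u => s(v, u))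
      (fun X => (((G.neighborFinset v).filter fun u => X s(v, u) = true).card : ℝ)) ?_ ?_
      (a := p * Δ) (by exact_mod_cast hΔ0) ?_ (by positivity) ?_ (by linarith)
    · intro X X' h
      have : (G.neighborFinset v).filter (fun u => X s(v, u) = true) =
          (G.neighborFinset v).filter fun u => X' s(v, u) = true := by
        refine Finset.filter_congr fun u hu => ?_
        rw [h s(v, u) (Finset.mem_image_of_mem _ hu)]
      simp only [this]
    · intro j hj X X' h
      obtain ⟨u, hu, rfl⟩ := Finset.mem_image.mp hj
      have key : ∀ x, x ≠ u → X s(v, x) = X' s(v, x) := fun x hx =>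
        h s(v, x) fun h' => hx (Sym2.congr_right.mp h')
      have hmem : ∀ Z Z' : Sym2 V → Bool, (∀ x, x ≠ u → Z s(v, x) = Z' s(v, x)) →
          ∀ x ∈ (G.neighborFinset v).filter (fun x => Z s(v, x) = true),
            x ∉ (G.neighborFinset v).filter (fun x => Z' s(v, x) = true) → x = u := by
        intro Z Z' hZ x hx hx'
        by_contra hne
        rw [mem_filter, hZ x hne] at hx
        exact hx' (mem_filter.mpr hx)
      refine abs_card_sub_card_le_one _ _ (fun x hx hx' y hy hy' => ?_) fun x hx hx' y hy hy' => ?_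
      · rw [hmem X X' key x hx hx', hmem X X' key y hy hy']
      · rw [hmem X' X (fun x hx => (key x hx).symm) x hx hx',
          hmem X' X (fun x hx => (key x hx).symm) y hy hy']
    · refine (Nat.cast_le.mpr Finset.card_image_le).trans ?_
      rw [card_neighborFinset_eq_degree, hΔ v]
    · rw [bernoulliExp_card_filter]
      simp only [bernoulliProb_coord, sum_const, card_neighborFinset_eq_degree, hΔ v, nsmul_eq_mul]
      rw [mul_comm]
  have hpath : ∀ f ∈ alternatingSeqs col L, bernoulliProb (fun _ => p) (A (Sum.inr f)) ≤
      (1 - p) ^ L := by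
    intro f hf
    simp only [alternatingSeqs, mem_filter, mem_univ, true_and] at hf
    have hinj : Function.Injective fun i : Fin L => s(f i.castSucc, f i.succ) := by
      intro i j hij
      simp only [Sym2.eq_iff] at hij
      rcases hij with h | h
      · exact Fin.castSucc_injective _ (hf.1 h.1)
      · have h1 := congrArg Fin.val (hf.1 h.1)
        have h2 := congrArg Fin.val (hf.1 h.2)
        simp only [Fin.val_castSucc, Fin.val_succ] at h1 h2
        omega
    have := bernoulliProb_forall_false p (univ.image fun i : Fin L => s(f i.castSucc, f i.succ))
    rw [Finset.card_image_of_injective _ hinj, card_univ, Fintype.card_fin] at this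
    rw [← this]
    refine bernoulliProb_mono hp fun X h e he => ?_
    obtain ⟨i, _, rfl⟩ := Finset.mem_image.mp he
    exact h i
  obtain ⟨X, hX⟩ := bernoulliProb_local_lemma_of_touch hp
    ((univ : Finset V).disjSum (alternatingSeqs col L)) A (fun e => {x | x ∈ e})
    (fun e => by
      induction e with
      | _ a b => exact ⟨a, Sym2.mem_mk_left a b⟩) Y
    (by
      rintro (v | f) _
      · exact ⟨v, self_mem_graphBall 1 v⟩
      · exact ⟨f 0, Finset.mem_image_of_mem _ (mem_univ _)⟩)
    (M := Δ + 1)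
    (by
      rintro (v | f) _
      · have := card_graphBall_le hΔ 1 v
        rw [pow_one] at this
        exact_mod_cast this
      · have : (univ.image f).card ≤ L + 1 := Finset.card_image_le.trans (by simp)
        exact_mod_cast this.trans (by omega))
    (by
      rintro (v | f) _
      · intro X X' h
        have : (G.neighborFinset v).filter (fun u => X s(v, u) = true) =
            (G.neighborFinset v).filter fun u => X' s(v, u) = true := by
          refine Finset.filter_congr fun u hu => ?_
          rw [h s(v, u) ?_]
          intro x hx
          have hx' : x ∈ s(v, u) := hx
          rw [Sym2.mem_iff] at hx'
          rcases hx' with rfl | rfl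
          · exact self_mem_graphBall 1 _
          · exact adj_mem_graphBall le_rfl (by simpa using hu)
        simp only [A, Sum.elim_inl, this]
      · intro X X' h
        have : ∀ i : Fin L, X s(f i.castSucc, f i.succ) = X' s(f i.castSucc, f i.succ) := by
          intro i
          refine h _ fun x hx => ?_
          have hx' : x ∈ s(f i.castSucc, f i.succ) := hx
          rw [Sym2.mem_iff] at hx'
          rcases hx' with rfl | rfl <;> simp [Y]
        simp only [A, Sum.elim_inr, this])
    (by
      intro x
      rw [Finset.sum_filter, Finset.sum_disjSum, ← Finset.sum_filter, ← Finset.sum_filter]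
      refine le_trans (mul_le_mul_of_nonneg_left (add_le_add ?_ ?_) (by positivity)) hsum
      · calc _ ≤ ∑ v : V with x ∈ Y (Sum.inl v), Real.exp (-((p * Δ) ^ 2 / (2 * Δ))) :=
              Finset.sum_le_sum fun v _ => hstar v
          _ ≤ _ := by
              rw [Finset.sum_const, nsmul_eq_mul]
              refine mul_le_mul_of_nonneg_right ?_ (Real.exp_nonneg _)
              have h1 : (univ.filter fun v => x ∈ Y (Sum.inl v)) = graphBall G 1 x := by
                ext v
                rw [mem_filter_univ]
                exact mem_graphBall_comm
              have := card_graphBall_le hΔ 1 x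
              rw [pow_one] at this
              rw [h1]
              exact_mod_cast this
      · calc _ ≤ ∑ f ∈ alternatingSeqs col L with x ∈ Y (Sum.inr f), (1 - p) ^ L :=
              Finset.sum_le_sum fun f hf => hpath f (Finset.mem_filter.mp hf).1
          _ ≤ _ := by
              rw [Finset.sum_const, nsmul_eq_mul]
              refine mul_le_mul_of_nonneg_right ?_ (pow_nonneg (by linarith) _)
              have := card_alternatingSeqs_le hcol L x
              have h1 : ((alternatingSeqs col L).filter fun f => x ∈ Y (Sum.inr f)) =
                  (alternatingSeqs col L).filter fun f => ∃ i, f i = x := by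
                ext f
                simp [Y]
              rw [h1]
              exact_mod_cast this)
  refine ⟨X, fun v => ?_, fun f hf c d h => ?_⟩
  · have := hX (Sum.inl v) (Finset.inl_mem_disjSum.mpr (mem_univ _))
    simpa [A] using this
  · have hmem : f ∈ alternatingSeqs col L := by
      simp only [alternatingSeqs, mem_filter, mem_univ, true_and]
      exact ⟨hf, c, d, h⟩
    have := hX (Sum.inr f) (Finset.inr_mem_disjSum.mpr hmem)
    simpa [A] using this

end Deletion

section Nibble

variable {V : Type} [Fintype V] [DecidableEq V] {G : SimpleGraph V} [DecidableRel G.Adj]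
  {Col : Type} [Fintype Col] [DecidableEq Col]

theorem exists_nibble_colouring {Δ : ℕ} (hΔ : G.IsRegularOfDegree Δ) {T : ℕ} {R : V → Col → Prop}
    {N : ℕ → ℕ} {Λ D F q : ℕ → ℝ} (hq : ∀ t, 0 ≤ q t ∧ q t ≤ 1) {s₀ : NibbleState V Col}
    (hcol₀ : ∀ e, s₀.col e = none) (hs₀ : NibbleInv G R s₀)
    (hOK : ∀ v, StateOK G R (Λ 0) (D 0) (F 0) s₀ v) {P : ℝ}
    (hP : ∀ t < T, ∀ v, bernoulliProb (fun i : Fin T × NibbleCoord V Col Δ => q i.1)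
      (BadRound G R N Λ D F s₀ t v) ≤ P)
    {m B : ℕ} (hm : 2 * m < G.girth) (hm2 : 2 ≤ m) {K : ℝ} (hK : ∑ t : Fin T, q t ≤ K)
    (hK1 : K ≤ 1) (hB : B ≤ (Δ + 1) ^ (2 * T + 4))
    (hsum : ((Δ : ℝ) + 1) ^ (2 * T + 4) * (T * ((Δ : ℝ) + 1) ^ (2 * T + 4) * P +
      ∑ n ∈ range B with m ≤ n, ((n : ℝ) + 1) * (Δ : ℝ) ^ (n + 1 - m) *
        ((Fintype.card Col : ℝ) ^ 2 * (n + 1) ^ 2 * K ^ (n - 1))) ≤ 1 / 4) :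
    ∃ s : NibbleState V Col, NibbleInv G R s ∧ (∀ v, StateOK G R (Λ T) (D T) (F T) s v) ∧
      ∀ n < B, m ≤ n → ∀ f ∈ cycleSeqs G n, ¬ ∃ c d : Col, ∃ a b : Fin (n + 1),
        ∀ i, i ≠ a → i ≠ b → s.col s(f i, f (i + 1)) = some (if Even i.val then c else d) := by
  classical
  have hp : ∀ i : Fin T × NibbleCoord V Col Δ, 0 ≤ q i.1 ∧ q i.1 ≤ 1 := fun i => hq i.1
  let I := (Fin T × V) ⊕ (Σ n : Fin B, Fin (n + 1) → V)
  let A : I → (Fin T × NibbleCoord V Col Δ → Bool) → Prop :=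
    Sum.elim (fun k => BadRound G R N Λ D F s₀ k.1 k.2) fun k => CycleHit k.1 k.2
  let Y : I → Finset V := Sum.elim (fun k => graphBall G (2 * T + 4) k.2) fun k => univ.image k.2
  let Cyc : Finset (Σ n : Fin B, Fin (n + 1) → V) :=
    (univ.filter fun n : Fin B => m ≤ n).sigma fun n => cycleSeqs G n
  obtain ⟨ω, hω⟩ := bernoulliProb_local_lemma_of_touch hp
    ((univ : Finset (Fin T × V)).disjSum Cyc) A (fun i => coordLoc i.2)
    (by
      rintro ⟨t, c, e | ⟨v, j⟩⟩
      · induction e with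
        | _ a b => exact ⟨a, Sym2.mem_mk_left a b⟩
      · exact ⟨v, rfl⟩) Y
    (by
      rintro (k | k) _
      · exact ⟨k.2, self_mem_graphBall _ _⟩
      · exact ⟨k.2 0, Finset.mem_image_of_mem _ (mem_univ _)⟩)
    (M := ((Δ : ℝ) + 1) ^ (2 * T + 4))
    (by
      rintro (k | k) _
      · exact_mod_cast card_graphBall_le hΔ _ _
      · have : (univ.image k.2).card ≤ B := Finset.card_image_le.trans (by
          rw [card_univ, Fintype.card_fin]; exact k.1.2)
        exact_mod_cast this.trans hB)
    (by
      rintro (k | k) _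
      · exact badRound_dependsOnlyOn R N Λ D F s₀ k.1 k.1.2 k.2
      · exact cycleHit_dependsOnlyOn k.1 k.2)
    (by
      intro x
      rw [Finset.sum_filter, Finset.sum_disjSum, ← Finset.sum_filter, ← Finset.sum_filter]
      refine le_trans (mul_le_mul_of_nonneg_left (add_le_add ?_ ?_) (by positivity)) hsum
      · have hP0 : ∀ k : Fin T × V, 0 ≤ P := fun k =>
          (bernoulliProb_nonneg hp _).trans (hP k.1 k.1.2 k.2)
        calc _ ≤ ∑ k ∈ (univ : Finset (Fin T × V)) with x ∈ Y (Sum.inl k), P :=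
              Finset.sum_le_sum fun k _ => hP k.1 k.1.2 k.2
          _ ≤ _ := by
              rw [Finset.sum_const, nsmul_eq_mul]
              have h1 : ((univ : Finset (Fin T × V)).filter fun k => x ∈ Y (Sum.inl k)) =
                  univ ×ˢ graphBall G (2 * T + 4) x := by
                ext k
                rw [mem_filter_univ, mem_product]
                simp only [mem_univ, true_and]
                exact mem_graphBall_comm
              rw [h1, card_product, card_univ, Fintype.card_fin]
              rcases isEmpty_or_nonempty (Fin T × V) with hE | ⟨⟨k⟩⟩
              · have hT : T = 0 := by
                  by_contra hT
                  exact hE.elim (⟨0, Nat.pos_of_ne_zero hT⟩, x)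
                simp [hT]
              · refine mul_le_mul_of_nonneg_right ?_ (hP0 k)
                exact_mod_cast Nat.mul_le_mul le_rfl (card_graphBall_le hΔ (2 * T + 4) x)
      · have h1 : (Cyc.filter fun k => x ∈ Y (Sum.inr k)) =
            (univ.filter fun n : Fin B => m ≤ n).sigma fun n =>
              (cycleSeqs G n).filter fun f => ∃ i, f i = x := by
          ext k
          simp [Cyc, Y, and_assoc]
        rw [h1, Finset.sum_sigma]
        calc _ ≤ ∑ n : Fin B with m ≤ n.1, ((n : ℝ) + 1) * (Δ : ℝ) ^ (n.1 + 1 - m) *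
              ((Fintype.card Col : ℝ) ^ 2 * (n + 1) ^ 2 * K ^ (n.1 - 1)) := by
              refine Finset.sum_le_sum fun n hn => ?_
              rw [mem_filter_univ] at hn
              have hK0 : 0 ≤ K := (Finset.sum_nonneg fun (t : Fin T) _ => (hq t).1).trans hK
              calc _ ≤ ∑ f ∈ cycleSeqs G n.1 with ∃ i, f i = x,
                    ((Fintype.card Col : ℝ) ^ 2 * (n + 1) ^ 2 * K ^ (n.1 - 1)) :=
                    Finset.sum_le_sum fun f hf =>
                      prob_cycleHit_le hq (by omega) (Finset.mem_filter.mp hf).1 hK hK1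
                _ ≤ _ := by
                    rw [Finset.sum_const, nsmul_eq_mul]
                    refine mul_le_mul_of_nonneg_right ?_ (by positivity)
                    exact_mod_cast card_cycleSeqs_mem_le hΔ x hm (by omega) hn
          _ = _ := by
              rw [Finset.sum_filter, Finset.sum_filter, Finset.sum_range])
  refine ⟨nibbleState G N s₀ (roundOf ω) T, nibbleState_inv hs₀ _ _, fun v => ?_,
    fun n hn hmn f hf => ?_⟩
  · exact stateOK_of_not_badRound hOK (fun t ht v =>
      hω (Sum.inl (⟨t, ht⟩, v)) (Finset.inl_mem_disjSum.mpr (mem_univ _))) T le_rfl v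
  · rintro ⟨c, d, a, b, h⟩
    refine hω (Sum.inr ⟨⟨n, hn⟩, f⟩) (Finset.inr_mem_disjSum.mpr ?_) ?_
    · exact Finset.mem_sigma.mpr ⟨(mem_filter_univ _).mpr hmn, hf⟩
    · refine ⟨c, d, a, b, fun i hia hib => ?_⟩
      obtain ⟨t, ht, h'⟩ := nibbleState_col_eq_some hcol₀ (h i hia hib)
      rw [roundOf, dif_pos ht] at h'
      exact ⟨⟨t, ht⟩, h'⟩

end Nibble

theorem exists_subset_pair_of_card_le_two {k : ℕ} (hk : 0 < k) {U : Finset ℕ} (hU : U ⊆ range k)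
    (h : U.card ≤ 2) : ∃ a < k, ∃ b < k, U ⊆ {a, b} := by
  rcases U.eq_empty_or_nonempty with rfl | ⟨a, ha⟩
  · exact ⟨0, hk, 0, hk, by simp⟩
  · have hak := mem_range.mp (hU ha)
    rcases (U.erase a).eq_empty_or_nonempty with h0 | ⟨b, hb⟩
    · refine ⟨a, hak, a, hak, fun x hx => ?_⟩
      by_contra hne
      have : x ∈ U.erase a := mem_erase.mpr ⟨by simpa using hne, hx⟩
      simp [h0] at this
    · have hbU := (mem_erase.mp hb).2
      have hba := (mem_erase.mp hb).1
      refine ⟨a, hak, b, mem_range.mp (hU hbU), ?_⟩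
      refine (Finset.eq_of_subset_of_card_le (by simp [insert_subset_iff, ha, hbU]) ?_).ge
      rw [Finset.card_pair hba.symm]
      exact h

theorem exists_window_disjoint {U : Finset ℕ} (h : U.card ≤ 2) (L : ℕ) :
    ∃ j < 3, ∀ i, j * L ≤ i → i < (j + 1) * L → i + 1 ∉ U := by
  by_contra! hcon
  obtain ⟨a, ha1, ha2, ha⟩ := hcon 0 (by omega)
  obtain ⟨b, hb1, hb2, hb⟩ := hcon 1 (by omega)
  obtain ⟨c, hc1, hc2, hc⟩ := hcon 2 (by omega)
  have h3 : ({a + 1, b + 1, c + 1} : Finset ℕ).card = 3 := by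
    rw [Finset.card_eq_three]
    exact ⟨a + 1, b + 1, c + 1, by omega, by omega, by omega, rfl⟩
  have := Finset.card_le_card (show ({a + 1, b + 1, c + 1} : Finset ℕ) ⊆ U by
    simp [insert_subset_iff, ha, hb, hc])
  omega

section Cycle

variable {V : Type} [Fintype V] [DecidableEq V] {G : SimpleGraph V} [DecidableRel G.Adj]

theorem cycle_edge_inj {v : V} {w : G.Walk v v} (hw : w.IsCycle) {i j : ℕ} (hi : i < w.length)
    (hj : j < w.length)
    (h : s(w.getVert i, w.getVert (i + 1)) = s(w.getVert j, w.getVert (j + 1))) : i = j := by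
  have hi' : i < w.edges.length := by simpa using hi
  have hj' : j < w.edges.length := by simpa using hj
  rw [← Walk.getElem_edges hi', ← Walk.getElem_edges hj'] at h
  exact (List.Nodup.getElem_inj_iff hw.edges_nodup).mp h

theorem cycle_edge_mem {v : V} {w : G.Walk v v} {i : ℕ} (hi : i < w.length) :
    s(w.getVert i, w.getVert (i + 1)) ∈ w.edges := by
  have hi' : i < w.edges.length := by simpa using hi
  rw [← Walk.getElem_edges hi']
  exact List.getElem_mem hi'

theorem cycle_alternates {v : V} {w : G.Walk v v} (hw : w.IsCycle) {ψ : Sym2 V → ℕ}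
    (htwo : ∃ c d : ℕ, ∀ e ∈ w.edges, ψ e = c ∨ ψ e = d)
    (hproper : ∀ e₁ ∈ w.edges, ∀ e₂ ∈ w.edges, e₁ ≠ e₂ → (∃ x, x ∈ e₁ ∧ x ∈ e₂) → ψ e₁ ≠ ψ e₂) :
    ∃ c d : ℕ, ∀ i < w.length,
      ψ s(w.getVert i, w.getVert (i + 1)) = if Even i then c else d := by
  obtain ⟨x, y, hxy⟩ := htwo
  set e : ℕ → Sym2 V := fun i => s(w.getVert i, w.getVert (i + 1)) with he
  have hne : ∀ i, i + 1 < w.length → ψ (e i) ≠ ψ (e (i + 1)) := by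
    intro i hi
    refine hproper _ (cycle_edge_mem (by omega)) _ (cycle_edge_mem hi) (fun h => ?_)
      ⟨w.getVert (i + 1), Sym2.mem_mk_right _ _, Sym2.mem_mk_left _ _⟩
    have := cycle_edge_inj hw (by omega) hi h
    omega
  refine ⟨ψ (e 0), ψ (e 1), fun i hi => ?_⟩
  induction i using Nat.strong_induction_on with
  | _ i ih =>
    match i with
    | 0 => simp [e]
    | 1 => simp [e]
    | i + 2 =>
      have h1 := ih i (by omega) (by omega)
      have h2 := hne i (by omega)
      have h3 := hne (i + 1) hi
      have hev : Even (i + 2) ↔ Even i := by simp [Nat.even_add]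
      have m0 := hxy _ (cycle_edge_mem (w := w) (i := i) (by omega))
      have m1 := hxy _ (cycle_edge_mem (w := w) (i := i + 1) (by omega))
      have m2 := hxy _ (cycle_edge_mem (w := w) (i := i + 2) hi)
      simp only [hev]
      rw [← h1]
      change ψ (e i) = x ∨ ψ (e i) = y at m0
      change ψ (e (i + 1)) = x ∨ ψ (e (i + 1)) = y at m1
      change ψ (e (i + 2)) = x ∨ ψ (e (i + 2)) = y at m2
      change ψ (e (i + 2)) = ψ (e i)
      grind

theorem cycle_getVert_mem_cycleSeqs {v : V} {w : G.Walk v v} (hw : w.IsCycle) {n : ℕ}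
    (hn : w.length = n + 1) :
    (fun i : Fin (n + 1) => w.getVert i) ∈ cycleSeqs G n ∧
      ∀ i : Fin (n + 1), w.getVert (i + 1 : Fin (n + 1)).val = w.getVert (i.val + 1) := by
  have hsucc : ∀ i : Fin (n + 1), w.getVert (i + 1 : Fin (n + 1)).val = w.getVert (i.val + 1) := by
    intro i
    have h3 := hw.three_le_length
    rw [Fin.val_add, Fin.val_one', Nat.mod_eq_of_lt (show 1 < n + 1 by omega)]
    rcases Nat.lt_or_ge (i.val + 1) (n + 1) with h | h
    · rw [Nat.mod_eq_of_lt h]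
    · have : i.val + 1 = n + 1 := by omega
      rw [this, Nat.mod_self, Walk.getVert_zero, ← hn, Walk.getVert_length]
  refine ⟨mem_cycleSeqs.mpr ⟨fun a b hab => ?_, fun i => ?_⟩, hsucc⟩
  · refine Fin.ext (hw.getVert_injOn' ?_ ?_ hab) <;> rw [Set.mem_ofPred_eq] <;> omega
  · rw [hsucc]
    exact w.adj_getVert_succ (by omega)

theorem three_le_uncoloured {Col : Type} [Fintype Col] [DecidableEq Col] (ι : Col → ℕ)
    (hι : Function.Injective ι) (c₀ : Col) {col : Sym2 V → Option Col} {X : Sym2 V → Bool}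
    {χ : Sym2 V → Option ℕ}
    (hχ : ∀ e n, χ e = some n → ∃ c, col e = some c ∧ ι c = n ∧ X e = false) {m L : ℕ}
    (hm : m < G.girth)
    (hshort : ∀ n < 3 * L, m ≤ n → ∀ f ∈ cycleSeqs G n, ¬ ∃ c d : Col, ∃ a b : Fin (n + 1),
      ∀ i, i ≠ a → i ≠ b → col s(f i, f (i + 1)) = some (if Even i.val then c else d))
    (hlong : ∀ f : Fin (L + 1) → V, f.Injective → ∀ c d, AlternatesOn col f c d →
      ∃ i : Fin L, X s(f i.castSucc, f i.succ) = true)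
    {v : V} {w : G.Walk v v} (hw : w.IsCycle) {ψ : Sym2 V → ℕ}
    (hψ : ∀ e ∈ w.edges, ∀ n, χ e = some n → ψ e = n)
    (htwo : ∃ c d : ℕ, ∀ e ∈ w.edges, ψ e = c ∨ ψ e = d)
    (hproper : ∀ e₁ ∈ w.edges, ∀ e₂ ∈ w.edges, e₁ ≠ e₂ → (∃ x, x ∈ e₁ ∧ x ∈ e₂) → ψ e₁ ≠ ψ e₂) :
    3 ≤ (w.edges.filter fun e => χ e = none).length := by
  classical
  by_contra! hlt
  obtain ⟨c, d, halt⟩ := cycle_alternates hw htwo hproper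
  set e : ℕ → Sym2 V := fun i => s(w.getVert i, w.getVert (i + 1)) with he
  set U : Finset ℕ := (range w.length).filter fun i => χ (e i) = none with hU
  have hUcard : U.card ≤ 2 := by
    have h1 : U.card ≤ (w.edges.filter fun e => χ e = none).toFinset.card := by
      refine Finset.card_le_card_of_injOn e (fun i hi => ?_) fun i hi j hj hij => ?_
      · rw [mem_coe, hU, mem_filter, mem_range] at hi
        simpa using ⟨cycle_edge_mem hi.1, hi.2⟩
      · rw [mem_coe, hU, mem_filter, mem_range] at hi hj
        exact cycle_edge_inj hw hi.1 hj.1 hij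
    have := List.toFinset_card_le (w.edges.filter fun e => χ e = none)
    omega
  let lift : ℕ → Col := fun n => if h : ∃ c, ι c = n then h.choose else c₀
  have hlift : ∀ c, lift (ι c) = c := by
    intro c
    have h : ∃ c', ι c' = ι c := ⟨c, rfl⟩
    simp only [lift, dif_pos h]
    exact hι h.choose_spec
  have hcol : ∀ i < w.length, i ∉ U →
      col (e i) = some (if Even i then lift c else lift d) ∧ X (e i) = false := by
    intro i hi hiU
    have hne : χ (e i) ≠ none := fun h => hiU (by simp [hU, hi, h])
    obtain ⟨n, hn⟩ := Option.ne_none_iff_exists'.mp hne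
    obtain ⟨c', h1, h2, h3⟩ := hχ _ _ hn
    refine ⟨?_, h3⟩
    have h4 := hψ _ (cycle_edge_mem hi) n hn
    rw [halt i hi, ← h2] at h4
    rw [h1, ← hlift c', ← h4]
    split_ifs <;> rfl
  have hgirth : G.girth ≤ w.length := girth_le_length hw
  obtain ⟨n, hn⟩ : ∃ n, w.length = n + 1 := ⟨w.length - 1, by omega⟩
  rcases Nat.lt_or_ge n (3 * L) with hnL | hnL
  · obtain ⟨hf, hsucc⟩ := cycle_getVert_mem_cycleSeqs hw hn
    obtain ⟨a, ha, b, hb, hab⟩ := exists_subset_pair_of_card_le_two (by omega)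
      (Finset.filter_subset _ _) hUcard
    refine hshort n hnL (by omega) _ hf ⟨lift c, lift d, ⟨a, by omega⟩, ⟨b, by omega⟩,
      fun i hia hib => ?_⟩
    have := hcol i.val (by omega) fun h => by
      have := hab h
      rw [mem_insert, mem_singleton] at this
      rcases this with h' | h'
      · exact hia (Fin.ext h')
      · exact hib (Fin.ext h')
    rw [← this.1]
    simp only [he, hsucc]
  · obtain ⟨j, hj, hjU⟩ := exists_window_disjoint hUcard L
    have hjL : (j + 1) * L ≤ 3 * L := Nat.mul_le_mul_right L hj
    have hj1 : (j + 1) * L = j * L + L := Nat.succ_mul j L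
    set b := j * L with hb
    have hmain : ∀ i : Fin L, col s(w.getVert (b + i + 1), w.getVert (b + i + 1 + 1)) =
        some (if Even (b + i + 1) then lift c else lift d) ∧
        X s(w.getVert (b + i + 1), w.getVert (b + i + 1 + 1)) = false := fun i =>
      hcol (b + i + 1) (by have := i.2; omega)
        (hjU (b + i) (by omega) (by have := i.2; omega))
    obtain ⟨i, hi⟩ := hlong (fun i => w.getVert (b + i + 1))
      (fun x y hxy => by
        have h1 : b + x.val + 1 = b + y.val + 1 := hw.getVert_injOn
          (by rw [Set.mem_ofPred_eq]; have := x.2; omega)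
          (by rw [Set.mem_ofPred_eq]; have := y.2; omega) hxy
        exact Fin.ext (by omega))
      (if Even (b + 1) then lift c else lift d) (if Even (b + 1) then lift d else lift c)
      (fun i => by
        have := (hmain i).1
        simp only [Fin.val_castSucc, Fin.val_succ]
        rw [show b + (i.val + 1) + 1 = b + i.val + 1 + 1 by omega, this]
        congr 1
        by_cases h1 : Even b <;> by_cases h2 : Even i.val <;> simp [Nat.even_add, h1, h2])
    have := (hmain i).2
    simp only [Fin.val_castSucc, Fin.val_succ] at hi
    rw [show b + (i.val + 1) + 1 = b + i.val + 1 + 1 by omega, this] at hi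
    exact Bool.false_ne_true hi

end Cycle

section Main

variable {V : Type} [Fintype V] [DecidableEq V] {G : SimpleGraph V} [DecidableRel G.Adj]

theorem not_adj_of_four_le_girth (h : 4 ≤ G.girth) (v u w : V) (hu : G.Adj v u) (hw : G.Adj v w) :
    ¬ G.Adj u w := by
  intro huw
  have hp : (Walk.cons hu (Walk.cons huw Walk.nil)).IsPath := by
    simp [Walk.cons_isPath_iff, hu.ne, huw.ne, hw.ne]
  have hq : (Walk.cons hw Walk.nil).IsPath := by
    simp [Walk.cons_isPath_iff, hw.ne]
  have := congrArg Walk.length (walk_eq_of_length_add_lt_girth hp hq (by simp; omega))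
  simp at this

theorem exists_colouring_of_parameters {Δ C T L m : ℕ} (hΔ : G.IsRegularOfDegree Δ) (hΔ0 : 0 < Δ)
    (hC0 : 0 < C) (hC2 : C ≤ 2 * Δ) (S : V → Finset ℕ)
    (hS : ∀ v, S v ⊆ range C) {a : ℝ} (hSa : ∀ v, ((S v).card : ℝ) ≤ a)
    {N : ℕ → ℕ} {Λ D F q : ℕ → ℝ} (hq : ∀ t, 0 ≤ q t ∧ q t ≤ 1)
    (hΛ0 : Λ 0 ≤ C - 2 * a) (hD0 : (Δ : ℝ) ≤ D 0)
    (hF0 : ∀ v c, (((G.neighborFinset v).filter fun u => c ∈ S u).card : ℝ) ≤ F 0)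
    {r τ : ℝ} (hτ : 0 ≤ τ) (hN : ∀ t < T, N t ≤ Δ) (hDN : ∀ t < T, ⌊D t⌋₊ ≤ N t)
    (hr : ∀ t < T, Real.exp (-(q t * ((1 - q t) ^ N t) ^ 2 * (Λ t - 1))) ≤ r)
    (hΛ' : ∀ t < T, Λ (t + 1) ≤ ((1 - q t) ^ N t) ^ 2 * Λ t - τ)
    (hD' : ∀ t < T, (1 - q t) ^ N t * r * D t + τ ≤ D (t + 1))
    (hF' : ∀ t < T, r * F t + τ ≤ F (t + 1))
    (hm : 2 * m < G.girth) (hm2 : 2 ≤ m) {K : ℝ} (hK : ∑ t : Fin T, q t ≤ K) (hK1 : K ≤ 1)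
    (hL : L ≤ Δ) (hL3 : 3 * L ≤ (Δ + 1) ^ (2 * T + 4))
    (hsum : ((Δ : ℝ) + 1) ^ (2 * T + 4) * (T * ((Δ : ℝ) + 1) ^ (2 * T + 4) *
        (2 * (3 * Δ) * Real.exp (-(τ ^ 2 / (2 * (3 * Δ))))) +
      ∑ n ∈ range (3 * L) with m ≤ n, ((n : ℝ) + 1) * (Δ : ℝ) ^ (n + 1 - m) *
        ((C : ℝ) ^ 2 * (n + 1) ^ 2 * K ^ (n - 1))) ≤ 1 / 4)
    {p : ℝ} (hp0 : 0 ≤ p) (hp1 : p ≤ 1)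
    (hsum' : ((Δ : ℝ) + 1) * ((Δ + 1) * Real.exp (-((p * Δ) ^ 2 / (2 * Δ))) +
      (L + 1) * (C : ℝ) ^ 2 * (1 - p) ^ L) ≤ 1 / 4)
    {b : ℝ} (hb : F T + 2 * p * Δ ≤ b) :
    ∃ χ : Sym2 V → Option ℕ,
      (∀ e : Sym2 V, e ∉ G.edgeSet → χ e = none) ∧
      IsPartialAcyclicEdgeColoring G χ ∧
      (∀ u v : V, G.Adj u v → ∀ c : ℕ, χ s(u, v) = some c → c < C ∧ c ∉ S u ∧ c ∉ S v) ∧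
      (∀ v : V, ∀ c ∈ S v, ((((G.neighborFinset v).filter
        (fun u => χ s(u, v) = none ∧ c ∈ S u)).card : ℝ)) ≤ b) ∧
      (∀ (v : V) (w : G.Walk v v), w.IsCycle →
        CycleCanBecomeBicolored G χ (fun e col => ∀ x y : V, e = s(x, y) → col ∈ S x ∧ col ∈ S y) w →
        3 ≤ (w.edges.filter (fun e => χ e = none)).length) := by
  classical
  let R : V → Fin C → Prop := fun v c => c.val ∈ S v
  let s₀ : NibbleState V (Fin C) := ⟨fun _ => none, fun v c => c.val ∉ S v⟩
  have hs₀ : NibbleInv G R s₀ :=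
    { mem_edgeSet := fun e c h => by simp [s₀] at h
      not_avail := fun e c h => by simp [s₀] at h
      proper := fun e e' c x h => by simp [s₀] at h
      avail := fun v c h => h }
  have hOK : ∀ v, StateOK G R (Λ 0) (D 0) (F 0) s₀ v := by
    intro v
    refine ⟨fun u _ _ => ?_, fun c => ?_, fun c => ?_⟩
    · have h1 : range C \ (S v ∪ S u) ⊆ (freeColors s₀ v u).map Fin.valEmbedding := by
        intro x hx
        rw [mem_sdiff, mem_range, mem_union, not_or] at hx
        exact mem_map.mpr ⟨⟨x, hx.1⟩, mem_freeColors.mpr ⟨hx.2.1, hx.2.2⟩, rfl⟩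
      have h2 := Finset.card_le_card h1
      rw [card_map] at h2
      have h3 := Finset.le_card_sdiff (S v ∪ S u) (range C)
      have h4 := Finset.card_union_le (S v) (S u)
      rw [card_range] at h3
      have h5 : C ≤ (freeColors s₀ v u).card + (S v).card + (S u).card := by omega
      have h6 : (C : ℝ) ≤ (freeColors s₀ v u).card + (S v).card + (S u).card := by exact_mod_cast h5
      linarith [hSa v, hSa u]
    · refine le_trans ?_ hD0
      have h1 : candNbrs G s₀ v c ⊆ G.neighborFinset v := fun u hu => by
        rw [mem_candNbrs] at hu
        rw [mem_neighborFinset]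
        exact hu.1
      have := Finset.card_le_card h1
      rw [card_neighborFinset_eq_degree, hΔ v] at this
      exact_mod_cast this
    · refine le_trans ?_ (hF0 v c.val)
      exact_mod_cast Finset.card_le_card fun u hu => by
        rw [mem_uncolNbrs] at hu
        rw [mem_filter, mem_neighborFinset]
        exact ⟨hu.1, hu.2.2⟩
  have hgirth4 : 4 ≤ G.girth := by omega
  have hP : ∀ t < T, ∀ v, bernoulliProb (fun i : Fin T × NibbleCoord V (Fin C) Δ => q i.1)
      (BadRound G R N Λ D F s₀ t v) ≤ 2 * (3 * Δ) * Real.exp (-(τ ^ 2 / (2 * (3 * Δ)))) := by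
    intro t ht v
    refine prob_badRound_le hq (not_adj_of_four_le_girth hgirth4) ht v (hN t ht) (hDN t ht)
      (by positivity) ?_ hτ (hr t ht) (hΛ' t ht) (hD' t ht) (hF' t ht)
    rw [Fintype.card_fin, card_neighborFinset_eq_degree, hΔ v]
    have : (C : ℝ) ≤ 2 * Δ := by exact_mod_cast hC2
    linarith
  obtain ⟨s, hs, hsOK, hshort⟩ := exists_nibble_colouring hΔ hq (fun _ => rfl) hs₀ hOK hP hm hm2 hK
    hK1 hL3 (by rw [Fintype.card_fin]; exact hsum)
  obtain ⟨X, hX, hlong⟩ := exists_deletion hΔ hΔ0 hs.proper hL hp0 hp1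
    (by rw [Fintype.card_fin]; exact hsum')
  let χ : Sym2 V → Option ℕ := fun e => if X e = true then none else (s.col e).map Fin.val
  have hχ : ∀ e n, χ e = some n → ∃ c : Fin C, s.col e = some c ∧ c.val = n ∧ X e = false := by
    intro e n h
    by_cases hXe : X e = true
    · simp [χ, hXe] at h
    · rw [show χ e = (s.col e).map Fin.val from if_neg hXe] at h
      obtain ⟨c, h1, h2⟩ := Option.map_eq_some_iff.mp h
      exact ⟨c, h1, h2, by simpa using hXe⟩
  have hproper : ∀ e₁ e₂ : Sym2 V, e₁ ≠ e₂ → (∃ x, x ∈ e₁ ∧ x ∈ e₂) → ∀ c : ℕ, χ e₁ = some c →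
      χ e₂ ≠ some c := by
    rintro e₁ e₂ hne ⟨x, hx1, hx2⟩ c h1 h2
    obtain ⟨c1, h1, h1', _⟩ := hχ _ _ h1
    obtain ⟨c2, h2, h2', _⟩ := hχ _ _ h2
    have : c1 = c2 := Fin.ext (h1'.trans h2'.symm)
    exact hne (hs.proper e₁ e₂ c1 x h1 (this ▸ h2) hx1 hx2)
  have hthree := fun {v : V} {w : G.Walk v v} (hw : w.IsCycle) {ψ : Sym2 V → ℕ} =>
    three_le_uncoloured (fun c : Fin C => c.val) Fin.val_injective ⟨0, hC0⟩ hχ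
      (show m < G.girth by omega) hshort hlong hw (ψ := ψ)
  refine ⟨χ, fun e he => ?_, ⟨fun e₁ _ e₂ _ => hproper e₁ e₂, ?_⟩, ?_, ?_, ?_⟩
  · by_contra hne
    obtain ⟨n, hn⟩ := Option.ne_none_iff_exists'.mp hne
    obtain ⟨c, hc, _⟩ := hχ _ _ hn
    exact he (hs.mem_edgeSet _ _ hc)
  · rintro v w hw ⟨c, d, hcd⟩
    have hsome : ∀ e ∈ w.edges, ∃ n, χ e = some n := fun e he =>
      (hcd e he).elim (fun h => ⟨_, h⟩) fun h => ⟨_, h⟩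
    have := hthree hw (ψ := fun e => (χ e).getD 0) (fun e _ n h => by simp [h])
      ⟨c, d, fun e he => (hcd e he).imp (fun h => by simp [h]) fun h => by simp [h]⟩
      (fun e₁ h₁ e₂ h₂ hne hx heq => by
        obtain ⟨n₁, hn₁⟩ := hsome e₁ h₁
        obtain ⟨n₂, hn₂⟩ := hsome e₂ h₂
        simp only [hn₁, hn₂, Option.getD_some] at heq
        exact hproper e₁ e₂ hne hx n₁ hn₁ (heq ▸ hn₂))
    have hnil : w.edges.filter (fun e => χ e = none) = [] := by
      rw [List.filter_eq_nil_iff]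
      intro e he
      obtain ⟨n, hn⟩ := hsome e he
      simp [hn]
    rw [hnil] at this
    simp at this
  · intro u v _ n h
    obtain ⟨c, hc, rfl, _⟩ := hχ _ _ h
    exact ⟨c.2, (hs.not_avail _ _ hc u (Sym2.mem_mk_left u v)).2,
      (hs.not_avail _ _ hc v (Sym2.mem_mk_right u v)).2⟩
  · intro v c hc
    have hcC := mem_range.mp (hS v hc)
    have hsub : (G.neighborFinset v).filter (fun u => χ s(u, v) = none ∧ c ∈ S u) ⊆
        uncolNbrs G R s v ⟨c, hcC⟩ ∪ (G.neighborFinset v).filter fun u => X s(v, u) = true := by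
      intro u hu
      rw [mem_filter, mem_neighborFinset, Sym2.eq_swap] at hu
      rw [mem_union, mem_uncolNbrs, mem_filter, mem_neighborFinset]
      by_cases hXe : X s(v, u) = true
      · exact Or.inr ⟨hu.1, hXe⟩
      · refine Or.inl ⟨hu.1, ?_, hu.2.2⟩
        simpa [χ, hXe] using hu.2.1
    have h1 := (Finset.card_le_card hsub).trans (Finset.card_union_le _ _)
    have h2 : ((((G.neighborFinset v).filter
        (fun u => χ s(u, v) = none ∧ c ∈ S u)).card : ℝ)) ≤ (uncolNbrs G R s v ⟨c, hcC⟩).card +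
        ((G.neighborFinset v).filter fun u => X s(v, u) = true).card := by exact_mod_cast h1
    linarith [hX v, (hsOK v).uncol ⟨c, hcC⟩]
  · rintro v w hw ⟨σ, _, htwo, hprop⟩
    exact hthree hw (ψ := fun e => (χ e).getD (σ e)) (fun e _ n h => by simp [h]) htwo hprop

end Main

section Numerics

theorem exp_neg_le_one_sub_add_sq {x : ℝ} (hx : 0 ≤ x) : Real.exp (-x) ≤ 1 - x + x ^ 2 := by
  rw [Real.exp_neg]
  have h1 : 1 + x ≤ Real.exp x := by linarith [Real.add_one_le_exp x]
  have h2 : (Real.exp x)⁻¹ ≤ (1 + x)⁻¹ := inv_anti₀ (by positivity) h1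
  refine h2.trans ?_
  rw [inv_le_iff_one_le_mul₀ (by positivity)]
  nlinarith [pow_nonneg hx 3]

theorem exists_nibble_constants {ε : ℝ} (hε0 : 0 < ε) (hε1 : ε ≤ 1 / 1000) :
    ∃ θ η δ f r : ℝ, 0 < θ ∧ θ ≤ 1 ∧ 0 < η ∧ η < 1 ∧ 0 < δ ∧ δ ≤ 1 ∧ 0 < f ∧ f < 1 ∧ 0 < r ∧ r < 1 ∧
      1 / (1 - η) ≤ 1 + ε / 18 ∧
      ∀ κ : ℝ, 1 - θ * (1 - η) - δ ≤ κ → κ ≤ Real.exp (-(θ * (1 - η))) →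
        f + δ ≤ κ ^ 2 ∧ κ * r + δ ≤ f ∧ Real.exp (-(κ ^ 2 * (θ - δ))) ≤ r := by
  obtain ⟨θ, hθ⟩ : ∃ θ, θ = ε / 400 := ⟨_, rfl⟩
  have hθ0 : 0 < θ := by rw [hθ]; positivity
  have hθ1 : θ ≤ 1 / 400000 := by rw [hθ]; linarith
  have hε : ε = 400 * θ := by rw [hθ]; ring
  have h2 : 0 < θ ^ 2 := by positivity
  have h3 : θ ^ 3 ≤ 1 / 400000 * θ ^ 2 := by nlinarith
  have h3' : 0 ≤ θ ^ 3 := by positivity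
  have h4 : θ ^ 4 ≤ 1 / 400000 * θ ^ 3 := by nlinarith
  have h4' : 0 ≤ θ ^ 4 := by positivity
  have h5 : θ ^ 5 ≤ 1 / 400000 * θ ^ 4 := by nlinarith
  have h5' : 0 ≤ θ ^ 5 := by positivity
  have h6 : θ ^ 6 ≤ 1 / 400000 * θ ^ 5 := by nlinarith
  have h6' : 0 ≤ θ ^ 6 := by positivity
  have h22 : θ ^ 2 ≤ 1 / 400000 * θ := by nlinarith
  refine ⟨θ, 20 * θ, θ ^ 2 / 10, (1 - θ * (1 - 20 * θ)) ^ 2 - 3 * (θ ^ 2 / 10), 1 - θ + 4 * θ ^ 2,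
    hθ0, by linarith, by linarith, by linarith, by linarith, by linarith, by nlinarith,
    by nlinarith, by nlinarith, by nlinarith, ?_, ?_⟩
  · rw [hε, div_le_iff₀ (by linarith)]
    nlinarith
  · intro κ hlo hhi
    have hx0 : 0 ≤ θ * (1 - 20 * θ) := mul_nonneg hθ0.le (by linarith)
    have hhi' := hhi.trans (exp_neg_le_one_sub_add_sq hx0)
    have hκ0 : 0 ≤ 1 - θ * (1 - 20 * θ) - θ ^ 2 / 10 := by nlinarith
    have hsq : (1 - θ * (1 - 20 * θ) - θ ^ 2 / 10) ^ 2 ≤ κ ^ 2 := pow_le_pow_left₀ hκ0 hlo 2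
    have hκ1 : κ ≤ 1 := by nlinarith
    refine ⟨by nlinarith, ?_, ?_⟩
    · have : κ * (1 - θ + 4 * θ ^ 2) ≤
          (1 - θ * (1 - 20 * θ) + (θ * (1 - 20 * θ)) ^ 2) * (1 - θ + 4 * θ ^ 2) :=
        mul_le_mul_of_nonneg_right hhi' (by nlinarith)
      nlinarith
    · have hκ2 : κ ^ 2 ≤ 1 := pow_le_one₀ (hκ0.trans hlo) hκ1
      have hθδ : 0 ≤ θ - θ ^ 2 / 10 := by linarith
      refine (exp_neg_le_one_sub_add_sq (mul_nonneg (sq_nonneg κ) hθδ)).trans ?_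
      have hy1 : κ ^ 2 * (θ - θ ^ 2 / 10) ≤ θ := by nlinarith
      have hy2 : (κ ^ 2 * (θ - θ ^ 2 / 10)) ^ 2 ≤ θ ^ 2 :=
        pow_le_pow_left₀ (mul_nonneg (sq_nonneg κ) hθδ) hy1 2
      have hy3 := mul_le_mul_of_nonneg_right hsq hθδ
      nlinarith

open Filter in
theorem eventually_mul_pow_mul_exp_le (A : ℝ) {c : ℝ} (hc : 0 < c) (k : ℕ) {b : ℝ} (hb : 0 < b) :
    ∀ᶠ n : ℕ in atTop, A * ((n : ℝ) ^ k * Real.exp (-(c * n))) ≤ b := by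
  have h1 := (Real.tendsto_pow_mul_exp_neg_atTop_nhds_zero k).comp
    (tendsto_natCast_atTop_atTop.const_mul_atTop hc : Tendsto (fun n : ℕ => c * (n : ℝ)) atTop atTop)
  have h2 := h1.const_mul (A / c ^ k)
  rw [mul_zero] at h2
  filter_upwards [h2.eventually_le_const hb] with n hn
  refine le_trans (le_of_eq ?_) hn
  simp only [Function.comp_apply, mul_pow]
  field_simp

open Filter in
theorem eventually_const_mul_log_le (A : ℕ) : ∀ᶠ n : ℕ in atTop, A * Nat.log 2 n ≤ n := by
  have h1 : ∀ᶠ l : ℕ in atTop, (A : ℝ) * (l / 2 ^ l) ≤ 1 := by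
    have := (tendsto_pow_const_div_const_pow_of_one_lt 1 (one_lt_two (α := ℝ))).const_mul (A : ℝ)
    simp only [pow_one, mul_zero] at this
    exact this.eventually_le_const one_pos
  obtain ⟨l₀, hl₀⟩ := eventually_atTop.mp h1
  filter_upwards [eventually_ge_atTop (2 ^ l₀)] with n hn
  have hn0 : n ≠ 0 := (lt_of_lt_of_le (by positivity) hn).ne'
  have h2 := hl₀ (Nat.log 2 n) (Nat.le_log_of_pow_le one_lt_two hn)
  rw [← mul_div_assoc, div_le_one (by positivity)] at h2
  exact (by exact_mod_cast h2 : A * Nat.log 2 n ≤ 2 ^ Nat.log 2 n).trans (Nat.pow_log_le_self 2 hn0)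

end Numerics

section Numerics

open Filter

theorem sum_short_cycle_terms_le {Δ C L m k B : ℕ} (hΔ : 1 ≤ Δ) (hC : C ≤ 2 * Δ) (hL : 3 * L ≤ Δ)
    (hm : 2 ≤ m) (hB : (2 ^ k) ^ (3 * L) ≤ Δ ^ B) :
    ∑ n ∈ range (3 * L) with m ≤ n, ((n : ℝ) + 1) * (Δ : ℝ) ^ (n + 1 - m) *
      ((C : ℝ) ^ 2 * (n + 1) ^ 2 * ((2 : ℝ) ^ k / Δ) ^ (n - 1)) ≤
    4 * (Δ : ℝ) ^ (6 + B) / (Δ : ℝ) ^ (m - 2) := by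
  have hΔ' : (1 : ℝ) ≤ Δ := by exact_mod_cast hΔ
  have hΔ0 : (0 : ℝ) < Δ := by linarith
  have hC' : (C : ℝ) ≤ 2 * Δ := by exact_mod_cast hC
  have hterm : ∀ n ∈ (range (3 * L)).filter (m ≤ ·), ((n : ℝ) + 1) * (Δ : ℝ) ^ (n + 1 - m) *
      ((C : ℝ) ^ 2 * (n + 1) ^ 2 * ((2 : ℝ) ^ k / Δ) ^ (n - 1)) ≤
      4 * (Δ : ℝ) ^ (5 + B) / (Δ : ℝ) ^ (m - 2) := by
    intro n hn
    rw [mem_filter, mem_range] at hn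
    have h1 : (n : ℝ) + 1 ≤ Δ := by exact_mod_cast (show n + 1 ≤ Δ by omega)
    have h3 : ((2 : ℝ) ^ k) ^ (n - 1) ≤ (Δ : ℝ) ^ B := by
      refine le_trans (pow_le_pow_right₀ (one_le_pow₀ one_le_two) (show n - 1 ≤ 3 * L by omega)) ?_
      exact_mod_cast hB
    have h4 : (Δ : ℝ) ^ (n - 1) = (Δ : ℝ) ^ (n + 1 - m) * (Δ : ℝ) ^ (m - 2) := by
      rw [← pow_add]
      congr 1
      omega
    have h5 : ((n : ℝ) + 1) * (Δ : ℝ) ^ (n + 1 - m) *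
        ((C : ℝ) ^ 2 * (n + 1) ^ 2 * ((2 : ℝ) ^ k / Δ) ^ (n - 1)) =
        ((n : ℝ) + 1) ^ 3 * (C : ℝ) ^ 2 * ((2 : ℝ) ^ k) ^ (n - 1) / (Δ : ℝ) ^ (m - 2) := by
      rw [div_pow, h4]
      field_simp
    rw [h5]
    refine div_le_div_of_nonneg_right ?_ (by positivity)
    calc ((n : ℝ) + 1) ^ 3 * (C : ℝ) ^ 2 * ((2 : ℝ) ^ k) ^ (n - 1)
        ≤ (Δ : ℝ) ^ 3 * (2 * Δ) ^ 2 * (Δ : ℝ) ^ B := by gcongr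
      _ = 4 * (Δ : ℝ) ^ (5 + B) := by ring
  refine (Finset.sum_le_card_nsmul _ _ _ hterm).trans ?_
  have hcard : (((range (3 * L)).filter (m ≤ ·)).card : ℝ) ≤ Δ := by
    have := (Finset.card_filter_le (range (3 * L)) (m ≤ ·))
    rw [card_range] at this
    exact_mod_cast this.trans hL
  rw [nsmul_eq_mul]
  calc _ ≤ (Δ : ℝ) * (4 * (Δ : ℝ) ^ (5 + B) / (Δ : ℝ) ^ (m - 2)) := by gcongr
    _ = _ := by ring

theorem eventually_exists_length (R T k : ℕ) (hR : 1 ≤ R) {τ p : ℝ} (hτ : 0 < τ) (hp0 : 0 < p)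
    (hp1 : p < 1) : ∃ m : ℕ, 2 ≤ m ∧ ∀ᶠ Δ : ℕ in atTop, ∀ C : ℕ, C ≤ 2 * Δ →
      ∃ L : ℕ, L ≤ Δ ∧ 3 * L ≤ (Δ + 1) ^ R ∧
      ((Δ : ℝ) + 1) ^ R * (T * ((Δ : ℝ) + 1) ^ R *
        (2 * (3 * Δ) * Real.exp (-((τ * Δ) ^ 2 / (2 * (3 * Δ))))) +
      ∑ n ∈ range (3 * L) with m ≤ n, ((n : ℝ) + 1) * (Δ : ℝ) ^ (n + 1 - m) *
        ((C : ℝ) ^ 2 * (n + 1) ^ 2 * ((2 : ℝ) ^ k / Δ) ^ (n - 1))) ≤ 1 / 4 ∧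
      ((Δ : ℝ) + 1) * ((Δ + 1) * Real.exp (-((p * Δ) ^ 2 / (2 * Δ))) +
        (L + 1) * (C : ℝ) ^ 2 * (1 - p) ^ L) ≤ 1 / 4 := by
  obtain ⟨A, hA⟩ := exists_pow_lt_of_lt_one (show (0 : ℝ) < 1 / 32 by norm_num)
    (show 1 - p < 1 by linarith)
  obtain ⟨B, hB⟩ : ∃ B, B = 3 * k * A := ⟨_, rfl⟩
  refine ⟨R + B + 9, by omega, ?_⟩
  filter_upwards [eventually_const_mul_log_le (3 * A), eventually_ge_atTop 1,
    eventually_ge_atTop (8 * (2 ^ R * 4)), eventually_ge_atTop 4096,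
    eventually_mul_pow_mul_exp_le ((2 ^ R) ^ 2 * T * 6) (show 0 < τ ^ 2 / 6 by positivity)
      (2 * R + 1) (show (0 : ℝ) < 1 / 8 by norm_num),
    eventually_mul_pow_mul_exp_le 4 (show 0 < p ^ 2 / 2 by positivity)
      2 (show (0 : ℝ) < 1 / 8 by norm_num)] with Δ hlog hΔ1 hΔ2 hΔ3 hexp hexp' C hC
  have hΔ' : (1 : ℝ) ≤ Δ := by exact_mod_cast hΔ1
  have hΔ0 : (0 : ℝ) < Δ := by linarith
  have hC' : (C : ℝ) ≤ 2 * Δ := by exact_mod_cast hC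
  have hΔs : (Δ : ℝ) + 1 ≤ 2 * Δ := by linarith
  have h3L : 3 * (A * Nat.log 2 Δ) ≤ Δ := by rw [← mul_assoc]; exact hlog
  refine ⟨A * Nat.log 2 Δ, by omega, ?_, ?_, ?_⟩
  · calc _ ≤ Δ := h3L
      _ ≤ (Δ + 1) ^ 1 := by rw [pow_one]; omega
      _ ≤ _ := Nat.pow_le_pow_right (by omega) hR
  · have hpow : (2 ^ k) ^ (3 * (A * Nat.log 2 Δ)) ≤ Δ ^ B := by
      calc (2 ^ k) ^ (3 * (A * Nat.log 2 Δ)) = (2 ^ Nat.log 2 Δ) ^ B := by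
            rw [← pow_mul, ← pow_mul, hB]
            ring_nf
        _ ≤ _ := Nat.pow_le_pow_left (Nat.pow_log_le_self 2 (by omega)) B
    have hS := sum_short_cycle_terms_le (m := R + B + 9) hΔ1 hC h3L (by omega) hpow
    have h1 : ((Δ : ℝ) + 1) ^ R ≤ 2 ^ R * (Δ : ℝ) ^ R := by
      rw [← mul_pow]
      gcongr
    have h2 : (τ * Δ) ^ 2 / (2 * (3 * Δ)) = τ ^ 2 / 6 * Δ := by
      field_simp
      ring
    have h3 : ((Δ : ℝ) + 1) ^ R * (T * ((Δ : ℝ) + 1) ^ R *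
        (2 * (3 * Δ) * Real.exp (-((τ * Δ) ^ 2 / (2 * (3 * Δ)))))) ≤ 1 / 8 := by
      rw [h2]
      calc _ ≤ (2 ^ R * (Δ : ℝ) ^ R) * (T * (2 ^ R * (Δ : ℝ) ^ R) *
            (2 * (3 * Δ) * Real.exp (-(τ ^ 2 / 6 * Δ)))) := by gcongr
        _ = (2 ^ R) ^ 2 * T * 6 * ((Δ : ℝ) ^ (2 * R + 1) * Real.exp (-(τ ^ 2 / 6 * Δ))) := by ring
        _ ≤ _ := hexp
    have h4 : 2 ^ R * (Δ : ℝ) ^ R * (4 * (Δ : ℝ) ^ (6 + B) / (Δ : ℝ) ^ (R + B + 9 - 2)) ≤ 1 / 8 := by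
      have : R + B + 9 - 2 = R + (6 + B) + 1 := by omega
      rw [this, pow_succ, pow_add _ R]
      have h5 : (8 * (2 ^ R * 4) : ℝ) ≤ Δ := by exact_mod_cast hΔ2
      have h6 : 2 ^ R * (Δ : ℝ) ^ R * (4 * (Δ : ℝ) ^ (6 + B) /
          ((Δ : ℝ) ^ R * (Δ : ℝ) ^ (6 + B) * Δ)) = 2 ^ R * 4 / Δ := by
        field_simp
      rw [h6, div_le_iff₀ hΔ0]
      linarith
    rw [mul_add]
    have h5 := (mul_le_mul h1 hS (Finset.sum_nonneg fun n _ => by positivity)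
      (by positivity)).trans h4
    linarith
  · have h2 : (p * Δ) ^ 2 / (2 * Δ) = p ^ 2 / 2 * Δ := by
      field_simp
    have hq0 : 0 ≤ 1 - p := by linarith
    have hlog' : (Δ : ℝ) ≤ 2 * 2 ^ Nat.log 2 Δ := by
      have := (Nat.lt_pow_succ_log_self (b := 2) one_lt_two Δ).le
      rw [pow_succ'] at this
      exact_mod_cast this
    have hdel : (1 - p) ^ (A * Nat.log 2 Δ) ≤ 32 / (Δ : ℝ) ^ 5 := by
      rw [pow_mul]
      calc ((1 - p) ^ A) ^ Nat.log 2 Δ ≤ (1 / 32) ^ Nat.log 2 Δ :=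
            pow_le_pow_left₀ (by positivity) hA.le _
        _ = 1 / (2 ^ Nat.log 2 Δ) ^ 5 := by
            rw [div_pow, one_pow, ← pow_mul, mul_comm, pow_mul]
            norm_num
        _ ≤ _ := by
            rw [div_le_div_iff₀ (by positivity) (by positivity), one_mul]
            calc (Δ : ℝ) ^ 5 ≤ (2 * 2 ^ Nat.log 2 Δ) ^ 5 := by gcongr
              _ = _ := by rw [mul_pow]; norm_num
    have hL1 : ((A * Nat.log 2 Δ : ℕ) : ℝ) + 1 ≤ 2 * Δ := by
      exact_mod_cast (show A * Nat.log 2 Δ + 1 ≤ 2 * Δ by omega)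
    rw [mul_add, h2]
    have e1 : ((Δ : ℝ) + 1) * ((Δ + 1) * Real.exp (-(p ^ 2 / 2 * Δ))) ≤ 1 / 8 := by
      calc _ ≤ (2 * Δ : ℝ) * ((2 * Δ) * Real.exp (-(p ^ 2 / 2 * Δ))) := by gcongr
        _ = 4 * ((Δ : ℝ) ^ 2 * Real.exp (-(p ^ 2 / 2 * Δ))) := by ring
        _ ≤ _ := hexp'
    have e2 : ((Δ : ℝ) + 1) * ((((A * Nat.log 2 Δ : ℕ) : ℝ) + 1) * (C : ℝ) ^ 2 *
        (1 - p) ^ (A * Nat.log 2 Δ)) ≤ 1 / 8 := by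
      calc _ ≤ (2 * Δ : ℝ) * ((2 * Δ) * (2 * Δ) ^ 2 * (32 / (Δ : ℝ) ^ 5)) := by gcongr
        _ = 512 / Δ := by field_simp; ring
        _ ≤ _ := by
            rw [div_le_iff₀ hΔ0]
            have : (4096 : ℝ) ≤ Δ := by exact_mod_cast hΔ3
            linarith
    linarith

end Numerics

/-- Let `ε ∈ (0, 10⁻³]`. There exist `g = g(ε)` and `Δ₀ = Δ₀(ε)` such that for every
`Δ ≥ Δ₀` and every `Δ`-regular finite simple graph `G` with girth at least `g`, and for
every collection `{S v}` of subsets of `{0, …, ⌊(1+ε)Δ⌋ - 1}` satisfying (A.1)–(A.3),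
there exists a partial acyclic edge colouring `χ` of `G` such that:
(B.1) every coloured edge `uv` has a colour `< ⌊(1+ε)Δ⌋` outside `S u ∪ S v`;
(B.2) for every vertex `v` and colour `c ∈ S v` there are at most `(ε²/18)²·Δ/128`
neighbours `u` of `v` with `uv` uncoloured and `c ∈ S u`;
(B.3) every cycle of `G` that can be made completely bicoloured by assigning to each of
its uncoloured edges `e = uv` a colour from `S u ∩ S v` has at least 3 uncoloured
edges. -/
theorem statement5 :
    ∀ ε : ℝ, 0 < ε → ε ≤ 1 / 1000 →
      ∃ g Δ₀ : ℕ, ∀ Δ : ℕ, Δ₀ ≤ Δ →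
        ∀ (V : Type) [Fintype V] [DecidableEq V] (G : SimpleGraph V) [DecidableRel G.Adj],
          G.IsRegularOfDegree Δ → (g : ℕ∞) ≤ G.girth →
            ∀ S : V → Finset ℕ,
              (∀ v : V, S v ⊆ Finset.range ⌊(1 + ε) * (Δ : ℝ)⌋₊) →
              (∀ v : V, ((S v).card : ℝ) ≤ 4 * ε * Δ / 9) →
              (∀ u v : V, G.Adj u v → ε ^ 2 * Δ / 18 ≤ ((S u ∩ S v).card : ℝ)) →
              (∀ (v : V) (c : ℕ),
                ((((G.neighborFinset v).filter (fun u => c ∈ S u)).card : ℝ)) ≤ ε * Δ / 2) →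
                ∃ χ : Sym2 V → Option ℕ,
                  (∀ e : Sym2 V, e ∉ G.edgeSet → χ e = none) ∧
                  IsPartialAcyclicEdgeColoring G χ ∧
                  (∀ u v : V, G.Adj u v → ∀ c : ℕ, χ s(u, v) = some c →
                    c < ⌊(1 + ε) * (Δ : ℝ)⌋₊ ∧ c ∉ S u ∧ c ∉ S v) ∧
                  (∀ v : V, ∀ c ∈ S v,
                    ((((G.neighborFinset v).filter
                        (fun u => χ s(u, v) = none ∧ c ∈ S u)).card : ℝ))
                      ≤ (ε ^ 2 / 18) ^ 2 * Δ / 128) ∧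
                  (∀ (v : V) (w : G.Walk v v), w.IsCycle →
                    CycleCanBecomeBicolored G χ
                      (fun e col => ∀ x y : V, e = s(x, y) → col ∈ S x ∧ col ∈ S y) w →
                    3 ≤ (w.edges.filter (fun e => χ e = none)).length) := by
  intro ε hε0 hε1
  obtain ⟨θ, η, δ, f, r, hθ0, hθ1, hη0, hη1, hδ0, hδ1, hf0, hf1, hr0, hr1, hη, hκ⟩ :=
    exists_nibble_constants hε0 hε1
  obtain ⟨β, hβ⟩ : ∃ β, β = (ε ^ 2 / 18) ^ 2 / 128 := ⟨_, rfl⟩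
  have hβ0 : 0 < β := by rw [hβ]; positivity
  have hβ1 : β < 1 := by
    have h1 : ε ^ 2 / 18 ≤ 1 := by nlinarith
    have h2 : (ε ^ 2 / 18) ^ 2 ≤ 1 := pow_le_one₀ (by positivity) h1
    rw [hβ]
    linarith
  obtain ⟨T, hT⟩ := exists_pow_lt_of_lt_one (show (0 : ℝ) < β / 4 by positivity) hr1
  obtain ⟨ν, hν⟩ : ∃ ν, ν = β / (4 * (T + 1)) := ⟨_, rfl⟩
  have hν0 : 0 < ν := by rw [hν]; positivity
  have hTν : T * ν ≤ β / 4 := by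
    rw [hν, ← mul_div_assoc, div_le_div_iff₀ (by positivity) (by positivity)]
    nlinarith
  obtain ⟨k, hk⟩ := pow_unbounded_of_one_lt (T * (θ / f ^ T)) (one_lt_two (α := ℝ))
  have hτ0 : 0 < min (δ * f ^ T) ν := lt_min (by positivity) hν0
  obtain ⟨τ, hτ⟩ : ∃ τ, τ = min (δ * f ^ T) ν := ⟨_, rfl⟩
  rw [← hτ] at hτ0
  have hτf : ∀ t ≤ T, τ ≤ δ * f ^ t := fun t ht => by
    rw [hτ]
    refine (min_le_left _ _).trans ?_
    have := pow_le_pow_of_le_one hf0.le hf1.le ht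
    gcongr
  have hτν : τ ≤ ν := by rw [hτ]; exact min_le_right _ _
  obtain ⟨m, hm2, hev⟩ := eventually_exists_length (2 * T + 4) T k (by omega) hτ0
    (show 0 < β / 4 by positivity) (show β / 4 < 1 by linarith)
  obtain ⟨Δ₀, hΔ₀⟩ := Filter.eventually_atTop.mp hev
  refine ⟨2 * m + 1, max (max Δ₀ (2 ^ k)) (max ⌈θ / (f ^ T * δ)⌉₊ ⌈18 / ε⌉₊), ?_⟩
  intro Δ hΔ V _ _ G _ hreg hg S hS hSa _ hSF
  rw [max_le_iff, max_le_iff, max_le_iff] at hΔ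
  obtain ⟨⟨hΔa, hΔb⟩, hΔc, hΔd⟩ := hΔ
  have hΔ1 : 1 ≤ Δ := (Nat.one_le_two_pow).trans hΔb
  have hΔ0 : (0 : ℝ) < Δ := by exact_mod_cast hΔ1
  have hgm : 2 * m < G.girth := by
    have : 2 * m + 1 ≤ G.girth := by exact_mod_cast hg
    omega
  have hΔc' : θ / (f ^ T * Δ) ≤ δ := by
    have h1 := (Nat.le_ceil _).trans (show ((⌈θ / (f ^ T * δ)⌉₊ : ℕ) : ℝ) ≤ Δ by exact_mod_cast hΔc)
    rw [div_le_iff₀ (by positivity)] at h1 ⊢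
    linarith
  have hΔd' : 18 ≤ Δ * ε := by
    have h1 := (Nat.le_ceil _).trans (show ((⌈18 / ε⌉₊ : ℕ) : ℝ) ≤ Δ by exact_mod_cast hΔd)
    rwa [div_le_iff₀ hε0] at h1
  have hC2 : ⌊(1 + ε) * (Δ : ℝ)⌋₊ ≤ 2 * Δ := by
    refine Nat.floor_le_of_le ?_
    push_cast
    gcongr
    linarith
  have hCΔ : Δ ≤ ⌊(1 + ε) * (Δ : ℝ)⌋₊ := Nat.le_floor (by nlinarith)
  have hClo : (1 + ε) * (Δ : ℝ) - 1 < ⌊(1 + ε) * (Δ : ℝ)⌋₊ := Nat.sub_one_lt_floor _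
  obtain ⟨L, hL, hL3, hsum, hsum'⟩ := hΔ₀ Δ hΔa _ hC2
  have h1η : 0 < 1 - η := by linarith
  let Λ : ℕ → ℝ := fun t => f ^ t * Δ / (1 - η)
  let D : ℕ → ℝ := fun t => f ^ t * Δ
  let F : ℕ → ℝ := fun t => (r ^ t * (ε / 2) + t * ν) * Δ
  let N : ℕ → ℕ := fun t => ⌈D t⌉₊
  let q : ℕ → ℝ := fun t => if t < T then θ / Λ t else 0
  have hΛD : ∀ t, D t = Λ t * (1 - η) := fun t => (div_mul_cancel₀ _ h1η.ne').symm
  have hDpos : ∀ t, 0 < D t := fun t => by positivity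
  have hΛpos : ∀ t, 0 < Λ t := fun t => by positivity
  have hDΛ : ∀ t, D t ≤ Λ t := fun t => by
    rw [hΛD]
    nlinarith [hΛpos t]
  have hqle : ∀ t < T, θ / Λ t ≤ θ / (f ^ T * Δ) := fun t ht => by
    refine div_le_div_of_nonneg_left hθ0.le (by positivity) (le_trans ?_ (hDΛ t))
    exact mul_le_mul_of_nonneg_right (pow_le_pow_of_le_one hf0.le hf1.le ht.le) hΔ0.le
  have hqδ : ∀ t < T, θ / Λ t ≤ δ := fun t ht => (hqle t ht).trans hΔc'
  have hqt : ∀ t < T, q t = θ / Λ t := fun t ht => if_pos ht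
  have hq : ∀ t, 0 ≤ q t ∧ q t ≤ 1 := fun t => by
    by_cases ht : t < T
    · rw [hqt t ht]
      exact ⟨(div_pos hθ0 (hΛpos t)).le, (hqδ t ht).trans hδ1⟩
    · simp [q, ht]
  have hqD : ∀ t < T, q t * D t = θ * (1 - η) := fun t ht => by
    rw [hqt t ht, hΛD]
    have := (hΛpos t).ne'
    field_simp
  have hkey : ∀ t < T, f + δ ≤ ((1 - q t) ^ N t) ^ 2 ∧ (1 - q t) ^ N t * r + δ ≤ f ∧
      Real.exp (-(((1 - q t) ^ N t) ^ 2 * (θ - δ))) ≤ r := fun t ht => by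
    refine hκ _ ?_ ?_
    · have h1 := one_add_mul_le_pow (show -2 ≤ -q t by linarith [(hq t).2]) (N t)
      have h2 : (N t : ℝ) ≤ D t + 1 := (Nat.ceil_lt_add_one (hDpos t).le).le
      have h3 := mul_le_mul_of_nonneg_left h2 (hq t).1
      rw [mul_add, hqD t ht, mul_one] at h3
      have h4 : q t ≤ δ := hqt t ht ▸ hqδ t ht
      rw [← sub_eq_add_neg] at h1
      linarith
    · calc (1 - q t) ^ N t ≤ (Real.exp (-q t)) ^ N t :=
            pow_le_pow_left₀ (by linarith [(hq t).2]) (Real.one_sub_le_exp_neg _) _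
        _ = Real.exp (-(q t * N t)) := by rw [← Real.exp_nat_mul]; ring_nf
        _ ≤ _ := by
            rw [Real.exp_le_exp, neg_le_neg_iff, ← hqD t ht]
            exact mul_le_mul_of_nonneg_left (Nat.le_ceil _) (hq t).1
  refine exists_colouring_of_parameters (Λ := Λ) (D := D) (F := F) (N := N) (q := q) (T := T)
    (r := r) (τ := τ * Δ) (K := 2 ^ k / Δ) hreg (by omega) (by omega) hC2 S hS hSa hq ?_ ?_ ?_
    (by positivity) ?_ ?_ ?_ ?_ ?_ ?_ hgm hm2 ?_ ?_ hL hL3 hsum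
    (show 0 ≤ β / 4 by positivity) (show β / 4 ≤ 1 by linarith) hsum' ?_
  · have h1 : Λ 0 = 1 / (1 - η) * Δ := by simp [Λ]; ring
    have h2 : Λ 0 ≤ (1 + ε / 18) * Δ := by rw [h1]; gcongr
    linarith
  · simp [D]
  · intro v c
    refine (hSF v c).trans (le_of_eq ?_)
    simp [F]
    ring
  · intro t _
    refine Nat.ceil_le.mpr ?_
    have := pow_le_one₀ hf0.le hf1.le (n := t)
    exact mul_le_of_le_one_left hΔ0.le this
  · exact fun t _ => Nat.floor_le_ceil _
  · intro t ht
    refine le_trans ?_ (hkey t ht).2.2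
    rw [Real.exp_le_exp, neg_le_neg_iff]
    have h1 : q t * Λ t = θ := by
      rw [hqt t ht]
      exact div_mul_cancel₀ _ (hΛpos t).ne'
    have h2 : q t ≤ δ := hqt t ht ▸ hqδ t ht
    calc ((1 - q t) ^ N t) ^ 2 * (θ - δ) ≤ ((1 - q t) ^ N t) ^ 2 * (q t * Λ t - q t) := by
          gcongr
          linarith
      _ = _ := by ring
  · intro t ht
    have h1 : Λ (t + 1) = f * Λ t := by simp only [Λ]; ring
    have h2 : τ * Δ ≤ δ * Λ t :=
      (mul_le_mul_of_nonneg_right (hτf t ht.le) hΔ0.le).trans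
        (by rw [mul_assoc]; exact mul_le_mul_of_nonneg_left (hDΛ t) hδ0.le)
    have h3 := mul_le_mul_of_nonneg_right (hkey t ht).1 (hΛpos t).le
    linarith
  · intro t ht
    have h1 : D (t + 1) = f * D t := by simp only [D]; ring
    have h2 : τ * Δ ≤ δ * D t :=
      (mul_le_mul_of_nonneg_right (hτf t ht.le) hΔ0.le).trans (le_of_eq (mul_assoc _ _ _))
    have h3 := mul_le_mul_of_nonneg_right (hkey t ht).2.1 (hDpos t).le
    linarith
  · intro t _
    have h1 : F (t + 1) = r * (r ^ t * (ε / 2)) * Δ + t * ν * Δ + ν * Δ := by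
      simp only [F]
      push_cast
      ring
    have h2 : τ * Δ ≤ ν * Δ := mul_le_mul_of_nonneg_right hτν hΔ0.le
    have h3 : r * (t * ν * Δ) ≤ t * ν * Δ := mul_le_of_le_one_left (by positivity) hr1.le
    have h4 : r * F t = r * (r ^ t * (ε / 2)) * Δ + r * (t * ν * Δ) := by
      simp only [F]
      ring
    linarith
  · calc ∑ t : Fin T, q t ≤ ∑ _t : Fin T, θ / (f ^ T * Δ) :=
          Finset.sum_le_sum fun t _ => hqt t t.2 ▸ hqle t t.2
      _ = T * (θ / f ^ T) / Δ := by
          rw [Finset.sum_const, Finset.card_univ, Fintype.card_fin, nsmul_eq_mul]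
          field_simp
      _ ≤ _ := by gcongr
  · rw [div_le_one hΔ0]
    exact_mod_cast hΔb
  · have h1 : r ^ T * (ε / 2) ≤ β / 4 := by
      have := mul_le_of_le_one_right (pow_nonneg hr0.le T) (show ε / 2 ≤ 1 by linarith)
      linarith
    have h2 : F T ≤ (β / 4 + β / 4) * Δ :=
      mul_le_mul_of_nonneg_right (add_le_add h1 hTν) hΔ0.le
    have h3 : (ε ^ 2 / 18) ^ 2 * Δ / 128 = β * Δ := by
      rw [hβ]
      ring
    rw [h3]
    linarith
end
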